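/- arXiv:1407.5204 — 2 statements merged into one kernel-verified Lean document; each statement's English description precedes it below -/
import Mathlib

section
/- There exist a Peano curve γ : [0,∞) → ℝ² and a continuous line field Λ on the punctured plane ℝ² \ {γ(0)} (i.e., a continuous map from ℝ² \ {γ(0)} to the real projective line of one-dimensional linear subspaces of ℝ²) such that for every t > 0 the boundary of the footprint γ([0,t]) is the image of a C^∞ embedding β_t of the circle 𝕋 = ℝ/2πℤ into ℝ², this boundary contains the point γ(t), and for every θ ∈ 𝕋 the tangent line of β_t at θ (the span of β_t′(θ), which is nonzero) equals Λ(β_t(θ)). -/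
/-- The quotient topology on the real projective line, induced from `ℝ² \\ {0}`. -/
noncomputable instance : TopologicalSpace (Projectivization ℝ (EuclideanSpace ℝ (Fin 2))) :=
  inferInstanceAs
    (TopologicalSpace (Quotient (projectivizationSetoid ℝ (EuclideanSpace ℝ (Fin 2)))))

open Filter Topology Set

/-- Quantitative averaging lemma: a fast oscillation decouples from a continuous amplitude. -/
lemma eventually_norm_integral_mul_comp_sub_le {φ ψ : ℝ → ℂ} (hφ : Continuous φ)
    (hψ : Continuous ψ) (hψp : Function.Periodic ψ 1) (hφ1 : ∀ s, ‖φ s‖ ≤ 1)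
    (hψ1 : ∀ s, ‖ψ s‖ ≤ 1) {ε : ℝ} (hε : 0 < ε) :
    ∀ᶠ M : ℕ in atTop, ∀ t ∈ Icc (0 : ℝ) 1,
      ‖(∫ s in (0 : ℝ)..t, φ s * ψ (M * s)) - (∫ v in (0 : ℝ)..1, ψ v) * ∫ s in (0 : ℝ)..t, φ s‖
        ≤ ε := by
  have hu : UniformContinuousOn φ (Icc 0 2) :=
    isCompact_Icc.uniformContinuousOn_of_continuous hφ.continuousOn
  obtain ⟨δ, hδ, hu⟩ := Metric.uniformContinuousOn_iff.1 hu (ε / 2) (half_pos hε)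
  have h1 : Tendsto (fun M : ℕ => 1 / (M : ℝ)) atTop (𝓝 0) := tendsto_one_div_atTop_nhds_zero_nat
  filter_upwards [eventually_gt_atTop 0, h1.eventually_lt_const hδ,
    h1.eventually_lt_const (show 0 < ε / 4 by positivity)] with M hM0 hMδ hMε t ht
  have hM : (1 : ℝ) ≤ M := by exact_mod_cast hM0
  have hMpos : (0 : ℝ) < M := by linarith
  set I : ℝ → ℂ := fun v => ∫ s in (0 : ℝ)..t, φ s * ψ (M * s + v) with hI
  have hIc : Continuous I := by
    apply intervalIntegral.continuous_parametric_intervalIntegral_of_continuous'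
    fun_prop
  have hmean : ∀ a, ∫ v in (0 : ℝ)..1, ψ (a + v) = ∫ v in (0 : ℝ)..1, ψ v := fun a => by
    rw [intervalIntegral.integral_comp_add_left]
    simpa using hψp.intervalIntegral_add_eq a 0
  have havg : ∫ v in (0 : ℝ)..1, I v = (∫ v in (0 : ℝ)..1, ψ v) * ∫ s in (0 : ℝ)..t, φ s := by
    rw [hI, MeasureTheory.intervalIntegral_intervalIntegral_swap]
    · simp_rw [intervalIntegral.integral_const_mul, hmean, intervalIntegral.integral_mul_const]
      ring
    · have : Continuous (fun p : ℝ × ℝ => φ p.2 * ψ (M * p.2 + p.1)) := by fun_prop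
      exact (this.continuousOn.integrableOn_compact
        (isCompact_uIcc.prod isCompact_uIcc)).mono_set
        (prod_mono uIoc_subset_uIcc uIoc_subset_uIcc)
  have hdiff : ∀ v ∈ Icc (0 : ℝ) 1, ‖I 0 - I v‖ ≤ ε := by
    intro v hv
    set h := v / M with hh
    have hh0 : 0 ≤ h := div_nonneg hv.1 hMpos.le
    have hh1 : h ≤ 1 / M := by rw [hh]; gcongr; exact hv.2
    have hh2 : h ≤ 1 := hh1.trans (by rw [div_le_one hMpos]; exact hM)
    set G : ℝ → ℂ := fun s => φ s * ψ (M * s) with hG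
    have hGc : Continuous G := by fun_prop
    have hG1 : ∀ s, ‖G s‖ ≤ 1 := fun s => by
      rw [hG]; simpa using mul_le_mul (hφ1 s) (hψ1 _) (norm_nonneg _) zero_le_one
    have e1 : I v = (∫ s in (0 : ℝ)..t, (φ s - φ (s + h)) * ψ (M * s + v))
        + ∫ s in (0 : ℝ)..t, G (s + h) := by
      rw [← intervalIntegral.integral_add]
      · refine intervalIntegral.integral_congr fun s _ => ?_
        have : (M : ℝ) * (s + h) = M * s + v := by rw [hh]; field_simp
        simp only [hG, this]; ring
      · exact Continuous.intervalIntegrable (by fun_prop) _ _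
      · exact Continuous.intervalIntegrable (by fun_prop) _ _
    have e2 : ∫ s in (0 : ℝ)..t, G (s + h) =
        I 0 + (∫ s in t..t + h, G s) - ∫ s in (0 : ℝ)..h, G s := by
      rw [intervalIntegral.integral_comp_add_right, zero_add]
      have hi : ∀ a b, IntervalIntegrable G MeasureTheory.volume a b :=
        fun a b => hGc.intervalIntegrable a b
      have a1 := intervalIntegral.integral_add_adjacent_intervals (hi 0 h) (hi h (t + h))
      have a2 := intervalIntegral.integral_add_adjacent_intervals (hi 0 t) (hi t (t + h))
      have : I 0 = ∫ s in (0 : ℝ)..t, G s := by simp [hI, hG]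
      rw [this, a2, ← a1]; ring
    have b1 : ‖∫ s in (0 : ℝ)..t, (φ s - φ (s + h)) * ψ (M * s + v)‖ ≤ ε / 2 * |t - 0| := by
      apply intervalIntegral.norm_integral_le_of_norm_le_const
      intro s hs
      rw [uIoc_of_le ht.1] at hs
      have hd : dist (φ s) (φ (s + h)) < ε / 2 := by
        apply hu s ⟨hs.1.le, by linarith [hs.2, ht.2]⟩ (s + h)
          ⟨by linarith [hs.1], by linarith [hs.2, ht.2]⟩
        rw [Real.dist_eq, abs_sub_comm, add_sub_cancel_left, abs_of_nonneg hh0]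
        linarith
      rw [dist_eq_norm] at hd
      rw [norm_mul]
      nlinarith [hψ1 (M * s + v), norm_nonneg (ψ (M * s + v)), norm_nonneg (φ s - φ (s + h))]
    have b2 : ‖∫ s in t..t + h, G s‖ ≤ 1 * |t + h - t| :=
      intervalIntegral.norm_integral_le_of_norm_le_const fun s _ => hG1 s
    have b3 : ‖∫ s in (0 : ℝ)..h, G s‖ ≤ 1 * |h - 0| :=
      intervalIntegral.norm_integral_le_of_norm_le_const fun s _ => hG1 s
    rw [sub_zero, abs_of_nonneg ht.1] at b1
    rw [add_sub_cancel_left, abs_of_nonneg hh0] at b2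
    rw [sub_zero, abs_of_nonneg hh0] at b3
    have : I 0 - I v = -(∫ s in (0 : ℝ)..t, (φ s - φ (s + h)) * ψ (M * s + v))
        - (∫ s in t..t + h, G s) + ∫ s in (0 : ℝ)..h, G s := by
      rw [e1, e2]; ring
    rw [this]
    refine (norm_add_le _ _).trans ((add_le_add_left (norm_sub_le _ _) _).trans ?_)
    rw [norm_neg]
    nlinarith [ht.2]
  have hI0 : ∫ s in (0 : ℝ)..t, φ s * ψ (M * s) = I 0 := by simp [hI]
  have : I 0 - ∫ v in (0 : ℝ)..1, I v = ∫ v in (0 : ℝ)..1, (I 0 - I v) := by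
    rw [intervalIntegral.integral_sub (by simp) (hIc.intervalIntegrable _ _)]
    simp
  rw [hI0, ← havg, this]
  refine (intervalIntegral.norm_integral_le_of_norm_le_const (C := ε) fun v hv => ?_).trans
    (by simp)
  rw [uIoc_of_le zero_le_one] at hv
  exact hdiff v ⟨hv.1.le, hv.2⟩

/-- The triangle wave of period `1` with values in `[0, 1]`. -/
noncomputable def triangleWave (u : ℝ) : ℝ := 2 * ‖(u : UnitAddCircle)‖

lemma continuous_triangleWave : Continuous triangleWave :=
  continuous_const.mul (continuous_norm.comp (AddCircle.continuous_mk' 1))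

lemma triangleWave_periodic : Function.Periodic triangleWave 1 := fun u => by
  simp [triangleWave]

lemma triangleWave_nonneg (u : ℝ) : 0 ≤ triangleWave u := by
  unfold triangleWave; positivity

lemma triangleWave_le_one (u : ℝ) : triangleWave u ≤ 1 := by
  rw [triangleWave, UnitAddCircle.norm_eq]
  linarith [abs_sub_round u]

lemma triangleWave_of_mem {u : ℝ} (hu : |u| ≤ 1 / 2) : triangleWave u = 2 * |u| := by
  rw [triangleWave]
  congr 1
  exact (AddCircle.norm_coe_eq_abs_iff (1 : ℝ) (x := u) one_ne_zero).2 (by simpa using hu)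

lemma norm_integral_cexp_triangleWave_le {y : ℝ} (hy : 0 < y) :
    ‖∫ u in (0 : ℝ)..1, Complex.exp (-(Complex.I * (y * triangleWave u : ℝ)))‖ ≤ 2 / y := by
  set F : ℝ → ℂ := fun u => Complex.exp (-(Complex.I * (y * triangleWave u : ℝ))) with hF
  have hFc : Continuous F := by
    have := continuous_triangleWave
    fun_prop
  have hFp : Function.Periodic F 1 := fun u => by simp [hF, triangleWave_periodic u]
  have hFe : ∀ u, F (-u) = F u := fun u => by
    simp [hF, triangleWave]
  have h1 : ∫ u in (0 : ℝ)..1, F u = ∫ u in (-(1 / 2) : ℝ)..1 / 2, F u := by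
    have := hFp.intervalIntegral_add_eq 0 (-(1 / 2))
    norm_num at this ⊢
    exact this
  have h2 : ∫ u in (-(1 / 2) : ℝ)..0, F u = ∫ u in (0 : ℝ)..1 / 2, F u := by
    have := intervalIntegral.integral_comp_neg (a := 0) (b := 1 / 2) F
    simp only [hFe, neg_zero] at this
    exact this.symm
  have h3 : ∫ u in (0 : ℝ)..1 / 2, F u
      = ∫ u in (0 : ℝ)..1 / 2, Complex.exp (-(Complex.I * (2 * y : ℝ)) * (u : ℝ)) := by
    refine intervalIntegral.integral_congr fun u hu => ?_
    rw [uIcc_of_le (by norm_num)] at hu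
    have hu' : |u| = u := abs_of_nonneg hu.1
    simp only [hF]
    rw [triangleWave_of_mem (by rw [hu']; exact hu.2), hu']
    congr 1
    push_cast
    ring
  have hc : (-(Complex.I * (2 * y : ℝ)) : ℂ) ≠ 0 := by simp [hy.ne']
  rw [h1, ← intervalIntegral.integral_add_adjacent_intervals (hFc.intervalIntegrable _ 0)
    (hFc.intervalIntegrable 0 _), h2, h3, integral_exp_mul_complex hc, ← two_mul, norm_mul,
    norm_div]
  have hn : ‖(-(Complex.I * (2 * y : ℝ)) : ℂ)‖ = 2 * y := by
    simp [abs_of_pos hy]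
  have hnum : ‖Complex.exp (-(Complex.I * (2 * y : ℝ)) * ((1 / 2 : ℝ) : ℂ))
      - Complex.exp (-(Complex.I * (2 * y : ℝ)) * ((0 : ℝ) : ℂ))‖ ≤ 2 := by
    refine (norm_sub_le _ _).trans ?_
    rw [Complex.norm_exp, Complex.norm_exp]
    simp
    norm_num
  rw [hn, Complex.norm_ofNat]
  calc 2 * (_ / (2 * y)) ≤ 2 * (2 / (2 * y)) := by gcongr
    _ = 2 / y := by field_simp

lemma norm_cexp_neg_I_mul (a : ℝ) : ‖Complex.exp (-(Complex.I * (a : ℝ)))‖ = 1 := by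
  rw [Complex.norm_exp]; simp

/-- The truncated exponential sums `∫₀ᵗ exp (-i k ξ(s)) ds` of a path `ξ`. -/
noncomputable def pathExpIntegral (ξ : ℝ → ℝ) (k : ℕ) (t : ℝ) : ℂ :=
  ∫ s in (0 : ℝ)..t, Complex.exp (-(Complex.I * (k * ξ s : ℝ)))

lemma norm_pathExpIntegral_le_one (ξ : ℝ → ℝ) (k : ℕ) {t : ℝ} (ht : t ∈ Icc (0 : ℝ) 1) :
    ‖pathExpIntegral ξ k t‖ ≤ 1 := by
  refine (intervalIntegral.norm_integral_le_of_norm_le_const (C := 1) fun s _ =>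
    (norm_cexp_neg_I_mul _).le).trans ?_
  rw [sub_zero, abs_of_nonneg ht.1, one_mul]
  exact ht.2

lemma exists_perturbation_pathExpIntegral_le {η : ℝ → ℝ} (hη : Continuous η)
    (hηp : Function.Periodic η 1) {a : ℝ} (ha : 0 < a) (K : ℕ) {ε : ℝ} (hε : 0 < ε) :
    ∃ η' : ℝ → ℝ, (Continuous η' ∧ Function.Periodic η' 1) ∧ (∀ s, |η' s - η s| ≤ a) ∧
      ∀ k : ℕ, 1 ≤ k → k ≤ K → ∀ t ∈ Icc (0 : ℝ) 1,
        ‖pathExpIntegral η' k t‖ ≤ min 1 (2 / (k * a)) * ‖pathExpIntegral η k t‖ + ε := by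
  have hT := continuous_triangleWave
  have key : ∀ᶠ M : ℕ in atTop, ∀ k ∈ Finset.Icc 1 K, ∀ t ∈ Icc (0 : ℝ) 1,
      ‖(∫ s in (0 : ℝ)..t, Complex.exp (-(Complex.I * (k * η s : ℝ))) *
          Complex.exp (-(Complex.I * (k * a * triangleWave (M * s) : ℝ)))) -
        (∫ v in (0 : ℝ)..1, Complex.exp (-(Complex.I * (k * a * triangleWave v : ℝ)))) *
          pathExpIntegral η k t‖ ≤ ε := by
    rw [eventually_all_finset]
    intro k _
    refine eventually_norm_integral_mul_comp_sub_le
      (φ := fun s => Complex.exp (-(Complex.I * (k * η s : ℝ))))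
      (ψ := fun v => Complex.exp (-(Complex.I * (k * a * triangleWave v : ℝ))))
      (by fun_prop) (by fun_prop) (fun u => ?_) (fun s => (norm_cexp_neg_I_mul _).le)
      (fun s => (norm_cexp_neg_I_mul _).le) hε
    simp only [triangleWave_periodic u]
  obtain ⟨M, hM⟩ := key.exists
  refine ⟨fun s => η s + a * triangleWave (M * s), ⟨by fun_prop, fun s => ?_⟩, fun s => ?_,
    fun k hk1 hkK t ht => ?_⟩
  · have := (triangleWave_periodic.nat_mul M) (M * s)
    simp only [mul_one] at this
    simp only [hηp s, mul_add, mul_one, this]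
  · rw [add_sub_cancel_left, abs_of_nonneg (mul_nonneg ha.le (triangleWave_nonneg _))]
    nlinarith [triangleWave_le_one (M * s)]
  · have h := hM k (Finset.mem_Icc.2 ⟨hk1, hkK⟩) t ht
    have e : (∫ s in (0 : ℝ)..t, Complex.exp (-(Complex.I * (k * η s : ℝ))) *
          Complex.exp (-(Complex.I * (k * a * triangleWave (M * s) : ℝ)))) =
        pathExpIntegral (fun s => η s + a * triangleWave (M * s)) k t := by
      refine intervalIntegral.integral_congr fun s _ => ?_
      simp only [← Complex.exp_add]
      congr 1
      push_cast
      ring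
    rw [e] at h
    set m := ∫ v in (0 : ℝ)..1, Complex.exp (-(Complex.I * (k * a * triangleWave v : ℝ)))
    have hk0 : (0 : ℝ) < k := by exact_mod_cast hk1
    have hm1 : ‖m‖ ≤ 1 := by
      refine (intervalIntegral.norm_integral_le_of_norm_le_const (C := 1) fun s _ =>
        (norm_cexp_neg_I_mul _).le).trans (by simp)
    have hm2 : ‖m‖ ≤ 2 / (k * a) := norm_integral_cexp_triangleWave_le (mul_pos hk0 ha)
    have h2 := norm_le_norm_sub_add (pathExpIntegral (fun s => η s + a * triangleWave (M * s)) k t)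
      (m * pathExpIntegral η k t)
    rw [norm_mul] at h2
    have h3 := mul_le_mul_of_nonneg_right (le_min hm1 hm2) (norm_nonneg (pathExpIntegral η k t))
    linarith

lemma le_prod_add_sum_of_le_mul_add {B : ℕ → ℝ} {q ε : ℕ → ℝ} (hB0 : B 0 ≤ 1)
    (hq0 : ∀ n, 0 ≤ q n) (hq1 : ∀ n, q n ≤ 1) (hε : ∀ n, 0 ≤ ε n)
    (h : ∀ n, B (n + 1) ≤ q n * B n + ε n) (n : ℕ) :
    B n ≤ ∏ j ∈ Finset.range n, q j + ∑ j ∈ Finset.range n, ε j := by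
  induction n with
  | zero => simpa using hB0
  | succ n ih =>
    rw [Finset.prod_range_succ, Finset.sum_range_succ]
    have h1 := mul_le_mul_of_nonneg_left ih (hq0 n)
    have h2 : q n * ∑ j ∈ Finset.range n, ε j ≤ ∑ j ∈ Finset.range n, ε j :=
      mul_le_of_le_one_left (Finset.sum_nonneg fun j _ => hε j) (hq1 n)
    nlinarith [h n]

/-- A continuous periodic path whose truncated exponential sums decay faster than any power. -/
theorem exists_path_pathExpIntegral_rapidly_decaying :
    ∃ ξ : ℝ → ℝ, Continuous ξ ∧ Function.Periodic ξ 1 ∧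
      (∀ Q : ℕ, ∃ C : ℝ, ∀ k : ℕ, 1 ≤ k → ∀ t ∈ Icc (0 : ℝ) 1,
        (k : ℝ) ^ Q * ‖pathExpIntegral ξ k t‖ ≤ C) ∧
      ∀ k : ℕ, 1 ≤ k → ∀ t ∈ Icc (0 : ℝ) 1, (k : ℝ) ^ 2 * ‖pathExpIntegral ξ k t‖ ≤ 1 / 16 := by
  set a : ℕ → ℝ := fun n => 32 * (1 / 2) ^ n with ha
  set ε : ℕ → ℝ := fun n => 1 / 2 ^ 15 * (1 / 2) ^ n / 4 ^ (n ^ 2) with hε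
  have ha0 : ∀ n, 0 < a n := fun n => by positivity
  have hε0 : ∀ n, 0 < ε n := fun n => by positivity
  choose! S hS1 hS2 hS3 using fun (n : ℕ) (η : ℝ → ℝ)
    (h : Continuous η ∧ Function.Periodic η 1) =>
      exists_perturbation_pathExpIntegral_le h.1 h.2 (ha0 n) (4 ^ n) (hε0 n)
  set X : ℕ → ℝ → ℝ := fun n => Nat.rec (fun _ => 0) (fun n η => S n η) n with hX
  have hX0 : ∀ s, X 0 s = 0 := fun s => rfl
  have hXs : ∀ n, X (n + 1) = S n (X n) := fun n => rfl
  have hXc : ∀ n, Continuous (X n) ∧ Function.Periodic (X n) 1 := by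
    intro n
    induction n with
    | zero => exact ⟨continuous_const, fun _ => rfl⟩
    | succ n ih => rw [hXs]; exact hS1 n _ ih
  have hXd : ∀ n s, |X (n + 1) s - X n s| ≤ a n := fun n s => by
    rw [hXs]; exact hS2 n _ (hXc n) s
  have has : Summable a := summable_geometric_two.mul_left 32
  -- the uniform limit of the approximations
  have hsum : ∀ s, Summable fun n => X (n + 1) s - X n s := fun s =>
    Summable.of_norm_bounded has fun n => hXd n s
  set ξ : ℝ → ℝ := fun s => ∑' n, (X (n + 1) s - X n s) with hξ
  have hξc : Continuous ξ := continuous_tsum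
    (fun n => (hXc (n + 1)).1.sub (hXc n).1) has fun n s => hXd n s
  have hξp : Function.Periodic ξ 1 := fun s => by
    simp only [hξ, (hXc _).2 s]
  have hlim : ∀ s, Tendsto (fun n => X n s) atTop (𝓝 (ξ s)) := fun s => by
    have := (hsum s).hasSum.tendsto_sum_nat
    simp only [Finset.sum_range_sub (fun n => X n s), hX0, sub_zero] at this
    exact this
  have hAlim : ∀ k t, Tendsto (fun n => pathExpIntegral (X n) k t) atTop
      (𝓝 (pathExpIntegral ξ k t)) := fun k t => by
    refine intervalIntegral.tendsto_integral_filter_of_dominated_convergence (fun _ => 1)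
      (Eventually.of_forall fun n => ?_) (Eventually.of_forall fun n => ?_) (by simp) ?_
    · have := (hXc n).1
      exact Continuous.aestronglyMeasurable (by fun_prop)
    · exact Eventually.of_forall fun s _ => (norm_cexp_neg_I_mul _).le
    · refine Eventually.of_forall fun s _ => ?_
      have hc : Continuous fun y : ℝ => Complex.exp (-(Complex.I * (k * y : ℝ))) := by fun_prop
      exact (hc.tendsto _).comp (hlim s)
  have hstep : ∀ n k : ℕ, 1 ≤ k → k ≤ 4 ^ n → ∀ t ∈ Icc (0 : ℝ) 1,
      ‖pathExpIntegral (X (n + 1)) k t‖ ≤ min 1 (2 / (k * a n)) * ‖pathExpIntegral (X n) k t‖ + ε n :=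
    fun n k hk1 hk t ht => by rw [hXs]; exact hS3 n _ (hXc n) k hk1 hk t ht
  have hεQ : ∀ Q n : ℕ, (4 : ℝ) ^ (n * Q) * ε n ≤ 4 ^ (Q ^ 2) * (1 / 2 ^ 15) * (1 / 2) ^ n := by
    intro Q n
    have h1 : n * Q ≤ n ^ 2 + Q ^ 2 := by nlinarith [sq_nonneg ((n : ℤ) - Q)]
    have h2 : (4 : ℝ) ^ (n * Q) ≤ 4 ^ (n ^ 2) * 4 ^ (Q ^ 2) := by
      rw [← pow_add]; exact pow_le_pow_right₀ (by norm_num) h1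
    calc (4 : ℝ) ^ (n * Q) * ε n ≤ (4 ^ (n ^ 2) * 4 ^ (Q ^ 2)) * ε n := by
          gcongr
      _ = 4 ^ (Q ^ 2) * (1 / 2 ^ 15) * (1 / 2) ^ n := by simp only [hε]; field_simp
  have main : ∀ Q k : ℕ, 1 ≤ k → ∀ t ∈ Icc (0 : ℝ) 1, (k : ℝ) ^ Q * ‖pathExpIntegral ξ k t‖ ≤
      4 ^ Q * ∏ j ∈ Finset.range (2 * Q), (2 ^ j / 16 : ℝ) + 4 ^ (Q ^ 2) * (1 / 2 ^ 15) * 2 := by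
    intro Q k hk t ht
    have hk0 : (0 : ℝ) < k := by exact_mod_cast hk
    obtain ⟨N, hkN, hNk⟩ : ∃ N : ℕ, k ≤ 4 ^ N ∧ 4 ^ N ≤ 4 * k := by
      refine ⟨Nat.clog 4 k, Nat.le_pow_clog (by norm_num) k, ?_⟩
      rcases hk.eq_or_lt with rfl | hk2
      · simp
      · have h1 := Nat.pow_pred_clog_lt_self (b := 4) (by norm_num) hk2
        have h2 : 0 < Nat.clog 4 k := Nat.clog_pos (by norm_num) hk2
        rw [← Nat.succ_pred_eq_of_pos h2, pow_succ]
        omega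
    have hkN' : (k : ℝ) ≤ 4 ^ N := by exact_mod_cast hkN
    have hNk' : (4 : ℝ) ^ N ≤ 4 * k := by exact_mod_cast hNk
    set q : ℕ → ℝ := fun m => min 1 (2 / (k * a (N + m))) with hq
    have hq0 : ∀ m, 0 ≤ q m := fun m =>
      le_min zero_le_one (div_nonneg two_pos.le (mul_pos hk0 (ha0 _)).le)
    have hq1 : ∀ m, q m ≤ 1 := fun m => min_le_left _ _
    have hq2 : ∀ m, q m ≤ 2 ^ N / k * (2 ^ m / 16) := fun m => by
      refine (min_le_right _ _).trans (le_of_eq ?_)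
      simp only [ha, one_div, inv_pow, pow_add]
      field_simp
      norm_num
    have hprod : ∀ m, 2 * Q ≤ m → (k : ℝ) ^ Q * ∏ j ∈ Finset.range m, q j ≤
        4 ^ Q * ∏ j ∈ Finset.range (2 * Q), (2 ^ j / 16 : ℝ) := fun m hm => by
      have h1 : ∏ j ∈ Finset.range m, q j ≤ ∏ j ∈ Finset.range (2 * Q), q j :=
        Finset.prod_le_prod_of_subset_of_le_one (Finset.range_mono hm) (fun i _ => hq0 i)
          fun i _ _ => hq1 i
      have h2 : ∏ j ∈ Finset.range (2 * Q), q j ≤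
          ∏ j ∈ Finset.range (2 * Q), (2 ^ N / k * (2 ^ j / 16) : ℝ) :=
        Finset.prod_le_prod (fun i _ => hq0 i) fun i _ => hq2 i
      rw [Finset.prod_mul_distrib, Finset.prod_const, Finset.card_range] at h2
      have h3 : (k : ℝ) ^ Q * (2 ^ N / k) ^ (2 * Q) = (4 ^ N / k) ^ Q := by
        rw [pow_mul, ← mul_pow]
        congr 1
        rw [div_pow, ← pow_mul, mul_comm N 2, pow_mul]
        norm_num
        field_simp
      have h4 : (4 ^ N / k : ℝ) ^ Q ≤ 4 ^ Q := by
        gcongr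
        rwa [div_le_iff₀ hk0]
      calc _ ≤ (k : ℝ) ^ Q * ((2 ^ N / k) ^ (2 * Q) *
              ∏ j ∈ Finset.range (2 * Q), (2 ^ j / 16 : ℝ)) := by
            gcongr; exact h1.trans h2
        _ = (4 ^ N / k) ^ Q * ∏ j ∈ Finset.range (2 * Q), (2 ^ j / 16 : ℝ) := by
            rw [← h3]; ring
        _ ≤ _ := by gcongr
    have herr : ∀ m, (k : ℝ) ^ Q * ∑ j ∈ Finset.range m, ε (N + j) ≤
        4 ^ (Q ^ 2) * (1 / 2 ^ 15) * 2 := fun m => by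
      calc (k : ℝ) ^ Q * ∑ j ∈ Finset.range m, ε (N + j)
          = ∑ j ∈ Finset.range m, (k : ℝ) ^ Q * ε (N + j) := Finset.mul_sum _ _ _
        _ ≤ ∑ j ∈ Finset.range m, 4 ^ (Q ^ 2) * (1 / 2 ^ 15) * (1 / 2 : ℝ) ^ j := by
            refine Finset.sum_le_sum fun j _ => ?_
            have h1 : (k : ℝ) ^ Q ≤ 4 ^ ((N + j) * Q) := by
              rw [pow_mul]
              gcongr
              exact hkN'.trans (pow_le_pow_right₀ (by norm_num) (by omega))
            have h2 : (1 / 2 : ℝ) ^ (N + j) ≤ (1 / 2) ^ j :=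
              pow_le_pow_of_le_one (by norm_num) (by norm_num) (by omega)
            calc _ ≤ 4 ^ ((N + j) * Q) * ε (N + j) := by gcongr
              _ ≤ _ := hεQ Q (N + j)
              _ ≤ _ := by gcongr
        _ = 4 ^ (Q ^ 2) * (1 / 2 ^ 15) * ∑ j ∈ Finset.range m, (1 / 2 : ℝ) ^ j := by
            rw [Finset.mul_sum]
        _ ≤ _ := by
            gcongr
            exact sum_geometric_two_le m
    have hb := le_prod_add_sum_of_le_mul_add (B := fun m => ‖pathExpIntegral (X (N + m)) k t‖)
      (q := q) (ε := fun m => ε (N + m)) (norm_pathExpIntegral_le_one _ _ ht) hq0 hq1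
      (fun m => (hε0 _).le) fun m => hstep (N + m) k hk
        (hkN.trans (Nat.pow_le_pow_right (by norm_num) (by omega))) t ht
    have hl : Tendsto (fun m => (k : ℝ) ^ Q * ‖pathExpIntegral (X (N + m)) k t‖) atTop
        (𝓝 ((k : ℝ) ^ Q * ‖pathExpIntegral ξ k t‖)) := by
      have h1 : Tendsto (fun m : ℕ => N + m) atTop atTop :=
        tendsto_atTop_mono (fun m => Nat.le_add_left m N) tendsto_id
      exact (((hAlim k t).comp h1).norm).const_mul _
    refine le_of_tendsto hl ?_
    filter_upwards [eventually_ge_atTop (2 * Q)] with m hm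
    have h1 : (k : ℝ) ^ Q * ‖pathExpIntegral (X (N + m)) k t‖ ≤ (k : ℝ) ^ Q *
        (∏ j ∈ Finset.range m, q j + ∑ j ∈ Finset.range m, ε (N + j)) := by
      gcongr; exact hb m
    rw [mul_add] at h1
    linarith [hprod m hm, herr m]
  refine ⟨ξ, hξc, hξp, fun Q => ⟨_, main Q⟩, fun k hk t ht => (main 2 k hk t ht).trans ?_⟩
  simp only [Finset.prod_range_succ, Finset.prod_range_zero]
  norm_num

lemma continuous_pathExpIntegral {ξ : ℝ → ℝ} (hξ : Continuous ξ) (k : ℕ) :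
    Continuous (pathExpIntegral ξ k) :=
  intervalIntegral.continuous_primitive
    (fun a b => Continuous.intervalIntegrable (by fun_prop) a b) 0

lemma norm_pathExpIntegral_le {ξ : ℝ → ℝ} (hξ : Continuous ξ) (hξp : Function.Periodic ξ 1)
    {k : ℕ} {D : ℝ} (hD : ∀ t ∈ Icc (0 : ℝ) 1, ‖pathExpIntegral ξ k t‖ ≤ D) (t : ℝ) :
    ‖pathExpIntegral ξ k t‖ ≤ (|t| + 2) * D := by
  set g : ℝ → ℂ := fun s => Complex.exp (-(Complex.I * (k * ξ s : ℝ))) with hg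
  have hgc : Continuous g := by fun_prop
  have hgp : Function.Periodic g 1 := fun s => by simp only [hg, hξp s]
  have hi : ∀ a b, IntervalIntegrable g MeasureTheory.volume a b :=
    fun a b => hgc.intervalIntegrable a b
  have hD0 : 0 ≤ D := (norm_nonneg _).trans (hD 0 (by simp))
  have e : pathExpIntegral ξ k t =
      ⌊t⌋ • pathExpIntegral ξ k 1 + pathExpIntegral ξ k (Int.fract t) := by
    have h1 := hgp.intervalIntegral_add_zsmul_eq ⌊t⌋ 0 hi
    simp only [zero_add, zsmul_eq_mul, mul_one] at h1
    have h2 : ∫ s in (0 : ℝ)..Int.fract t, g s = ∫ s in (⌊t⌋ : ℝ)..t, g s := by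
      have h3 := intervalIntegral.integral_comp_add_right (a := 0) (b := Int.fract t) g ⌊t⌋
      rw [zero_add, Int.fract_add_floor] at h3
      rw [← h3]
      refine intervalIntegral.integral_congr fun s _ => ?_
      simpa using (hgp.int_mul ⌊t⌋ s).symm
    simp only [pathExpIntegral, zsmul_eq_mul]
    rw [h2, ← h1, intervalIntegral.integral_add_adjacent_intervals (hi _ _) (hi _ _)]
  have hfl : |(⌊t⌋ : ℝ)| ≤ |t| + 1 := by
    have h1 := Int.floor_le t
    have h2 := Int.lt_floor_add_one t
    rw [abs_le]
    constructor <;> cases abs_cases t <;> linarith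
  have h1 := hD 1 (by simp)
  have h2 := hD _ ⟨Int.fract_nonneg t, (Int.fract_lt_one t).le⟩
  rw [e]
  refine (norm_add_le _ _).trans ?_
  rw [zsmul_eq_mul, norm_mul, Complex.norm_intCast]
  have h3 := mul_le_mul hfl h1 (norm_nonneg _) (by positivity)
  linarith

/-- The terms of the Fourier series (of the `j`-th derivative) of the occupation density. -/
noncomputable def densityTerm (ξ : ℝ → ℝ) (j : ℕ) (t x : ℝ) (k : ℕ) : ℂ :=
  (Complex.I * ((k : ℝ) + 1 : ℝ)) ^ j * pathExpIntegral ξ (k + 1) t *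
    Complex.exp (((k : ℝ) + 1 : ℝ) * x * Complex.I)

lemma norm_densityTerm (ξ : ℝ → ℝ) (j : ℕ) (t x : ℝ) (k : ℕ) :
    ‖densityTerm ξ j t x k‖ = ((k : ℝ) + 1) ^ j * ‖pathExpIntegral ξ (k + 1) t‖ := by
  have h : ‖Complex.exp (((k : ℝ) + 1 : ℝ) * x * Complex.I)‖ = 1 := by
    rw [← Complex.ofReal_mul, Complex.norm_exp_ofReal_mul_I]
  have h2 : ‖(((k : ℝ) + 1 : ℝ) : ℂ)‖ = k + 1 := by
    rw [Complex.norm_real, Real.norm_of_nonneg (by positivity)]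
  rw [densityTerm, norm_mul, norm_mul, norm_pow, norm_mul, h, h2, Complex.norm_I, one_mul, mul_one]

lemma densityTerm_succ (ξ : ℝ → ℝ) (j : ℕ) (t x : ℝ) (k : ℕ) :
    HasDerivAt (fun x => densityTerm ξ j t x k) (densityTerm ξ (j + 1) t x k) x := by
  have h1 : HasDerivAt (fun y : ℝ => (((k : ℝ) + 1 : ℝ) : ℂ) * (y : ℂ) * Complex.I)
      ((((k : ℝ) + 1 : ℝ) : ℂ) * 1 * Complex.I) x :=
    ((Complex.ofRealCLM.hasDerivAt (x := x)).const_mul _).mul_const _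
  have h2 := (h1.cexp).const_mul
    ((Complex.I * ((k : ℝ) + 1 : ℝ)) ^ j * pathExpIntegral ξ (k + 1) t)
  refine h2.congr_deriv ?_
  simp only [densityTerm]
  ring

lemma summable_one_div_succ_sq : Summable fun k : ℕ => 1 / ((k : ℝ) + 1) ^ 2 := by
  have := (summable_nat_add_iff 1).2 (Real.summable_one_div_nat_pow (p := 2).2 (by norm_num))
  simpa using this

lemma tsum_one_div_succ_sq_le : ∑' k : ℕ, 1 / ((k : ℝ) + 1) ^ 2 ≤ 2 := by
  have h := (hasSum_nat_add_iff' 1).2 hasSum_zeta_two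
  have h2 : ∑' k : ℕ, 1 / ((k : ℝ) + 1) ^ 2 = Real.pi ^ 2 / 6 := by
    simpa using h.tsum_eq
  rw [h2]
  nlinarith [Real.pi_lt_d2, Real.pi_pos]

lemma one_add_two_mul_re_div_one_sub {w : ℂ} (hw : ‖w‖ < 1) :
    1 + 2 * (w / (1 - w)).re = (1 - ‖w‖ ^ 2) / ‖1 - w‖ ^ 2 := by
  have h1 : (1 : ℂ) - w ≠ 0 := fun h => by
    rw [← sub_eq_zero.1 h] at hw; simp at hw
  have h2 : Complex.normSq (1 - w) ≠ 0 := fun h => h1 (Complex.normSq_eq_zero.1 h)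
  rw [Complex.div_re, ← Complex.normSq_eq_norm_sq, ← Complex.normSq_eq_norm_sq]
  field_simp
  simp only [Complex.normSq_apply, Complex.sub_re, Complex.sub_im, Complex.one_re, Complex.one_im]
  ring

/-- The Poisson kernel representation of the Abel means of the occupation density. -/
lemma abel_density_sub {ξ : ℝ → ℝ} (hξ : Continuous ξ) {r : ℝ} (hr0 : 0 ≤ r) (hr1 : r < 1)
    (x s t : ℝ) :
    (t + 2 * (∑' k, (r : ℂ) ^ (k + 1) * densityTerm ξ 0 t x k).re) -
      (s + 2 * (∑' k, (r : ℂ) ^ (k + 1) * densityTerm ξ 0 s x k).re) =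
    ∫ u in s..t, (1 - r ^ 2) / ‖1 - r * Complex.exp ((x - ξ u : ℝ) * Complex.I)‖ ^ 2 := by
  set z : ℝ → ℂ := fun u => Complex.exp ((x - ξ u : ℝ) * Complex.I) with hz
  have hzc : Continuous z := by fun_prop
  have hz1 : ∀ u, ‖z u‖ = 1 := fun u => Complex.norm_exp_ofReal_mul_I _
  have hterm : ∀ (a b : ℝ) k, ∫ u in a..b, (r * z u) ^ (k + 1) = (r : ℂ) ^ (k + 1) *
      densityTerm ξ 0 b x k - (r : ℂ) ^ (k + 1) * densityTerm ξ 0 a x k := by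
    intro a b k
    have h0 : ∀ c : ℝ, densityTerm ξ 0 c x k = ∫ u in (0 : ℝ)..c, z u ^ (k + 1) := by
      intro c
      rw [densityTerm, pathExpIntegral, pow_zero, one_mul, ← intervalIntegral.integral_mul_const]
      refine intervalIntegral.integral_congr fun u _ => ?_
      simp only [hz, ← Complex.exp_add, ← Complex.exp_nat_mul]
      congr 1
      push_cast
      ring
    have hi : ∀ a b, IntervalIntegrable (fun u => z u ^ (k + 1)) MeasureTheory.volume a b :=
      fun a b => (hzc.pow _).intervalIntegrable a b
    simp_rw [mul_pow, h0, intervalIntegral.integral_const_mul, ← mul_sub]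
    rw [intervalIntegral.integral_interval_sub_left (hi _ _) (hi _ _)]
  have hrz : ∀ u, ‖r * z u‖ = r := fun u => by
    rw [norm_mul, hz1, mul_one, Complex.norm_real, Real.norm_of_nonneg hr0]
  have hgs : Summable fun k : ℕ => r ^ (k + 1) :=
    (summable_nat_add_iff 1).2 (summable_geometric_of_lt_one hr0 hr1)
  have hne : ∀ u, (1 : ℂ) - r * z u ≠ 0 := fun u h => by
    have := hrz u
    rw [← sub_eq_zero.1 h] at this
    simp at this; linarith
  have hint : ∀ a b : ℝ, HasSum (fun k => ∫ u in a..b, (r * z u) ^ (k + 1))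
      (∫ u in a..b, r * z u / (1 - r * z u)) := by
    intro a b
    refine intervalIntegral.hasSum_integral_of_dominated_convergence
      (fun k _ => r ^ (k + 1)) (fun k => ?_) (fun k => ?_) ?_ ?_ ?_
    · exact Continuous.aestronglyMeasurable (by fun_prop)
    · exact Eventually.of_forall fun u _ => by rw [norm_pow, hrz]
    · exact Eventually.of_forall fun u _ => hgs
    · simp
    · refine Eventually.of_forall fun u _ => ?_
      have := (hasSum_geometric_of_norm_lt_one (ξ := r * z u) (by rw [hrz]; exact hr1)).mul_left
        (r * z u)
      simpa only [← pow_succ', ← div_eq_mul_inv] using this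
  have hS : ∀ c : ℝ, Summable fun k => (r : ℂ) ^ (k + 1) * densityTerm ξ 0 c x k := fun c => by
    have := (hint 0 c).summable
    simp only [hterm] at this
    simpa [densityTerm, pathExpIntegral] using this
  have h1 := (hint s t).tsum_eq
  simp only [hterm] at h1
  rw [(hS t).tsum_sub (hS s)] at h1
  have hcont : Continuous fun u => r * z u / (1 - r * z u) :=
    Continuous.div (by fun_prop) (by fun_prop) hne
  have h2 : (∫ u in s..t, r * z u / (1 - r * z u)).re =
      ∫ u in s..t, (r * z u / (1 - r * z u)).re :=
    (Complex.reCLM.intervalIntegral_comp_comm (hcont.intervalIntegrable _ _)).symm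
  have h3 : ∀ u, (1 - r ^ 2) / ‖1 - r * z u‖ ^ 2 = 1 + 2 * (r * z u / (1 - r * z u)).re :=
    fun u => by
      rw [one_add_two_mul_re_div_one_sub (by rw [hrz]; exact hr1), hrz]
  have hre : Continuous fun u => (r * z u / (1 - r * z u)).re := Complex.continuous_re.comp hcont
  change _ = ∫ u in s..t, (1 - r ^ 2) / ‖1 - r * z u‖ ^ 2
  simp_rw [h3]
  rw [intervalIntegral.integral_add (by simp) ((hre.const_mul 2).intervalIntegrable _ _),
    intervalIntegral.integral_const_mul, ← h2, ← h1]
  simp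
  ring

/-- A continuous family of smooth `2π`-periodic functions, increasing in time, which at time `t`
grows only at the point `ξ t` of the circle. -/
structure GrowthProfile where
  /-- The point of growth. -/
  ξ : ℝ → ℝ
  /-- The profile at a given time. -/
  f : ℝ → ℝ → ℝ
  continuous_ξ : Continuous ξ
  continuous_f : Continuous fun p : ℝ × ℝ => f p.1 p.2
  contDiff_f : ∀ t, ContDiff ℝ (⊤ : ℕ∞) (f t)
  continuous_deriv : Continuous fun p : ℝ × ℝ => deriv (f p.1) p.2
  periodic_f : ∀ t, Function.Periodic (f t) (2 * Real.pi)
  monotone_f : ∀ x, Monotone fun t => f t x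
  abs_f_sub_le : ∀ t x, |f t x - t| ≤ |t| / 2 + 1
  f_eq_of_cos_ne_one : ∀ s t x, s ≤ t → (∀ u ∈ Icc s t, Real.cos (x - ξ u) ≠ 1) → f s x = f t x

theorem nonempty_growthProfile : Nonempty GrowthProfile := by
  obtain ⟨ξ, hξ, hξp, hdec, hsmall⟩ := exists_path_pathExpIntegral_rapidly_decaying
  have hterm : ∀ j, ∃ C : ℝ, ∀ t x k, ‖densityTerm ξ j t x k‖ ≤
      (|t| + 2) * (C * (1 / ((k : ℝ) + 1) ^ 2)) := by
    intro j
    obtain ⟨C, hC⟩ := hdec (j + 2)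
    refine ⟨C, fun t x k => ?_⟩
    have h1 := norm_pathExpIntegral_le hξ hξp (k := k + 1) (D := C / ((k : ℝ) + 1) ^ (j + 2))
      (fun s hs => by
        have := hC (k + 1) (by omega) s hs
        rw [le_div_iff₀ (by positivity), mul_comm]
        exact_mod_cast this) t
    rw [norm_densityTerm]
    calc _ ≤ ((k : ℝ) + 1) ^ j * ((|t| + 2) * (C / ((k : ℝ) + 1) ^ (j + 2))) := by gcongr
      _ = _ := by rw [pow_add]; field_simp
  choose C hC using hterm
  have hsm : ∀ j t, Summable fun k : ℕ => (|t| + 2) * (C j * (1 / ((k : ℝ) + 1) ^ 2)) :=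
    fun j t => (summable_one_div_succ_sq.mul_left _).mul_left _
  set G : ℕ → ℝ → ℝ → ℂ := fun j t x => ∑' k, densityTerm ξ j t x k with hG
  have hGc : ∀ j, Continuous fun p : ℝ × ℝ => G j p.1 p.2 := by
    intro j
    have hpos : ∀ t : ℝ, (0 : ℝ) < |t| + 2 := fun t => by positivity
    have h1 : Continuous fun p : ℝ × ℝ =>
        ∑' k, ((|p.1| + 2 : ℝ) : ℂ)⁻¹ * densityTerm ξ j p.1 p.2 k := by
      refine continuous_tsum (u := fun k : ℕ => C j * (1 / ((k : ℝ) + 1) ^ 2)) (fun k => ?_)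
        (summable_one_div_succ_sq.mul_left _) fun k p => ?_
      · have := continuous_pathExpIntegral hξ (k + 1)
        have h0 : ∀ p : ℝ × ℝ, ((|p.1| + 2 : ℝ) : ℂ) ≠ 0 := fun p => by
          exact_mod_cast (hpos p.1).ne'
        unfold densityTerm
        fun_prop (disch := assumption)
      · rw [norm_mul, norm_inv, Complex.norm_real, Real.norm_of_nonneg (hpos _).le,
          inv_mul_le_iff₀ (hpos _)]
        exact hC j _ _ k
    have h2 : (fun p : ℝ × ℝ => G j p.1 p.2) = fun p => ((|p.1| + 2 : ℝ) : ℂ) *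
        ∑' k, ((|p.1| + 2 : ℝ) : ℂ)⁻¹ * densityTerm ξ j p.1 p.2 k := by
      funext p
      have h0 : ((|p.1| + 2 : ℝ) : ℂ) ≠ 0 := by exact_mod_cast (hpos p.1).ne'
      rw [tsum_mul_left, mul_inv_cancel_left₀ h0]
    rw [h2]
    fun_prop
  have hGd : ∀ j t x, HasDerivAt (G j t) (G (j + 1) t x) x := fun j t x =>
    hasDerivAt_tsum (hsm (j + 1) t) (fun k y => densityTerm_succ ξ j t y k)
      (fun k y => hC (j + 1) t y k) (y₀ := 0)
      (Summable.of_norm_bounded (hsm j t) fun k => hC j t 0 k) x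
  have hGsm : ∀ (n : ℕ) j t, ContDiff ℝ n (G j t) := by
    intro n
    induction n with
    | zero =>
      intro j t
      rw [Nat.cast_zero, contDiff_zero]
      exact continuous_iff_continuousAt.2 fun x => (hGd j t x).continuousAt
    | succ n ih =>
      intro j t
      rw [Nat.cast_succ, contDiff_succ_iff_deriv]
      refine ⟨fun x => (hGd j t x).differentiableAt, by simp, ?_⟩
      rw [show deriv (G j t) = G (j + 1) t from funext fun x => (hGd j t x).deriv]
      exact ih _ _
  set f : ℝ → ℝ → ℝ := fun t x => t + 2 * (G 0 t x).re with hf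
  have hfd : ∀ t x, HasDerivAt (f t) (2 * (G 1 t x).re) x := fun t x => by
    have h1 : HasDerivAt (fun y => (G 0 t y).re) (G 1 t x).re x :=
      (Complex.reCLM.hasFDerivAt.comp_hasDerivAt x (hGd 0 t x))
    exact (h1.const_mul 2).const_add t
  have habel : ∀ t x, Tendsto (fun r : ℝ =>
      t + 2 * (∑' k, (r : ℂ) ^ (k + 1) * densityTerm ξ 0 t x k).re) (𝓝[<] 1) (𝓝 (f t x)) := by
    intro t x
    have h1 : Tendsto (fun r : ℝ => ∑' k, (r : ℂ) ^ (k + 1) * densityTerm ξ 0 t x k) (𝓝[<] 1)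
        (𝓝 (G 0 t x)) := by
      refine tendsto_tsum_of_dominated_convergence (hsm 0 t) (fun k => ?_) ?_
      · have hc : Continuous fun r : ℝ => (r : ℂ) ^ (k + 1) * densityTerm ξ 0 t x k := by
          fun_prop
        have := (hc.tendsto 1).mono_left (nhdsWithin_le_nhds (s := Iio 1))
        simpa using this
      · filter_upwards [Ioo_mem_nhdsLT (zero_lt_one (α := ℝ))] with r hr k
        rw [norm_mul, norm_pow, Complex.norm_real, Real.norm_of_nonneg hr.1.le]
        exact (mul_le_of_le_one_left (norm_nonneg _) (pow_le_one₀ hr.1.le hr.2.le)).trans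
          (hC 0 t x k)
    exact ((Complex.continuous_re.tendsto _ |>.comp h1).const_mul 2).const_add t
  have hmono : ∀ x, Monotone fun t => f t x := by
    intro x s t hst
    refine le_of_tendsto_of_tendsto (habel s x) (habel t x) ?_
    filter_upwards [Ioo_mem_nhdsLT (zero_lt_one (α := ℝ))] with r hr
    rw [← sub_nonneg, abel_density_sub hξ hr.1.le hr.2]
    refine intervalIntegral.integral_nonneg hst fun u _ => ?_
    have : 0 ≤ 1 - r ^ 2 := by nlinarith [hr.1, hr.2]
    positivity
  have hloc : ∀ s t x, s ≤ t → (∀ u ∈ Icc s t, Real.cos (x - ξ u) ≠ 1) → f s x = f t x := by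
    intro s t x hst hcos
    set z : ℝ → ℂ := fun u => Complex.exp ((x - ξ u : ℝ) * Complex.I) with hz
    have hz1 : ∀ u, ‖z u‖ = 1 := fun u => Complex.norm_exp_ofReal_mul_I _
    have hzc : Continuous fun u => ‖1 - z u‖ := by fun_prop
    obtain ⟨v, hv, hmin⟩ := isCompact_Icc.exists_isMinOn (nonempty_Icc.2 hst) hzc.continuousOn
    set δ := ‖1 - z v‖ with hδ
    have hδ0 : 0 < δ := by
      rw [hδ, norm_pos_iff, sub_ne_zero]
      intro h
      apply hcos v hv
      rw [← Complex.exp_ofReal_mul_I_re]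
      change (z v).re = 1
      rw [← h, Complex.one_re]
    refine (hmono x hst).antisymm ?_
    have h1 := (habel t x).sub (habel s x)
    have h2 : Tendsto (fun r : ℝ => (1 - r ^ 2) * (4 / δ ^ 2) * |t - s|) (𝓝[<] 1) (𝓝 0) := by
      have hc : Continuous fun r : ℝ => (1 - r ^ 2) * (4 / δ ^ 2) * |t - s| := by fun_prop
      have := (hc.tendsto 1).mono_left (nhdsWithin_le_nhds (s := Iio 1))
      simpa using this
    have h3 : f t x - f s x ≤ 0 := by
      refine le_of_tendsto_of_tendsto h1 h2 ?_
      filter_upwards [Ioo_mem_nhdsLT (zero_lt_one (α := ℝ))] with r hr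
      rw [abel_density_sub hξ hr.1.le hr.2]
      refine (Real.le_norm_self _).trans (intervalIntegral.norm_integral_le_of_norm_le_const
        fun u hu => ?_)
      change ‖(1 - r ^ 2) / ‖1 - r * z u‖ ^ 2‖ ≤ _
      rw [uIoc_of_le hst] at hu
      have hm : δ ≤ ‖1 - z u‖ := hmin ⟨hu.1.le, hu.2⟩
      have hrz : ‖r * z u‖ = r := by
        rw [norm_mul, hz1, mul_one, Complex.norm_real, Real.norm_of_nonneg hr.1.le]
      have ha : 1 - r ≤ ‖1 - r * z u‖ := by
        have := norm_sub_norm_le 1 (r * z u)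
        rwa [hrz, norm_one] at this
      have hb : ‖1 - z u‖ ≤ ‖1 - r * z u‖ + (1 - r) := by
        have e : (1 : ℂ) - z u = (1 - r * z u) - ((1 - r : ℝ) : ℂ) * z u := by
          push_cast; ring
        rw [e]
        refine (norm_sub_le _ _).trans_eq ?_
        rw [norm_mul, hz1, mul_one, Complex.norm_real, Real.norm_of_nonneg (by linarith [hr.2])]
      have hd : δ / 2 ≤ ‖1 - r * z u‖ := by linarith
      have hr2 : 0 ≤ 1 - r ^ 2 := by nlinarith [hr.1, hr.2]
      rw [Real.norm_of_nonneg (by positivity)]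
      calc (1 - r ^ 2) / ‖1 - r * z u‖ ^ 2 ≤ (1 - r ^ 2) / (δ / 2) ^ 2 := by gcongr
        _ = _ := by field_simp; norm_num
    linarith
  refine ⟨⟨ξ, f, hξ, ?_, fun t => ?_, ?_, fun t x => ?_, hmono, fun t x => ?_, hloc⟩⟩
  · have := hGc 0
    fun_prop
  · have h1 : ContDiff ℝ (⊤ : ℕ∞) (G 0 t) := contDiff_infty.2 fun n => hGsm n 0 t
    exact contDiff_const.add (contDiff_const.mul (Complex.reCLM.contDiff.comp h1))
  · simp_rw [(hfd _ _).deriv]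
    have := hGc 1
    fun_prop
  · have : ∀ k, densityTerm ξ 0 t (x + 2 * Real.pi) k = densityTerm ξ 0 t x k := fun k => by
      simp only [densityTerm]
      congr 1
      rw [Complex.exp_eq_exp_iff_exists_int]
      exact ⟨k + 1, by push_cast; ring⟩
    simp only [hf, hG, this]
  · have h1 : ‖G 0 t x‖ ≤ ∑' k : ℕ, (|t| + 2) * (1 / 16 * (1 / ((k : ℝ) + 1) ^ 2)) := by
      refine tsum_of_norm_bounded
        ((summable_one_div_succ_sq.mul_left _).mul_left _).hasSum fun k => ?_
      rw [norm_densityTerm, pow_zero, one_mul]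
      refine norm_pathExpIntegral_le hξ hξp (fun s hs => ?_) t
      have := hsmall (k + 1) (by omega) s hs
      rw [mul_one_div, le_div_iff₀ (by positivity), mul_comm]
      exact_mod_cast this
    rw [tsum_mul_left, tsum_mul_left] at h1
    have h2 : |(G 0 t x).re| ≤ ‖G 0 t x‖ := Complex.abs_re_le_norm _
    have h3 : (|t| + 2) * (1 / 16 * ∑' k : ℕ, 1 / ((k : ℝ) + 1) ^ 2) ≤
        (|t| + 2) * (1 / 16 * 2) := by
      gcongr; exact tsum_one_div_succ_sq_le
    simp only [hf, add_sub_cancel_left, abs_mul, abs_two]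
    linarith [abs_nonneg t]

/-- The unit vector with polar angle `θ`. -/
noncomputable def unitVec (θ : ℝ) : EuclideanSpace ℝ (Fin 2) := !₂[Real.cos θ, Real.sin θ]

/-- The polar angle of a point of the plane, in `(-π, π]`. -/
noncomputable def polarAngle (p : EuclideanSpace ℝ (Fin 2)) : ℝ := Complex.arg ⟨p 0, p 1⟩

/-- The rotation of the plane by a right angle. -/
noncomputable def quarterTurn (p : EuclideanSpace ℝ (Fin 2)) : EuclideanSpace ℝ (Fin 2) :=
  !₂[-p 1, p 0]

lemma norm_unitVec (θ : ℝ) : ‖unitVec θ‖ = 1 := by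
  simp [unitVec, EuclideanSpace.norm_eq]

lemma contDiff_unitVec : ContDiff ℝ (⊤ : ℕ∞) unitVec := by
  rw [contDiff_euclidean]
  intro i
  fin_cases i
  · exact Real.contDiff_cos
  · exact Real.contDiff_sin

lemma hasDerivAt_unitVec (θ : ℝ) : HasDerivAt unitVec (quarterTurn (unitVec θ)) θ := by
  have h : HasDerivAt (fun θ => ![Real.cos θ, Real.sin θ]) ![-Real.sin θ, Real.cos θ] θ := by
    rw [hasDerivAt_pi]
    intro i
    fin_cases i
    · exact Real.hasDerivAt_cos θ
    · exact Real.hasDerivAt_sin θ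
  exact (PiLp.continuousLinearEquiv 2 ℝ fun _ : Fin 2 => ℝ).symm.hasFDerivAt.comp_hasDerivAt θ h

lemma quarterTurn_smul (c : ℝ) (p : EuclideanSpace ℝ (Fin 2)) :
    quarterTurn (c • p) = c • quarterTurn p := by
  ext i
  fin_cases i <;> simp [quarterTurn]

lemma continuous_quarterTurn : Continuous quarterTurn := by
  unfold quarterTurn
  fun_prop

lemma smul_add_quarterTurn_ne_zero (g : ℝ) {p : EuclideanSpace ℝ (Fin 2)} (hp : p ≠ 0) :
    g • p + quarterTurn p ≠ 0 := by
  intro h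
  apply hp
  have h0 := congrArg (fun v : EuclideanSpace ℝ (Fin 2) => v 0) h
  have h1 := congrArg (fun v : EuclideanSpace ℝ (Fin 2) => v 1) h
  simp [quarterTurn] at h0 h1
  have h2 : p 0 ^ 2 + p 1 ^ 2 = 0 := by linear_combination p 0 * h1 - p 1 * h0
  have h3 : p 0 = 0 := by nlinarith [sq_nonneg (p 0), sq_nonneg (p 1)]
  have h4 : p 1 = 0 := by nlinarith [sq_nonneg (p 0), sq_nonneg (p 1)]
  ext i
  fin_cases i
  · exact h3
  · exact h4

lemma unitVec_eq_iff {θ φ : ℝ} :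
    unitVec θ = unitVec φ ↔ ∃ m : ℤ, φ = θ + m * (2 * Real.pi) := by
  constructor
  · intro h
    have h0 : Real.cos θ = Real.cos φ := by
      simpa [unitVec] using congrArg (fun v : EuclideanSpace ℝ (Fin 2) => v 0) h
    have h1 : Real.sin θ = Real.sin φ := by
      simpa [unitVec] using congrArg (fun v : EuclideanSpace ℝ (Fin 2) => v 1) h
    obtain ⟨m, hm⟩ := Real.Angle.angle_eq_iff_two_pi_dvd_sub.1
      (Real.Angle.cos_sin_inj h0.symm h1.symm)
    exact ⟨m, by linarith⟩
  · rintro ⟨m, rfl⟩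
    simp [unitVec, Real.cos_add_int_mul_two_pi, Real.sin_add_int_mul_two_pi]

lemma unitVec_eq_of_cos_sub_eq_one {θ φ : ℝ} (h : Real.cos (θ - φ) = 1) :
    unitVec θ = unitVec φ := by
  obtain ⟨m, hm⟩ := (Real.cos_eq_one_iff _).1 h
  exact (unitVec_eq_iff.2 ⟨m, by linarith⟩).symm

lemma norm_smul_unitVec_polarAngle (p : EuclideanSpace ℝ (Fin 2)) :
    ‖p‖ • unitVec (polarAngle p) = p := by
  have hn : ‖p‖ = ‖(⟨p 0, p 1⟩ : ℂ)‖ := by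
    rw [EuclideanSpace.norm_eq, Complex.norm_eq_sqrt_sq_add_sq]
    simp
  ext i
  fin_cases i
  · simp [unitVec, polarAngle, hn, Complex.norm_mul_cos_arg]
  · simp [unitVec, polarAngle, hn, Complex.norm_mul_sin_arg]

lemma continuousAt_coe_polarAngle {p : EuclideanSpace ℝ (Fin 2)} (hp : p ≠ 0) :
    ContinuousAt (fun p => (polarAngle p : Real.Angle)) p := by
  have h0 : (⟨p 0, p 1⟩ : ℂ) ≠ 0 := fun h => by
    apply hp
    ext i
    fin_cases i
    · exact congrArg Complex.re h
    · exact congrArg Complex.im h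
  have h1 : Continuous fun q : EuclideanSpace ℝ (Fin 2) => (⟨q 0, q 1⟩ : ℂ) := by
    have : (fun q : EuclideanSpace ℝ (Fin 2) => (⟨q 0, q 1⟩ : ℂ)) =
        fun q => (q 0 : ℂ) + (q 1 : ℂ) * Complex.I := by
      funext q
      rw [Complex.mk_eq_add_mul_I]
    rw [this]
    fun_prop
  exact ContinuousAt.comp (f := fun q : EuclideanSpace ℝ (Fin 2) => (⟨q 0, q 1⟩ : ℂ))
    (Complex.continuousAt_arg_coe_angle h0) h1.continuousAt

namespace GrowthProfile

variable (G : GrowthProfile)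

/-- The point with polar angle `θ` on the boundary curve at time `t`. -/
noncomputable def point (t θ : ℝ) : EuclideanSpace ℝ (Fin 2) := Real.exp (G.f t θ) • unitVec θ

lemma norm_point (t θ : ℝ) : ‖G.point t θ‖ = Real.exp (G.f t θ) := by
  rw [point, norm_smul, norm_unitVec, mul_one, Real.norm_of_nonneg (Real.exp_pos _).le]

lemma point_ne_zero (t θ : ℝ) : G.point t θ ≠ 0 := by
  rw [← norm_pos_iff, norm_point]
  exact Real.exp_pos _

lemma continuous_point : Continuous fun q : ℝ × ℝ => G.point q.1 q.2 := by
  have h1 := G.continuous_f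
  have h2 := contDiff_unitVec.continuous
  unfold point
  fun_prop

lemma f_add_int_mul (t θ : ℝ) (m : ℤ) : G.f t (θ + m * (2 * Real.pi)) = G.f t θ :=
  (G.periodic_f t).int_mul m θ

lemma point_eq_iff {s t θ φ : ℝ} : G.point t θ = G.point s φ ↔
    (∃ m : ℤ, φ = θ + m * (2 * Real.pi)) ∧ G.f t θ = G.f s φ := by
  constructor
  · intro h
    have h1 : G.f t θ = G.f s φ := by
      have := congrArg norm h
      rwa [norm_point, norm_point, Real.exp_eq_exp] at this
    refine ⟨unitVec_eq_iff.1 ?_, h1⟩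
    rw [point, point, h1] at h
    exact smul_right_injective _ (Real.exp_pos _).ne' h
  · rintro ⟨hm, h1⟩
    rw [point, point, unitVec_eq_iff.2 hm, h1]

lemma continuous_time (θ : ℝ) : Continuous fun t => G.f t θ :=
  G.continuous_f.comp (continuous_id.prodMk continuous_const)

lemma abs_time_le (t θ : ℝ) : |t| ≤ 2 * |G.f t θ| + 2 := by
  have h1 := G.abs_f_sub_le t θ
  have h2 := abs_sub_abs_le_abs_sub t (G.f t θ)
  rw [abs_sub_comm] at h2
  linarith

/-- The first time at which the profile reaches a given height. -/
lemma exists_first_time (θ v : ℝ) : ∃ t, G.f t θ = v ∧ ∀ s < t, G.f s θ < v := by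
  set S := {t | v ≤ G.f t θ} with hS
  have hne : S.Nonempty := by
    refine ⟨2 * |v| + 2, ?_⟩
    have h1 := (abs_le.1 (G.abs_f_sub_le (2 * |v| + 2) θ)).1
    rw [abs_of_nonneg (by positivity : (0 : ℝ) ≤ 2 * |v| + 2)] at h1
    have := le_abs_self v
    show v ≤ _
    linarith
  have hbdd : BddBelow S := by
    refine ⟨-(2 * |v| + 2), fun t (ht : v ≤ _) => ?_⟩
    have h1 := (abs_le.1 (G.abs_f_sub_le t θ)).2
    have h2 := neg_abs_le v
    have h3 := abs_nonneg v
    cases abs_cases t <;> linarith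
  have hcl : IsClosed S := isClosed_le continuous_const (G.continuous_time θ)
  have hmem : sInf S ∈ S := hcl.csInf_mem hne hbdd
  have hlt : ∀ s < sInf S, G.f s θ < v := fun s hs => by
    by_contra h
    exact absurd (csInf_le hbdd (not_lt.1 h)) (not_le.2 hs)
  refine ⟨sInf S, le_antisymm ?_ hmem, hlt⟩
  refine le_of_tendsto (((G.continuous_time θ).tendsto _).mono_left
    (nhdsWithin_le_nhds (s := Iio (sInf S)))) ?_
  filter_upwards [self_mem_nhdsWithin] with s hs using (hlt s hs).le

lemma unitVec_eq_of_first_time {t θ : ℝ} (h : ∀ s < t, G.f s θ < G.f t θ) :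
    unitVec θ = unitVec (G.ξ t) := by
  apply unitVec_eq_of_cos_sub_eq_one
  by_contra hc
  have hcont : Continuous fun u => Real.cos (θ - G.ξ u) := by
    have := G.continuous_ξ
    fun_prop
  obtain ⟨δ, hδ, hball⟩ := Metric.eventually_nhds_iff.1 (hcont.continuousAt.eventually_ne hc)
  refine (h (t - δ / 2) (by linarith)).ne (G.f_eq_of_cos_ne_one _ _ _ (by linarith) fun u hu =>
    hball ?_)
  rw [Real.dist_eq, abs_lt]
  constructor <;> linarith [hu.1, hu.2]

/-- The Peano curve swept out by the point of growth. -/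
noncomputable def curve (t : ℝ) : EuclideanSpace ℝ (Fin 2) :=
  if t ≤ 0 then 0 else G.point (Real.log t) (G.ξ (Real.log t))

lemma curve_zero : G.curve 0 = 0 := by simp [curve]

lemma curve_of_pos {t : ℝ} (ht : 0 < t) :
    G.curve t = G.point (Real.log t) (G.ξ (Real.log t)) := by
  rw [curve, if_neg ht.not_ge]

lemma continuous_curve : Continuous G.curve := by
  rw [continuous_iff_continuousAt]
  intro t
  rcases lt_trichotomy t 0 with ht | rfl | ht
  · refine (continuousAt_const (y := 0)).congr ?_
    filter_upwards [gt_mem_nhds ht] with s hs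
    rw [curve, if_pos hs.le]
  · rw [ContinuousAt, curve_zero]
    have hb : ∀ t : ℝ, ‖G.curve t‖ ≤ Real.exp 1 * √|t| + Real.exp 2 * |t| ^ 2 := by
      intro t
      rcases le_or_gt t 0 with ht | ht
      · rw [curve, if_pos ht, norm_zero]
        positivity
      · have h1 := (abs_le.1 (G.abs_f_sub_le (Real.log t) (G.ξ (Real.log t)))).2
        rw [G.curve_of_pos ht, norm_point, abs_of_pos ht]
        rcases abs_cases (Real.log t) with ⟨h2, h3⟩ | ⟨h2, h3⟩
        · have h4 : Real.exp 2 * t ^ 2 = Real.exp (2 + 2 * Real.log t) := by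
            rw [Real.exp_add, two_mul (Real.log t), Real.exp_add, Real.exp_log ht, sq]
          have h5 : Real.exp (G.f (Real.log t) (G.ξ (Real.log t))) ≤ Real.exp 2 * t ^ 2 := by
            rw [h4, Real.exp_le_exp]
            linarith
          have h6 : 0 ≤ Real.exp 1 * √t := by positivity
          linarith
        · have h4 : Real.exp 1 * √t = Real.exp (1 + Real.log t / 2) := by
            rw [Real.exp_add, ← Real.log_sqrt ht.le, Real.exp_log (Real.sqrt_pos.2 ht)]
          have h5 : Real.exp (G.f (Real.log t) (G.ξ (Real.log t))) ≤ Real.exp 1 * √t := by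
            rw [h4, Real.exp_le_exp]
            linarith
          have h6 : 0 ≤ Real.exp 2 * t ^ 2 := by positivity
          linarith
    refine squeeze_zero_norm hb ?_
    have hc : Continuous fun t : ℝ => Real.exp 1 * √|t| + Real.exp 2 * |t| ^ 2 := by fun_prop
    simpa using hc.tendsto 0
  · have h1 : ContinuousAt (fun s => G.point (Real.log s) (G.ξ (Real.log s))) t := by
      have h2 : ContinuousAt Real.log t := Real.continuousAt_log ht.ne'
      have h3 : ContinuousAt (fun s => (Real.log s, G.ξ (Real.log s))) t :=
        h2.prodMk (G.continuous_ξ.continuousAt.comp h2)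
      exact G.continuous_point.continuousAt.comp h3
    refine h1.congr ?_
    filter_upwards [lt_mem_nhds ht] with s hs
    rw [G.curve_of_pos hs]

/-- The gauge function of the footprint at time `t`. -/
noncomputable def gauge (t : ℝ) (p : EuclideanSpace ℝ (Fin 2)) : ℝ :=
  ‖p‖ * Real.exp (-G.f t (polarAngle p))

lemma continuous_gauge (t : ℝ) : Continuous (G.gauge t) := by
  rw [continuous_iff_continuousAt]
  intro p
  by_cases hp : p = 0
  · subst hp
    obtain ⟨B, hB⟩ : ∃ B, ∀ x, -G.f t x ≤ B := ⟨|t| / 2 + 1 - t, fun x => by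
      linarith [(abs_le.1 (G.abs_f_sub_le t x)).1]⟩
    have h0 : G.gauge t 0 = 0 := by simp [gauge]
    rw [ContinuousAt, h0]
    refine squeeze_zero_norm (a := fun q => ‖q‖ * Real.exp B) (fun q => ?_) ?_
    · rw [gauge, norm_mul, norm_norm, Real.norm_of_nonneg (Real.exp_pos _).le]
      gcongr
      exact hB _
    · have hc : Continuous fun q : EuclideanSpace ℝ (Fin 2) => ‖q‖ * Real.exp B := by fun_prop
      simpa using hc.tendsto 0
  · have hl : Continuous ((G.periodic_f t).lift : Real.Angle → ℝ) :=
      continuous_coinduced_dom.2 (G.contDiff_f t).continuous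
    have h1 : ContinuousAt (fun q => G.f t (polarAngle q)) p :=
      ContinuousAt.comp (f := fun q => (polarAngle q : Real.Angle)) hl.continuousAt
        (continuousAt_coe_polarAngle hp)
    unfold gauge
    exact continuousAt_id.norm.mul (Real.continuous_exp.continuousAt.comp h1.neg)

lemma gauge_smul_unitVec (t θ : ℝ) {c : ℝ} (hc : 0 ≤ c) :
    G.gauge t (c • unitVec θ) = c * Real.exp (-G.f t θ) := by
  have hn : ‖c • unitVec θ‖ = c := by
    rw [norm_smul, norm_unitVec, mul_one, Real.norm_of_nonneg hc]
  rw [gauge, hn]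
  rcases hc.eq_or_lt with rfl | hc
  · simp
  · have h1 := norm_smul_unitVec_polarAngle (c • unitVec θ)
    rw [hn] at h1
    obtain ⟨m, hm⟩ := unitVec_eq_iff.1 (smul_right_injective _ hc.ne' h1).symm
    rw [hm, f_add_int_mul]

lemma gauge_point (t θ : ℝ) : G.gauge t (G.point t θ) = 1 := by
  rw [point, gauge_smul_unitVec _ _ _ (Real.exp_pos _).le, ← Real.exp_add, add_neg_cancel,
    Real.exp_zero]

lemma range_point (t : ℝ) : range (G.point t) = {p | G.gauge t p = 1} := by
  ext p
  constructor
  · rintro ⟨θ, rfl⟩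
    exact G.gauge_point t θ
  · intro (h : G.gauge t p = 1)
    refine ⟨polarAngle p, ?_⟩
    have h1 : Real.exp (G.f t (polarAngle p)) = ‖p‖ := by
      rw [gauge, Real.exp_neg, ← div_eq_mul_inv, div_eq_one_iff_eq (Real.exp_pos _).ne'] at h
      exact h.symm
    rw [point, h1, norm_smul_unitVec_polarAngle]

lemma image_curve {t : ℝ} (ht : 0 < t) :
    G.curve '' Icc 0 t = {p | G.gauge (Real.log t) p ≤ 1} := by
  ext p
  constructor
  · rintro ⟨s, hs, rfl⟩
    rcases hs.1.eq_or_lt with rfl | h0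
    · simp [curve_zero, gauge]
    · rw [G.curve_of_pos h0, point, mem_ofPred_eq, gauge_smul_unitVec _ _ _ (Real.exp_pos _).le,
        ← Real.exp_add, Real.exp_le_one_iff]
      have := G.monotone_f (G.ξ (Real.log s)) (Real.log_le_log h0 hs.2)
      dsimp only at this
      linarith
  · intro (h : G.gauge (Real.log t) p ≤ 1)
    by_cases hp : p = 0
    · exact ⟨0, ⟨le_rfl, ht.le⟩, by rw [curve_zero, hp]⟩
    have hp0 : 0 < ‖p‖ := norm_pos_iff.2 hp
    obtain ⟨s, hs1, hs2⟩ := G.exists_first_time (polarAngle p) (Real.log ‖p‖)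
    refine ⟨Real.exp s, ⟨(Real.exp_pos s).le, ?_⟩, ?_⟩
    · rw [← Real.le_log_iff_exp_le ht]
      by_contra hlt
      have h1 := hs2 _ (not_le.1 hlt)
      rw [gauge, ← Real.exp_log hp0, ← Real.exp_add, Real.exp_le_one_iff] at h
      linarith
    · have h1 := G.unitVec_eq_of_first_time (hs1 ▸ hs2)
      rw [G.curve_of_pos (Real.exp_pos s), Real.log_exp]
      obtain ⟨m, hm⟩ := unitVec_eq_iff.1 h1
      rw [point, ← h1, hm, f_add_int_mul, hs1, Real.exp_log hp0, norm_smul_unitVec_polarAngle]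

lemma frontier_image_curve {t : ℝ} (ht : 0 < t) :
    frontier (G.curve '' Icc 0 t) = range (G.point (Real.log t)) := by
  rw [range_point, G.image_curve ht]
  refine (frontier_le_subset_eq (G.continuous_gauge _) continuous_const).antisymm ?_
  intro p (hp : G.gauge (Real.log t) p = 1)
  refine ⟨subset_closure hp.le, fun hint => ?_⟩
  have h1 : Tendsto (fun c : ℝ => c • p) (𝓝[>] 1) (𝓝 p) := by
    have hc : Continuous fun c : ℝ => c • p := by fun_prop
    have := (hc.tendsto 1).mono_left (nhdsWithin_le_nhds (s := Ioi 1))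
    simpa using this
  obtain ⟨c, hc, hc1⟩ :=
    ((h1.eventually (mem_interior_iff_mem_nhds.1 hint)).and self_mem_nhdsWithin).exists
  have hc1 : 1 < c := hc1
  have h2 := norm_smul_unitVec_polarAngle p
  have h3 : G.gauge (Real.log t) (c • p) = c * G.gauge (Real.log t) p := by
    conv_lhs => rw [← h2]
    rw [smul_smul, gauge_smul_unitVec _ _ _ (by positivity), gauge, mul_assoc]
  have hc : G.gauge (Real.log t) (c • p) ≤ 1 := hc
  rw [h3, hp] at hc
  linarith

lemma deriv_eq_of_f_eq {s t θ : ℝ} (h : G.f s θ = G.f t θ) :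
    deriv (G.f s) θ = deriv (G.f t) θ := by
  wlog hst : s ≤ t generalizing s t
  · exact (this h.symm (le_of_not_ge hst)).symm
  have hd : ∀ r, DifferentiableAt ℝ (G.f r) θ := fun r =>
    (G.contDiff_f r).differentiable (by simp) θ
  have hmin : IsLocalMin (G.f t - G.f s) θ := Eventually.of_forall fun x => by
    have := G.monotone_f x hst
    dsimp only at this
    simp only [Pi.sub_apply, h, sub_self]
    linarith
  have h1 := hmin.deriv_eq_zero
  rw [deriv_sub (hd t) (hd s)] at h1
  linarith

lemma deriv_f_add_int_mul (t θ : ℝ) (m : ℤ) :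
    deriv (G.f t) (θ + m * (2 * Real.pi)) = deriv (G.f t) θ := by
  rw [← deriv_comp_add_const]
  simp only [f_add_int_mul]

lemma deriv_eq_of_point_eq {s t θ φ : ℝ} (h : G.point t θ = G.point s φ) :
    deriv (G.f t) θ = deriv (G.f s) φ := by
  obtain ⟨⟨m, rfl⟩, h1⟩ := G.point_eq_iff.1 h
  rw [f_add_int_mul] at h1
  rw [deriv_f_add_int_mul, G.deriv_eq_of_f_eq h1]

lemma exists_point_eq {p : EuclideanSpace ℝ (Fin 2)} (hp : p ≠ 0) :
    ∃ t, G.point t (polarAngle p) = p := by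
  obtain ⟨t, ht, -⟩ := G.exists_first_time (polarAngle p) (Real.log ‖p‖)
  exact ⟨t, by rw [point, ht, Real.exp_log (norm_pos_iff.2 hp), norm_smul_unitVec_polarAngle]⟩

open Classical in
/-- The logarithmic slope, in polar coordinates, of the boundary curves through a point. -/
noncomputable def slope (p : EuclideanSpace ℝ (Fin 2)) : ℝ :=
  if hp : p = 0 then 0 else deriv (G.f (G.exists_point_eq hp).choose) (polarAngle p)

lemma slope_point (t θ : ℝ) : G.slope (G.point t θ) = deriv (G.f t) θ := by
  rw [slope, dif_neg (G.point_ne_zero t θ)]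
  exact G.deriv_eq_of_point_eq (G.exists_point_eq (G.point_ne_zero t θ)).choose_spec

lemma continuousAt_slope {p : EuclideanSpace ℝ (Fin 2)} (hp : p ≠ 0) :
    ContinuousAt G.slope p := by
  rw [ContinuousAt, tendsto_iff_ultrafilter]
  intro U hU
  choose! T hT using fun (q : EuclideanSpace ℝ (Fin 2)) (hq : q ≠ 0) => G.exists_point_eq hq
  have hne : ∀ᶠ q in (U : Filter (EuclideanSpace ℝ (Fin 2))), q ≠ 0 := hU (isOpen_ne.mem_nhds hp)
  have hlog : ∀ᶠ q in (U : Filter (EuclideanSpace ℝ (Fin 2))), |Real.log ‖q‖| < |Real.log ‖p‖| + 1 := by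
    have hc : ContinuousAt (fun q : EuclideanSpace ℝ (Fin 2) => |Real.log ‖q‖|) p :=
      (continuousAt_id.norm.log (norm_ne_zero_iff.2 hp)).abs
    exact hU (hc.eventually_lt_const (lt_add_one _))
  set R := 2 * (|Real.log ‖p‖| + 1) + 2
  have hmem : ∀ᶠ q in (U : Filter (EuclideanSpace ℝ (Fin 2))),
      (T q, polarAngle q) ∈ Icc (-R) R ×ˢ Icc (-Real.pi) Real.pi := by
    filter_upwards [hne, hlog] with q hq hlq
    refine ⟨abs_le.1 ?_, (Complex.neg_pi_lt_arg _).le, Complex.arg_le_pi _⟩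
    have h1 : G.f (T q) (polarAngle q) = Real.log ‖q‖ := by
      conv_rhs => rw [← hT q hq, norm_point, Real.log_exp]
    have h2 := G.abs_time_le (T q) (polarAngle q)
    rw [h1] at h2
    linarith
  obtain ⟨⟨t, θ⟩, -, hlim⟩ := (isCompact_Icc.prod isCompact_Icc).ultrafilter_le_nhds
    (U.map fun q => (T q, polarAngle q)) (le_principal_iff.2 hmem)
  have hlim : Tendsto (fun q => (T q, polarAngle q)) U (𝓝 (t, θ)) := hlim
  have h1 : Tendsto (fun q => G.point (T q) (polarAngle q)) U (𝓝 (G.point t θ)) :=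
    (G.continuous_point.tendsto (t, θ)).comp hlim
  have h2 : Tendsto (fun q => deriv (G.f (T q)) (polarAngle q)) U (𝓝 (deriv (G.f t) θ)) :=
    (G.continuous_deriv.tendsto (t, θ)).comp hlim
  have h3 : Tendsto (fun q => G.point (T q) (polarAngle q)) U (𝓝 p) :=
    (tendsto_id'.2 hU).congr' (by filter_upwards [hne] with q hq using (hT q hq).symm)
  rw [tendsto_nhds_unique h3 h1, slope_point]
  refine h2.congr' ?_
  filter_upwards [hne] with q hq
  conv_rhs => rw [← hT q hq, slope_point]

open Classical in
/-- The line field tangent to all the boundary curves. -/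
noncomputable def lineField (p : EuclideanSpace ℝ (Fin 2)) :
    Projectivization ℝ (EuclideanSpace ℝ (Fin 2)) :=
  if hp : p = 0 then Projectivization.mk ℝ (G.point 0 0) (G.point_ne_zero 0 0)
  else Projectivization.mk ℝ (G.slope p • p + quarterTurn p) (smul_add_quarterTurn_ne_zero _ hp)

lemma continuousOn_lineField : ContinuousOn G.lineField {p | p ≠ 0} := by
  rw [continuousOn_iff_continuous_domRestrict]
  have h1 : Continuous fun q : {p : EuclideanSpace ℝ (Fin 2) | p ≠ 0} => G.slope q :=
    continuous_iff_continuousAt.2 fun q =>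
      (G.continuousAt_slope q.2).comp continuous_subtype_val.continuousAt
  have h2 : Continuous fun q : {p : EuclideanSpace ℝ (Fin 2) | p ≠ 0} =>
      (⟨G.slope q • (q : EuclideanSpace ℝ (Fin 2)) + quarterTurn q,
        smul_add_quarterTurn_ne_zero _ q.2⟩ : {v : EuclideanSpace ℝ (Fin 2) // v ≠ 0}) :=
    ((h1.smul continuous_subtype_val).add
      (continuous_quarterTurn.comp continuous_subtype_val)).subtype_mk _
  have h3 : Continuous fun v : {v : EuclideanSpace ℝ (Fin 2) // v ≠ 0} =>
      Projectivization.mk ℝ (v : EuclideanSpace ℝ (Fin 2)) v.2 := continuous_quotient_mk'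
  have h4 : ({p | p ≠ 0} : Set (EuclideanSpace ℝ (Fin 2))).domRestrict G.lineField =
      fun q : {p : EuclideanSpace ℝ (Fin 2) | p ≠ 0} =>
        Projectivization.mk ℝ (G.slope q • (q : EuclideanSpace ℝ (Fin 2)) + quarterTurn q)
          (smul_add_quarterTurn_ne_zero _ q.2) := by
    funext q
    rw [domRestrict_apply, lineField, dif_neg q.2]
  rw [h4]
  exact h3.comp h2

lemma hasDerivAt_point (t θ : ℝ) : HasDerivAt (G.point t)
    (G.slope (G.point t θ) • G.point t θ + quarterTurn (G.point t θ)) θ := by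
  have h1 : HasDerivAt (G.f t) (deriv (G.f t) θ) θ :=
    ((G.contDiff_f t).differentiable (by simp) θ).hasDerivAt
  refine (h1.exp.smul (hasDerivAt_unitVec θ)).congr_deriv ?_
  rw [slope_point, point, quarterTurn_smul, smul_smul, add_comm, mul_comm]

lemma contDiff_point (t : ℝ) : ContDiff ℝ (⊤ : ℕ∞) (G.point t) :=
  (G.contDiff_f t).exp.smul contDiff_unitVec

end GrowthProfile

/-- There exist a Peano curve `γ : [0,∞) → ℝ²` (continuous, with image of
nonempty interior) and a continuous line field `Λ` on the punctured plane `ℝ² \ {γ 0}`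
(a continuous map to the real projective line of one-dimensional subspaces of `ℝ²`)
such that for every `t > 0` the boundary of the footprint `γ([0,t])` is the image of a
`C^∞` embedding `β` of the circle `𝕋 = ℝ/2πℤ` into `ℝ²` (here encoded as a smooth
`2π`-periodic map `β : ℝ → ℝ²` which is injective modulo `2π` and has nonvanishing
derivative), this boundary contains `γ t`, and for every `θ` the tangent line of `β`
at `θ` (the span of `β′(θ) ≠ 0`) equals `Λ(β θ)`. -/
theorem exists_peano_curve_with_smooth_footprints_tangent_to_line_field :
    ∃ (γ : ℝ → EuclideanSpace ℝ (Fin 2))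
      (Λ : EuclideanSpace ℝ (Fin 2) → Projectivization ℝ (EuclideanSpace ℝ (Fin 2))),
      ContinuousOn γ (Set.Ici 0) ∧
      (interior (γ '' Set.Ici 0)).Nonempty ∧
      ContinuousOn Λ {p | p ≠ γ 0} ∧
      ∀ t : ℝ, 0 < t →
        ∃ β : ℝ → EuclideanSpace ℝ (Fin 2),
          ContDiff ℝ (⊤ : ℕ∞) β ∧
          Function.Periodic β (2 * Real.pi) ∧
          (∀ θ₁ θ₂ : ℝ, β θ₁ = β θ₂ ↔ ∃ m : ℤ, θ₂ = θ₁ + m * (2 * Real.pi)) ∧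
          frontier (γ '' Set.Icc 0 t) = Set.range β ∧
          γ t ∈ frontier (γ '' Set.Icc 0 t) ∧
          ∀ θ : ℝ, ∃ h : deriv β θ ≠ 0,
            Λ (β θ) = Projectivization.mk ℝ (deriv β θ) h := by
  obtain ⟨G⟩ := nonempty_growthProfile
  refine ⟨G.curve, G.lineField, G.continuous_curve.continuousOn, ?_, ?_, fun t ht => ?_⟩
  · have hopen : IsOpen {p | G.gauge (Real.log 1) p < 1} :=
      isOpen_lt (G.continuous_gauge _) continuous_const
    refine ⟨0, interior_maximal (s := G.curve '' Ici 0) ?_ hopen (by simp [GrowthProfile.gauge])⟩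
    intro p (hp : G.gauge (Real.log 1) p < 1)
    have h1 : p ∈ G.curve '' Icc 0 1 := by
      rw [G.image_curve one_pos]
      exact hp.le
    exact image_mono Icc_subset_Ici_self h1
  · rw [G.curve_zero]
    exact G.continuousOn_lineField
  · refine ⟨G.point (Real.log t), G.contDiff_point _, fun θ => ?_, fun θ₁ θ₂ => ?_,
      G.frontier_image_curve ht, ?_, fun θ => ?_⟩
    · refine (G.point_eq_iff.2 ⟨⟨1, by simp⟩, ?_⟩).symm
      exact (G.periodic_f _ θ).symm
    · rw [G.point_eq_iff]
      refine ⟨fun h => h.1, fun h => ⟨h, ?_⟩⟩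
      obtain ⟨m, rfl⟩ := h
      exact (G.f_add_int_mul _ _ m).symm
    · rw [G.frontier_image_curve ht, G.curve_of_pos ht]
      exact mem_range_self _
    · have hd := (G.hasDerivAt_point (Real.log t) θ).deriv
      have hp := G.point_ne_zero (Real.log t) θ
      refine ⟨by rw [hd]; exact smul_add_quarterTurn_ne_zero _ hp, ?_⟩
      simp only [GrowthProfile.lineField, dif_neg hp, hd]
end

section
/- Let k : (0,∞) → ℕ be upper semicontinuous and ε : (0,∞) → (0,∞) be lower semicontinuous. Then there exist a Peano curve γ : [0,∞) → ℝ² and a continuous line field Λ on ℝ² \ {γ(0)} such that for every t > 0 the boundary of γ([0,t]) is the image of a C^∞ embedding β_t : 𝕋 → ℝ² containing γ(t), tangent to Λ at every point (β_t′(θ) ≠ 0 spans Λ(β_t(θ)) for all θ), and satisfying ‖β_t − α_t‖_{k(t)} < ε(t), where α_t : 𝕋 → ℝ² is the embedding θ ↦ (t cos θ, t sin θ). -/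
namespace Footprint

/-! ### Iterated random subdivision -/

/-- The probability of the branch `b`, where the branch `true` has probability `q θ`. -/
noncomputable def branchWeight (q : ℝ → ℝ) (b : Bool) (θ : ℝ) : ℝ :=
  if b then q θ else 1 - q θ

/-- The affine map taking the cell of `d` among `2 * m` separated cells in `(0, 1)` onto
`[0, 1]`. -/
def cellMap (m : ℕ) (d : Fin m × Bool) (t : ℝ) : ℝ :=
  3 * (2 * m * t - (2 * (d.1 : ℕ) + d.2.toNat : ℕ)) - 1

/-- The transfer operator of one subdivision into `m` layers, each with two branches. -/
noncomputable def subdivide (q : ℝ → ℝ) (m : ℕ) (G : ℝ → ℝ → ℝ) (t θ : ℝ) : ℝ :=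
  ∑ d : Fin m × Bool, (m : ℝ)⁻¹ * branchWeight q d.2 θ * G (cellMap m d t) θ

/-- The composition of the subdivision operators with indices `j, …, j + n - 1`. -/
noncomputable def subdivideIter (p : ℕ → ℝ → ℝ) (M : ℕ → ℕ) :
    ℕ → ℕ → (ℝ → ℝ → ℝ) → ℝ → ℝ → ℝ
  | _, 0, G => G
  | j, n + 1, G => subdivide (p j) (M j) (subdivideIter p M (j + 1) n G)

/-- The times in cells whose branch at the `n`-th subdivision, counted from the `j`-th one,
is `b`. -/
def branchTimes (M : ℕ → ℕ) (b : Bool) : ℕ → ℕ → Set ℝ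
  | 0, j => ⋃ d : Fin (M j) × Bool, {t | d.2 = b ∧ cellMap (M j) d t ∈ Set.Icc (0 : ℝ) 1}
  | n + 1, j => ⋃ d : Fin (M j) × Bool, cellMap (M j) d ⁻¹' branchTimes M b n (j + 1)

/-- Truncation of a real number to the unit interval. -/
noncomputable def unitClamp (t _θ : ℝ) : ℝ := max 0 (min 1 t)

/-- Functions which are equal to `0` before time `0` and to `1` after time `1`. -/
def IsClamped (G : ℝ → ℝ → ℝ) : Prop :=
  ∀ t θ, (t ≤ 0 → G t θ = 0) ∧ (1 ≤ t → G t θ = 1)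

/-- Functions which vanish outside the time interval `(0, 1)`. -/
def IsUnitSupported (R : ℝ → ℝ → ℝ) : Prop :=
  ∀ t θ, (t ≤ 0 → R t θ = 0) ∧ (1 ≤ t → R t θ = 0)

lemma branchWeight_add (q : ℝ → ℝ) (θ : ℝ) :
    branchWeight q true θ + branchWeight q false θ = 1 := by
  simp [branchWeight]

lemma branchWeight_nonneg {q : ℝ → ℝ} (hq : ∀ θ, q θ ∈ Set.Icc (0 : ℝ) 1) (b : Bool) (θ : ℝ) :
    0 ≤ branchWeight q b θ := by
  have := hq θ
  cases b <;> simp [branchWeight, this.1, this.2]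

lemma continuous_cellMap (m : ℕ) (d : Fin m × Bool) : Continuous (cellMap m d) := by
  unfold cellMap; fun_prop

lemma monotone_cellMap (m : ℕ) (d : Fin m × Bool) : Monotone (cellMap m d) := by
  intro s t h
  unfold cellMap
  have : (m : ℝ) * s ≤ m * t := by gcongr
  linarith

lemma cellMap_nonpos {m : ℕ} (d : Fin m × Bool) {t : ℝ} (ht : t ≤ 0) : cellMap m d t < 0 := by
  unfold cellMap
  have h1 : (m : ℝ) * t ≤ 0 := mul_nonpos_of_nonneg_of_nonpos (by positivity) ht
  have h2 : (0 : ℝ) ≤ (2 * (d.1 : ℕ) + d.2.toNat : ℕ) := by positivity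
  linarith

lemma one_le_cellMap {m : ℕ} (d : Fin m × Bool) {t : ℝ} (ht : 1 ≤ t) : 1 < cellMap m d t := by
  unfold cellMap
  have h1 : (m : ℝ) * 1 ≤ m * t := by gcongr
  have h3 : 2 * (d.1 : ℕ) + d.2.toNat + 1 ≤ 2 * m := by
    have := d.1.2
    have := Bool.toNat_le d.2
    omega
  have h4 : ((2 * (d.1 : ℕ) + d.2.toNat : ℕ) : ℝ) + 1 ≤ 2 * m := by exact_mod_cast h3
  linarith

lemma cellMap_surj {m : ℕ} (d : Fin m × Bool) (u : ℝ) : ∃ t, cellMap m d t = u := by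
  have hm : (m : ℝ) ≠ 0 := by
    have := d.1.2
    exact_mod_cast (by omega : m ≠ 0)
  refine ⟨((u + 1) / 3 + (2 * (d.1 : ℕ) + d.2.toNat : ℕ)) / (2 * m), ?_⟩
  unfold cellMap
  field_simp
  ring

lemma cellMap_injective_index {m : ℕ} {d d' : Fin m × Bool} {t : ℝ}
    (h : cellMap m d t ∈ Set.Icc (0 : ℝ) 1) (h' : cellMap m d' t ∈ Set.Icc (0 : ℝ) 1) :
    d = d' := by
  unfold cellMap at h h'
  obtain ⟨h1, h2⟩ := h
  obtain ⟨h3, h4⟩ := h'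
  have a : ((2 * (d.1 : ℕ) + d.2.toNat : ℕ) : ℝ) < (2 * (d'.1 : ℕ) + d'.2.toNat : ℕ) + 1 := by
    linarith
  have b : ((2 * (d'.1 : ℕ) + d'.2.toNat : ℕ) : ℝ) < (2 * (d.1 : ℕ) + d.2.toNat : ℕ) + 1 := by
    linarith
  have a' : 2 * (d.1 : ℕ) + d.2.toNat < 2 * (d'.1 : ℕ) + d'.2.toNat + 1 := by exact_mod_cast a
  have b' : 2 * (d'.1 : ℕ) + d'.2.toNat < 2 * (d.1 : ℕ) + d.2.toNat + 1 := by exact_mod_cast b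
  have := Bool.toNat_le d.2
  have := Bool.toNat_le d'.2
  have e1 : (d.1 : ℕ) = d'.1 := by omega
  have e2 : d.2.toNat = d'.2.toNat := by omega
  refine Prod.ext (Fin.ext e1) ?_
  cases h5 : d.2 <;> cases h6 : d'.2 <;> simp_all

lemma sum_weights (q : ℝ → ℝ) {m : ℕ} (hm : 0 < m) (θ : ℝ) :
    ∑ d : Fin m × Bool, (m : ℝ)⁻¹ * branchWeight q d.2 θ = 1 := by
  have : (m : ℝ) ≠ 0 := by positivity
  rw [Fintype.sum_prod_type]
  simp only [Fintype.sum_bool]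
  simp_rw [← mul_add, branchWeight_add]
  simp [this]

lemma isClamped_unitClamp : IsClamped unitClamp := fun t θ =>
  ⟨fun h => by simp [unitClamp, h], fun h => by simp [unitClamp, h]⟩

lemma IsClamped.subdivide {G : ℝ → ℝ → ℝ} (hG : IsClamped G) (q : ℝ → ℝ) {m : ℕ} (hm : 0 < m) :
    IsClamped (subdivide q m G) := by
  refine fun t θ => ⟨fun h => Finset.sum_eq_zero fun d _ => ?_, fun h => ?_⟩
  · rw [(hG _ θ).1 (cellMap_nonpos d h).le, mul_zero]
  · rw [← sum_weights q hm θ]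
    refine Finset.sum_congr rfl fun d _ => ?_
    rw [(hG _ θ).2 (one_le_cellMap d h).le, mul_one]

lemma IsUnitSupported.subdivide {G : ℝ → ℝ → ℝ} (hG : IsUnitSupported G) (q : ℝ → ℝ) (m : ℕ) :
    IsUnitSupported (subdivide q m G) := by
  refine fun t θ => ⟨fun h => Finset.sum_eq_zero fun d _ => ?_,
    fun h => Finset.sum_eq_zero fun d _ => ?_⟩
  · rw [(hG _ θ).1 (cellMap_nonpos d h).le, mul_zero]
  · rw [(hG _ θ).2 (one_le_cellMap d h).le, mul_zero]

lemma IsClamped.sub {F G : ℝ → ℝ → ℝ} (hF : IsClamped F) (hG : IsClamped G) :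
    IsUnitSupported (F - G) := fun t θ =>
  ⟨fun h => by simp [(hF t θ).1 h, (hG t θ).1 h], fun h => by simp [(hF t θ).2 h, (hG t θ).2 h]⟩

section Iter

variable {p : ℕ → ℝ → ℝ} {M : ℕ → ℕ}

lemma IsClamped.subdivideIter (hM : ∀ k, 0 < M k) {G : ℝ → ℝ → ℝ} (hG : IsClamped G) (n j : ℕ) :
    IsClamped (subdivideIter p M j n G) := by
  induction n generalizing j with
  | zero => exact hG
  | succ n ih => exact (ih (j + 1)).subdivide _ (hM j)

lemma IsUnitSupported.subdivideIter {G : ℝ → ℝ → ℝ} (hG : IsUnitSupported G) (n j : ℕ) :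
    IsUnitSupported (subdivideIter p M j n G) := by
  induction n generalizing j with
  | zero => exact hG
  | succ n ih => exact (ih (j + 1)).subdivide _ _

lemma subdivide_sub (q : ℝ → ℝ) (m : ℕ) (F G : ℝ → ℝ → ℝ) :
    subdivide q m (F - G) = subdivide q m F - subdivide q m G := by
  ext t θ
  simp [subdivide, mul_sub, Finset.sum_sub_distrib]

lemma subdivideIter_sub (F G : ℝ → ℝ → ℝ) (n j : ℕ) :
    subdivideIter p M j n (F - G) = subdivideIter p M j n F - subdivideIter p M j n G := by
  induction n generalizing j with
  | zero => rfl
  | succ n ih => simp only [subdivideIter, ih, subdivide_sub]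

lemma subdivideIter_succ' (G : ℝ → ℝ → ℝ) (n j : ℕ) :
    subdivideIter p M j (n + 1) G =
      subdivideIter p M j n (subdivide (p (j + n)) (M (j + n)) G) := by
  induction n generalizing j with
  | zero => rfl
  | succ n ih =>
    rw [subdivideIter, ih (j + 1), subdivideIter, show j + 1 + n = j + (n + 1) by ring]

lemma subdivide_mono {q : ℝ → ℝ} (hq : ∀ θ, q θ ∈ Set.Icc (0 : ℝ) 1) (m : ℕ) {G : ℝ → ℝ → ℝ}
    (hG : ∀ θ, Monotone fun t => G t θ) (θ : ℝ) : Monotone fun t => subdivide q m G t θ := by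
  intro s t h
  refine Finset.sum_le_sum fun d _ => ?_
  exact mul_le_mul_of_nonneg_left (hG θ (monotone_cellMap m d h))
    (mul_nonneg (by positivity) (branchWeight_nonneg hq _ _))

lemma subdivideIter_mono (hp : ∀ k θ, p k θ ∈ Set.Icc (0 : ℝ) 1) {G : ℝ → ℝ → ℝ}
    (hG : ∀ θ, Monotone fun t => G t θ) (n j : ℕ) (θ : ℝ) :
    Monotone fun t => subdivideIter p M j n G t θ := by
  induction n generalizing j θ with
  | zero => exact hG θ
  | succ n ih => exact subdivide_mono (hp j) _ (fun θ => ih (j + 1) θ) θ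

/-- At each time, at most one cell contributes to the subdivision of a unit supported
function. -/
lemma exists_subdivide_eq (q : ℝ → ℝ) (m : ℕ) {R : ℝ → ℝ → ℝ} (hR : IsUnitSupported R) (t : ℝ) :
    ∃ b s, ∀ θ, subdivide q m R t θ = (m : ℝ)⁻¹ * branchWeight q b θ * R s θ := by
  have key : ∀ d : Fin m × Bool, cellMap m d t ∉ Set.Icc (0 : ℝ) 1 →
      ∀ θ, R (cellMap m d t) θ = 0 := by
    intro d hd θ
    rcases le_or_gt (cellMap m d t) 0 with h | h
    · exact (hR _ θ).1 h
    · exact (hR _ θ).2 (not_lt.1 fun h' => hd ⟨h.le, h'.le⟩)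
  by_cases h : ∃ d : Fin m × Bool, cellMap m d t ∈ Set.Icc (0 : ℝ) 1
  · obtain ⟨d, hd⟩ := h
    refine ⟨d.2, cellMap m d t, fun θ => Finset.sum_eq_single d (fun d' _ hne => ?_) (by simp)⟩
    rw [key d' (fun h' => hne (cellMap_injective_index h' hd)), mul_zero]
  · push Not at h
    refine ⟨true, 0, fun θ => ?_⟩
    rw [(hR 0 θ).1 le_rfl, mul_zero]
    exact Finset.sum_eq_zero fun d _ => by rw [key d (h d), mul_zero]

lemma exists_subdivideIter_eq {R : ℝ → ℝ → ℝ} (hR : IsUnitSupported R) (n j : ℕ) (t : ℝ) :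
    ∃ (ω : ℕ → Bool) (s : ℝ), ∀ θ, subdivideIter p M j n R t θ =
      (∏ i ∈ Finset.range n, (M (j + i) : ℝ)⁻¹) *
        (∏ i ∈ Finset.range n, branchWeight (p (j + i)) (ω i) θ) * R s θ := by
  induction n generalizing j t with
  | zero => exact ⟨fun _ => true, t, fun θ => by simp [subdivideIter]⟩
  | succ n ih =>
    obtain ⟨b, s, h⟩ := exists_subdivide_eq (p j) (M j)
      (hR.subdivideIter (p := p) (M := M) n (j + 1)) t
    obtain ⟨ω, s', h'⟩ := ih (j + 1) s
    refine ⟨fun i => if i = 0 then b else ω (i - 1), s', fun θ => ?_⟩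
    rw [subdivideIter, h, h', Finset.prod_range_succ', Finset.prod_range_succ']
    simp only [add_zero, show ∀ i, j + 1 + i = j + (i + 1) by intro i; ring,
      Nat.add_eq_zero_iff, one_ne_zero, and_false, if_false, if_true, Nat.add_sub_cancel]
    ring

lemma unitClamp_mem (t θ : ℝ) : unitClamp t θ ∈ Set.Icc (0 : ℝ) 1 := by
  simp [unitClamp]

lemma exists_subdivide_unitClamp_sub (q : ℝ → ℝ) {m : ℕ} (hm : 0 < m) (s : ℝ) :
    ∃ a b : ℝ, |a| ≤ 1 ∧ |b| ≤ 1 ∧ ∀ θ, (subdivide q m unitClamp - unitClamp) s θ =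
      a * branchWeight q false θ + b * branchWeight q true θ := by
  let A : Bool → ℝ := fun b => ∑ l : Fin m, (m : ℝ)⁻¹ * unitClamp (cellMap m (l, b) s) 0
  have hA : ∀ b, A b ∈ Set.Icc (0 : ℝ) 1 := by
    intro b
    refine ⟨Finset.sum_nonneg fun l _ => mul_nonneg (by positivity) (unitClamp_mem _ _).1, ?_⟩
    calc A b ≤ ∑ l : Fin m, (m : ℝ)⁻¹ * 1 :=
          Finset.sum_le_sum fun l _ =>
            mul_le_mul_of_nonneg_left (unitClamp_mem _ _).2 (by positivity)
      _ = 1 := by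
          have : (m : ℝ) ≠ 0 := by positivity
          simp [this]
  have hs := unitClamp_mem s 0
  refine ⟨A false - unitClamp s 0, A true - unitClamp s 0, ?_, ?_, fun θ => ?_⟩
  · rw [abs_le]
    constructor <;> linarith [(hA false).1, (hA false).2, hs.1, hs.2]
  · rw [abs_le]
    constructor <;> linarith [(hA true).1, (hA true).2, hs.1, hs.2]
  · have e : subdivide q m unitClamp s θ =
        A false * branchWeight q false θ + A true * branchWeight q true θ := by
      simp only [subdivide, Fintype.sum_prod_type, Fintype.sum_bool, Finset.sum_add_distrib, A,
        Finset.sum_mul, unitClamp]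
      rw [add_comm]
      congr 1 <;> exact Finset.sum_congr rfl fun l _ => by ring
    have e' : unitClamp s θ = unitClamp s 0 := rfl
    have := branchWeight_add q θ
    simp only [Pi.sub_apply, e, e']
    linear_combination unitClamp s 0 * this

/-! ### The times of growth -/

lemma isClosed_branchTimes (b : Bool) (n j : ℕ) : IsClosed (branchTimes M b n j) := by
  induction n generalizing j with
  | zero =>
    refine isClosed_iUnion_of_finite fun d => ?_
    exact isClosed_const.inter (isClosed_Icc.preimage (continuous_cellMap _ d))
  | succ n ih =>
    exact isClosed_iUnion_of_finite fun d => (ih (j + 1)).preimage (continuous_cellMap _ d)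

lemma mem_Ioo_of_cellMap_mem {m : ℕ} {d : Fin m × Bool} {t : ℝ}
    (h : cellMap m d t ∈ Set.Icc (0 : ℝ) 1) : t ∈ Set.Ioo (0 : ℝ) 1 := by
  constructor
  · by_contra! h'
    exact absurd h.1 (cellMap_nonpos d h').not_ge
  · by_contra! h'
    exact absurd h.2 (one_le_cellMap d h').not_ge

lemma branchTimes_subset (b : Bool) (n j : ℕ) : branchTimes M b n j ⊆ Set.Ioo (0 : ℝ) 1 := by
  induction n generalizing j with
  | zero =>
    intro t ht
    simp only [branchTimes, Set.mem_iUnion] at ht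
    obtain ⟨d, -, hd⟩ := ht
    exact mem_Ioo_of_cellMap_mem hd
  | succ n ih =>
    intro t ht
    simp only [branchTimes, Set.mem_iUnion] at ht
    obtain ⟨d, hd⟩ := ht
    exact mem_Ioo_of_cellMap_mem (Set.Ioo_subset_Icc_self (ih (j + 1) hd))

lemma branch_unique (n j : ℕ) {t : ℝ} {b b' : Bool} (h : t ∈ branchTimes M b n j)
    (h' : t ∈ branchTimes M b' n j) : b = b' := by
  induction n generalizing j t with
  | zero =>
    simp only [branchTimes, Set.mem_iUnion] at h h'
    obtain ⟨d, rfl, hd⟩ := h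
    obtain ⟨d', rfl, hd'⟩ := h'
    rw [cellMap_injective_index hd hd']
  | succ n ih =>
    simp only [branchTimes, Set.mem_iUnion] at h h'
    obtain ⟨d, hd⟩ := h
    obtain ⟨d', hd'⟩ := h'
    obtain rfl := cellMap_injective_index (Set.Ioo_subset_Icc_self (branchTimes_subset _ _ _ hd))
      (Set.Ioo_subset_Icc_self (branchTimes_subset _ _ _ hd'))
    exact ih (j + 1) hd hd'

lemma exists_of_subdivide_ne {q : ℝ → ℝ} {m : ℕ} {G : ℝ → ℝ → ℝ} {s t θ : ℝ}
    (h : subdivide q m G s θ ≠ subdivide q m G t θ) :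
    ∃ d : Fin m × Bool, branchWeight q d.2 θ ≠ 0 ∧
      G (cellMap m d s) θ ≠ G (cellMap m d t) θ := by
  contrapose! h
  refine Finset.sum_congr rfl fun d _ => ?_
  by_cases hd : branchWeight q d.2 θ = 0
  · simp [hd]
  · rw [h d hd]

lemma exists_preimage_mem_Icc {m : ℕ} {d : Fin m × Bool} {s t u : ℝ}
    (hu : u ∈ Set.Icc (cellMap m d s) (cellMap m d t)) :
    ∃ v ∈ Set.Icc s t, cellMap m d v = u := by
  have hm : (0 : ℝ) < m := by
    have := d.1.2
    exact_mod_cast (by omega : 0 < m)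
  obtain ⟨v, rfl⟩ := cellMap_surj d u
  refine ⟨v, ?_, rfl⟩
  unfold cellMap at hu
  constructor
  · have : (m : ℝ) * s ≤ m * v := by linarith [hu.1]
    exact le_of_mul_le_mul_left this hm
  · have : (m : ℝ) * v ≤ m * t := by linarith [hu.2]
    exact le_of_mul_le_mul_left this hm

/-- Growth at `θ` only takes place at times whose branches all have positive probability
at `θ`. -/
lemma exists_mem_branchTimes (hM : ∀ k, 0 < M k) {G : ℝ → ℝ → ℝ} (hG : IsClamped G)
    {θ : ℝ} {n N : ℕ} (hN : n < N) (j : ℕ) {s t : ℝ} (hst : s ≤ t)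
    (h : subdivideIter p M j N G s θ ≠ subdivideIter p M j N G t θ) :
    ∃ b, branchWeight (p (j + n)) b θ ≠ 0 ∧ ∃ u ∈ Set.Icc s t, u ∈ branchTimes M b n j := by
  obtain ⟨N, rfl⟩ : ∃ N', N = N' + 1 := ⟨N - 1, by omega⟩
  induction n generalizing j s t N with
  | zero =>
    obtain ⟨d, hd, hne⟩ := exists_of_subdivide_ne h
    have hc := hG.subdivideIter (p := p) hM N (j + 1)
    have hle := monotone_cellMap (M j) d hst
    have h0 : 0 < cellMap (M j) d t := by
      by_contra! h0
      exact hne (by rw [(hc _ θ).1 h0, (hc _ θ).1 (hle.trans h0)])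
    have h1 : cellMap (M j) d s < 1 := by
      by_contra! h1
      exact hne (by rw [(hc _ θ).2 h1, (hc _ θ).2 (h1.trans hle)])
    obtain ⟨u, hu, hu'⟩ := exists_preimage_mem_Icc (d := d) (s := s) (t := t)
      (u := max 0 (cellMap (M j) d s)) ⟨le_max_right _ _, max_le h0.le hle⟩
    refine ⟨d.2, hd, u, hu, ?_⟩
    simp only [branchTimes, Set.mem_iUnion]
    exact ⟨d, rfl, hu' ▸ ⟨le_max_left _ _, max_le zero_le_one h1.le⟩⟩
  | succ n ih =>
    obtain ⟨d, hd, hne⟩ := exists_of_subdivide_ne h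
    obtain ⟨N, rfl⟩ : ∃ N', N = N' + 1 := ⟨N - 1, by omega⟩
    obtain ⟨b, hb, u, hu, hub⟩ := ih (j + 1) (monotone_cellMap (M j) d hst) N (by omega) hne
    obtain ⟨v, hv, rfl⟩ := exists_preimage_mem_Icc hu
    refine ⟨b, by rwa [show j + (n + 1) = j + 1 + n by ring], v, hv, ?_⟩
    simp only [branchTimes, Set.mem_iUnion]
    exact ⟨d, hub⟩

end Iter

/-! ### The limit of the subdivisions -/

/-- Families of smooth periodic functions which are continuous with their first derivative. -/
structure IsC1Family (G : ℝ → ℝ → ℝ) : Prop where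
  smooth : ∀ t, ContDiff ℝ (⊤ : ℕ∞) (G t)
  periodic : ∀ t, Function.Periodic (G t) (2 * Real.pi)
  cont : Continuous fun z : ℝ × ℝ => G z.1 z.2
  cont_deriv : Continuous fun z : ℝ × ℝ => deriv (G z.1) z.2

lemma continuous_unitClamp : Continuous fun z : ℝ × ℝ => unitClamp z.1 z.2 := by
  unfold unitClamp; fun_prop

lemma isC1Family_unitClamp : IsC1Family unitClamp where
  smooth _ := contDiff_const
  periodic _ _ := rfl
  cont := continuous_unitClamp
  cont_deriv := by
    have : ∀ t, deriv (unitClamp t) = fun _ => 0 := fun t => deriv_const' (max 0 (min 1 t))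
    simp_rw [this]
    exact continuous_const

lemma IsC1Family.sub {F G : ℝ → ℝ → ℝ} (hF : IsC1Family F) (hG : IsC1Family G) :
    IsC1Family (F - G) where
  smooth t := (hF.smooth t).sub (hG.smooth t)
  periodic t := (hF.periodic t).sub (hG.periodic t)
  cont := hF.cont.sub hG.cont
  cont_deriv := by
    have : ∀ t θ, deriv ((F - G) t) θ = deriv (F t) θ - deriv (G t) θ := fun t θ =>
      deriv_sub ((hF.smooth t).differentiable (by simp)).differentiableAt
        ((hG.smooth t).differentiable (by simp)).differentiableAt
    simp_rw [this]
    exact hF.cont_deriv.sub hG.cont_deriv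

section Smooth

variable {q : ℝ → ℝ}

lemma contDiff_branchWeight (hq : ContDiff ℝ (⊤ : ℕ∞) q) (b : Bool) :
    ContDiff ℝ (⊤ : ℕ∞) (branchWeight q b) := by
  cases b
  · exact (contDiff_const (c := (1 : ℝ))).sub hq
  · exact hq

lemma periodic_branchWeight {c : ℝ} (hq : Function.Periodic q c) (b : Bool) :
    Function.Periodic (branchWeight q b) c := by
  intro θ
  simp [branchWeight, hq θ]

lemma IsC1Family.subdivide (hq : ContDiff ℝ (⊤ : ℕ∞) q)
    (hper : Function.Periodic q (2 * Real.pi)) (m : ℕ) {G : ℝ → ℝ → ℝ}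
    (hG : IsC1Family G) : IsC1Family (subdivide q m G) where
  smooth t := by
    refine ContDiff.sum fun d _ => ?_
    exact (contDiff_const.mul (contDiff_branchWeight hq _)).mul (hG.smooth _)
  periodic t θ := by
    refine Finset.sum_congr rfl fun d _ => ?_
    rw [hG.periodic, periodic_branchWeight hper]
  cont := by
    refine continuous_finsetSum _ fun d _ => ?_
    refine (continuous_const.mul ((contDiff_branchWeight hq _).continuous.comp
      continuous_snd)).mul ?_
    exact hG.cont.comp (((continuous_cellMap m d).comp continuous_fst).prodMk continuous_snd)
  cont_deriv := by
    have hw : ∀ b, Differentiable ℝ (branchWeight q b) := fun b =>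
      (contDiff_branchWeight hq b).differentiable (by simp)
    have hd : ∀ t θ, deriv (Footprint.subdivide q m G t) θ =
        ∑ d : Fin m × Bool, ((m : ℝ)⁻¹ * deriv (branchWeight q d.2) θ * G (cellMap m d t) θ +
          (m : ℝ)⁻¹ * branchWeight q d.2 θ * deriv (G (cellMap m d t)) θ) := by
      intro t θ
      refine HasDerivAt.deriv (HasDerivAt.fun_sum fun d _ => ?_)
      exact (((hw d.2).differentiableAt.hasDerivAt).const_mul _).mul
        ((hG.smooth _).differentiable (by simp)).differentiableAt.hasDerivAt
    simp_rw [hd]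
    have hc : ∀ d, Continuous fun z : ℝ × ℝ => ((cellMap m d z.1, z.2) : ℝ × ℝ) := fun d =>
      ((continuous_cellMap m d).comp continuous_fst).prodMk continuous_snd
    refine continuous_finsetSum _ fun d _ => Continuous.add ?_ ?_
    · exact (continuous_const.mul (((contDiff_branchWeight hq _).continuous_deriv
        (by simp)).comp continuous_snd)).mul (hG.cont.comp (hc d))
    · exact (continuous_const.mul ((contDiff_branchWeight hq _).continuous.comp
        continuous_snd)).mul (hG.cont_deriv.comp (hc d))

lemma exists_bound_iteratedDeriv {c : ℝ} (hc : c ≠ 0) (hq : ContDiff ℝ (⊤ : ℕ∞) q)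
    (hper : Function.Periodic q c) (i : ℕ) : ∃ C, ∀ θ, ‖iteratedDeriv i q θ‖ ≤ C := by
  have h : Function.Periodic (iteratedDeriv i q) c := by
    intro θ
    have := congrFun (iteratedDeriv_comp_add_const (n := i) (f := q) (s := c)) θ
    simpa [show (fun z => q (z + c)) = q from funext hper] using this.symm
  obtain ⟨C, hC⟩ := (h.isBounded_of_continuous hc
    (hq.continuous_iteratedDeriv i (by exact_mod_cast le_top))).exists_norm_le
  exact ⟨C, fun θ => hC _ ⟨θ, rfl⟩⟩

end Smooth

section Limit

variable {p : ℕ → ℝ → ℝ}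

lemma isC1Family_subdivideIter (hp : ∀ k, ContDiff ℝ (⊤ : ℕ∞) (p k))
    (hper : ∀ k, Function.Periodic (p k) (2 * Real.pi)) (M : ℕ → ℕ) {G : ℝ → ℝ → ℝ}
    (hG : IsC1Family G) (n j : ℕ) : IsC1Family (subdivideIter p M j n G) := by
  induction n generalizing j with
  | zero => exact hG
  | succ n ih => exact (ih (j + 1)).subdivide (hp j) (hper j) _

/-- The change made by the `n`-th subdivision. -/
noncomputable def increment (p : ℕ → ℝ → ℝ) (M : ℕ → ℕ) (n : ℕ) : ℝ → ℝ → ℝ :=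
  subdivideIter p M 0 (n + 1) unitClamp - subdivideIter p M 0 n unitClamp

/-- The probability of a word of branches. -/
noncomputable def wordWeight (p : ℕ → ℝ → ℝ) (n : ℕ) (w : Fin n → Bool) (θ : ℝ) : ℝ :=
  ∏ i : Fin n, branchWeight (p i) (w i) θ

lemma exists_increment_eq {M : ℕ → ℕ} (hM : ∀ k, 0 < M k) (n : ℕ) (t : ℝ) :
    ∃ (a b : ℝ) (w w' : Fin (n + 1) → Bool), |a| ≤ 1 ∧ |b| ≤ 1 ∧
      ∀ θ, increment p M n t θ = (∏ i ∈ Finset.range n, (M i : ℝ)⁻¹) *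
        (a * wordWeight p (n + 1) w θ + b * wordWeight p (n + 1) w' θ) := by
  have hR : IsUnitSupported (subdivide (p n) (M n) unitClamp - unitClamp) :=
    (isClamped_unitClamp.subdivide _ (hM n)).sub isClamped_unitClamp
  obtain ⟨ω, s, h⟩ := exists_subdivideIter_eq (p := p) (M := M) hR n 0 t
  obtain ⟨a, b, ha, hb, hab⟩ := exists_subdivide_unitClamp_sub (p n) (hM n) s
  refine ⟨a, b, Fin.snoc (fun i => ω i) false, Fin.snoc (fun i => ω i) true, ha, hb,
    fun θ => ?_⟩
  rw [increment, subdivideIter_succ', ← subdivideIter_sub, zero_add, h, hab]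
  simp only [zero_add, wordWeight, Fin.prod_univ_castSucc, Fin.snoc_castSucc, Fin.snoc_last,
    Fin.val_castSucc, Fin.val_last, Finset.prod_range fun i => branchWeight (p i) (ω i) θ]
  ring

lemma contDiff_wordWeight (hp : ∀ k, ContDiff ℝ (⊤ : ℕ∞) (p k)) (n : ℕ) (w : Fin n → Bool) :
    ContDiff ℝ (⊤ : ℕ∞) (wordWeight p n w) :=
  contDiff_prod fun i _ => contDiff_branchWeight (hp i) _

lemma exists_bound_wordWeight (hp : ∀ k, ContDiff ℝ (⊤ : ℕ∞) (p k))
    (hper : ∀ k, Function.Periodic (p k) (2 * Real.pi)) (i n : ℕ) :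
    ∃ C, 0 ≤ C ∧ ∀ w θ, ‖iteratedDeriv i (wordWeight p n w) θ‖ ≤ C := by
  have hw : ∀ w, Function.Periodic (wordWeight p n w) (2 * Real.pi) := fun w θ =>
    Finset.prod_congr rfl fun i _ => periodic_branchWeight (hper i) _ θ
  choose C hC using fun w => exists_bound_iteratedDeriv Real.two_pi_pos.ne'
    (contDiff_wordWeight hp n w) (hw w) i
  have h0 : ∀ w, 0 ≤ C w := fun w => (norm_nonneg _).trans (hC w 0)
  exact ⟨∑ w, C w, Finset.sum_nonneg fun w _ => h0 w, fun w θ =>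
    (hC w θ).trans (Finset.single_le_sum (fun w _ => h0 w) (Finset.mem_univ w))⟩

/-- With sufficiently many layers, all derivatives of the increments are summable, uniformly
in time. -/
lemma exists_layers (hp : ∀ k, ContDiff ℝ (⊤ : ℕ∞) (p k))
    (hper : ∀ k, Function.Periodic (p k) (2 * Real.pi)) :
    ∃ (M : ℕ → ℕ) (v : ℕ → ℕ → ℝ), (∀ k, 0 < M k) ∧ (∀ i, Summable (v i)) ∧
      ∀ i n t θ, ‖iteratedDeriv i (increment p M n t) θ‖ ≤ v i n := by
  choose C hC0 hC using fun i n => exists_bound_wordWeight hp hper i (n + 1)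
  let S : ℕ → ℝ := fun m => ∑ i ∈ Finset.range (m + 2), C i (m + 1)
  let M : ℕ → ℕ := fun m => ⌈(2 : ℝ) ^ (m + 2) * S m⌉₊ + 1
  have hM : ∀ k, 0 < M k := fun k => Nat.succ_pos _
  let v : ℕ → ℕ → ℝ := fun i n => (∏ j ∈ Finset.range n, (M j : ℝ)⁻¹) * (2 * C i n)
  have hM1 : ∀ k, (M k : ℝ)⁻¹ ≤ 1 := fun k => inv_le_one_of_one_le₀ (by exact_mod_cast hM k)
  have hprod : ∀ n, 0 ≤ ∏ j ∈ Finset.range n, (M j : ℝ)⁻¹ := fun n =>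
    Finset.prod_nonneg fun j _ => by positivity
  refine ⟨M, v, hM, fun i => ?_, fun i n t θ => ?_⟩
  · rw [← summable_nat_add_iff (i + 1)]
    refine Summable.of_nonneg_of_le
      (fun n => mul_nonneg (hprod _) (mul_nonneg zero_le_two (hC0 _ _))) (fun n => ?_)
      summable_geometric_two
    have h1 : ∏ j ∈ Finset.range (n + (i + 1)), (M j : ℝ)⁻¹ ≤ (M (n + i) : ℝ)⁻¹ := by
      rw [show n + (i + 1) = (n + i) + 1 by ring, Finset.prod_range_succ]
      refine mul_le_of_le_one_left (by positivity) ?_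
      exact Finset.prod_le_one (fun j _ => by positivity) fun j _ => hM1 j
    have h2 : C i (n + i + 1) ≤ S (n + i) :=
      Finset.single_le_sum (f := fun j => C j (n + i + 1)) (fun j _ => hC0 _ _)
        (Finset.mem_range.2 (by omega))
    have h3 : (2 : ℝ) ^ (n + i + 2) * S (n + i) ≤ M (n + i) := by
      have := Nat.le_ceil ((2 : ℝ) ^ (n + i + 2) * S (n + i))
      simp only [M, Nat.cast_add, Nat.cast_one]
      linarith
    have h4 : (0 : ℝ) < M (n + i) := by exact_mod_cast hM _
    have h5 : (2 : ℝ) ^ (n + i + 2) * C i (n + i + 1) ≤ M (n + i) :=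
      (mul_le_mul_of_nonneg_left h2 (by positivity)).trans h3
    have h6 : (2 : ℝ) ^ n * 2 ≤ 2 ^ (n + i + 2) := by
      rw [← pow_succ]
      exact pow_le_pow_right₀ one_le_two (by omega)
    calc v i (n + (i + 1)) ≤ (M (n + i) : ℝ)⁻¹ * (2 * C i (n + i + 1)) :=
          mul_le_mul_of_nonneg_right h1 (mul_nonneg zero_le_two (hC0 _ _))
      _ ≤ (1 / 2) ^ n := by
          rw [one_div, inv_pow, inv_mul_le_iff₀ h4, ← div_eq_mul_inv,
            le_div_iff₀ (by positivity)]
          calc 2 * C i (n + i + 1) * 2 ^ n = (2 ^ n * 2) * C i (n + i + 1) := by ring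
            _ ≤ 2 ^ (n + i + 2) * C i (n + i + 1) :=
                mul_le_mul_of_nonneg_right h6 (hC0 _ _)
            _ ≤ _ := h5
  · obtain ⟨a, b, w, w', ha, hb, h⟩ := exists_increment_eq (p := p) hM n t
    have hs := fun w => ((contDiff_wordWeight hp (n + 1) w).of_le
      (by exact_mod_cast le_top : ((i : ℕ) : WithTop ℕ∞) ≤ ((⊤ : ℕ∞) : WithTop ℕ∞))).contDiffAt
        (x := θ)
    rw [show increment p M n t = _ from funext h, iteratedDeriv_const_mul_field,
      iteratedDeriv_fun_add (contDiffAt_const.mul (hs w)) (contDiffAt_const.mul (hs w')),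
      iteratedDeriv_const_mul_field, iteratedDeriv_const_mul_field, norm_mul,
      Real.norm_of_nonneg (hprod n)]
    refine mul_le_mul_of_nonneg_left ?_ (hprod n)
    have e : ∀ a : ℝ, |a| ≤ 1 → ∀ w,
        ‖a * iteratedDeriv i (wordWeight p (n + 1) w) θ‖ ≤ C i n := by
      intro a ha w
      rw [norm_mul]
      exact (mul_le_of_le_one_left (norm_nonneg _) ha).trans (hC i n w θ)
    have hw' := e b hb w'
    exact (norm_add_le _ _).trans (by linarith [e a ha w])

/-- A family of smooth functions growing from `0` to `1`, only at times at which all branches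
have positive probability. -/
theorem exists_growth (hp : ∀ k, ContDiff ℝ (⊤ : ℕ∞) (p k))
    (hper : ∀ k, Function.Periodic (p k) (2 * Real.pi))
    (h01 : ∀ k θ, p k θ ∈ Set.Icc (0 : ℝ) 1) :
    ∃ (M : ℕ → ℕ) (H : ℝ → ℝ → ℝ) (B : ℕ → ℝ), IsC1Family H ∧ IsClamped H ∧
      (∀ θ, Monotone fun t => H t θ) ∧
      (∀ i t θ, t ∈ Set.Icc (0 : ℝ) 1 → ‖iteratedDeriv i (fun θ => H t θ - t) θ‖ ≤ B i) ∧
      ∀ n s t θ, s ≤ t → H s θ ≠ H t θ →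
        ∃ b, branchWeight (p n) b θ ≠ 0 ∧ ∃ u ∈ Set.Icc s t, u ∈ branchTimes M b n 0 := by
  obtain ⟨M, v, hM, hv, hb⟩ := exists_layers hp hper
  have hT : ∀ n, IsC1Family (subdivideIter p M 0 n unitClamp) := fun n =>
    isC1Family_subdivideIter hp hper M isC1Family_unitClamp n 0
  have hI : ∀ n, IsC1Family (increment p M n) := fun n => (hT (n + 1)).sub (hT n)
  have hb0 : ∀ n t θ, ‖increment p M n t θ‖ ≤ v 0 n := fun n t θ => by
    simpa using hb 0 n t θ
  have hb1 : ∀ n t θ, ‖deriv (increment p M n t) θ‖ ≤ v 1 n := fun n t θ => by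
    simpa [iteratedDeriv_one] using hb 1 n t θ
  have hsum : ∀ t θ, Summable fun n => increment p M n t θ := fun t θ =>
    Summable.of_norm_bounded (hv 0) fun n => hb0 n t θ
  let D : ℝ → ℝ → ℝ := fun t θ => ∑' n, increment p M n t θ
  let H : ℝ → ℝ → ℝ := fun t θ => unitClamp t θ + D t θ
  have hlim : ∀ t θ, Filter.Tendsto (fun n => subdivideIter p M 0 n unitClamp t θ) Filter.atTop
      (nhds (H t θ)) := by
    intro t θ
    have := ((hsum t θ).hasSum.tendsto_sum_nat).const_add (unitClamp t θ)
    refine this.congr fun n => ?_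
    have e := Finset.sum_range_sub (fun n => subdivideIter p M 0 n unitClamp t θ) n
    simp only [increment, Pi.sub_apply]
    rw [e]
    simp [subdivideIter]
  have hiter : ∀ i n t θ, ‖iteratedFDeriv ℝ i (increment p M n t) θ‖ ≤ v i n := fun i n t θ => by
    rw [norm_iteratedFDeriv_eq_norm_iteratedDeriv]
    exact hb i n t θ
  have hD : ∀ t, ContDiff ℝ (⊤ : ℕ∞) (D t) := fun t =>
    contDiff_tsum (fun n => (hI n).smooth t) (fun i _ => hv i) fun i n θ _ => hiter i n t θ
  have hDbound : ∀ i t θ, ‖iteratedDeriv i (D t) θ‖ ≤ ∑' n, v i n := by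
    intro i t θ
    rw [← norm_iteratedFDeriv_eq_norm_iteratedDeriv,
      iteratedFDeriv_tsum_apply (N := (⊤ : ℕ∞)) (fun n => (hI n).smooth t) (fun i _ => hv i)
        (fun i n θ _ => hiter i n t θ) le_top]
    exact tsum_of_norm_bounded (hv i).hasSum fun n => hiter i n t θ
  have hcl : IsClamped H := fun t θ =>
    ⟨fun h => tendsto_nhds_unique (hlim t θ) (tendsto_const_nhds.congr fun n =>
      ((isClamped_unitClamp.subdivideIter hM n 0 t θ).1 h).symm),
    fun h => tendsto_nhds_unique (hlim t θ) (tendsto_const_nhds.congr fun n =>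
      ((isClamped_unitClamp.subdivideIter hM n 0 t θ).2 h).symm)⟩
  have hHd : ∀ t, deriv (H t) = deriv (D t) := fun t => by
    ext θ
    exact deriv_const_add (f := D t) (unitClamp t 0)
  refine ⟨M, H, fun i => ∑' n, v i n, ⟨fun t => contDiff_const.add (hD t), fun t θ => ?_, ?_, ?_⟩,
    hcl, fun θ s t hst => ?_, fun i t θ ht => ?_, fun n s t θ hst hne => ?_⟩
  · simp only [H, D]
    simp_rw [(hI _).periodic t θ]
    rfl
  · exact continuous_unitClamp.add
      (continuous_tsum (fun n => (hI n).cont) (hv 0) fun n z => hb0 n z.1 z.2)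
  · have : ∀ t, deriv (D t) = fun θ => ∑' n, deriv (increment p M n t) θ := fun t =>
      deriv_tsum (hv 1) (fun n => ((hI n).smooth t).differentiable (by simp))
        (fun n θ => hb1 n t θ) (hsum t 0)
    simp_rw [hHd, this]
    exact continuous_tsum (fun n => (hI n).cont_deriv) (hv 1) fun n z => hb1 n z.1 z.2
  · refine le_of_tendsto_of_tendsto' (hlim s θ) (hlim t θ) fun n => ?_
    refine subdivideIter_mono h01 (fun θ s t hst => ?_) n 0 θ hst
    exact max_le_max le_rfl (min_le_min le_rfl hst)
  · have : (fun θ => H t θ - t) = D t := by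
      ext θ
      simp [H, unitClamp, ht.1, ht.2]
    rw [this]
    exact hDbound i t θ
  · have : ∃ N, n < N ∧
        subdivideIter p M 0 N unitClamp s θ ≠ subdivideIter p M 0 N unitClamp t θ := by
      by_contra! h
      refine hne (tendsto_nhds_unique (hlim s θ) ((hlim t θ).congr' ?_))
      filter_upwards [Filter.eventually_gt_atTop n] with N hN using (h N hN).symm
    obtain ⟨N, hN, hne'⟩ := this
    simpa using exists_mem_branchTimes hM isClamped_unitClamp hN 0 hst hne'

end Limit

/-! ### The position of growth -/

lemma exists_rat_affine_separating {x y : ℝ} (h : x ≠ y) :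
    ∃ a c : ℚ, (a : ℝ) * x + c < 0 ∧ 1 < (a : ℝ) * y + c := by
  obtain ⟨a, ha⟩ : ∃ a : ℚ, 1 < (a : ℝ) * (y - x) := by
    rcases lt_or_gt_of_ne h with h | h
    · obtain ⟨a, ha⟩ := exists_rat_gt (1 / (y - x))
      exact ⟨a, (div_lt_iff₀ (sub_pos.2 h)).1 ha⟩
    · obtain ⟨a, ha⟩ := exists_rat_lt (1 / (y - x))
      exact ⟨a, (lt_div_iff_of_neg (sub_neg.2 h)).1 ha⟩
  obtain ⟨c, hc1, hc2⟩ := exists_rat_btwn (show 1 - (a : ℝ) * y < -(a * x) by linarith)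
  exact ⟨a, c, by linarith, by linarith⟩

/-- A sequence of smooth functions on the circle separating points. -/
lemma exists_separating_sequence : ∃ τ : ℕ → ℝ → ℝ,
    (∀ k, ContDiff ℝ (⊤ : ℕ∞) (τ k)) ∧ (∀ k, Function.Periodic (τ k) (2 * Real.pi)) ∧
    (∃ k, ∀ θ, τ k θ = Real.cos θ + 1 / 2) ∧
    ∀ θ θ', ¬(Real.cos θ = Real.cos θ' ∧ Real.sin θ = Real.sin θ') →
      ∃ k, τ k θ < 0 ∧ 1 < τ k θ' := by
  obtain ⟨e, he⟩ := exists_surjective_nat (ℚ × ℚ × ℚ)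
  refine ⟨fun k θ => (e k).1 * Real.cos θ + (e k).2.1 * Real.sin θ + (e k).2.2, fun k => ?_,
    fun k θ => ?_, ?_, fun θ θ' h => ?_⟩
  · have := Real.contDiff_cos (n := ((⊤ : ℕ∞) : WithTop ℕ∞))
    have := Real.contDiff_sin (n := ((⊤ : ℕ∞) : WithTop ℕ∞))
    fun_prop
  · simp
  · obtain ⟨k, hk⟩ := he (1, 0, 1 / 2)
    exact ⟨k, fun θ => by simp [hk]⟩
  · by_cases hc : Real.cos θ = Real.cos θ'
    · obtain ⟨a, c, h1, h2⟩ := exists_rat_affine_separating (fun hs => h ⟨hc, hs⟩)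
      obtain ⟨k, hk⟩ := he (0, a, c)
      exact ⟨k, by simpa [hk] using h1, by simpa [hk] using h2⟩
    · obtain ⟨a, c, h1, h2⟩ := exists_rat_affine_separating hc
      obtain ⟨k, hk⟩ := he (a, 0, c)
      exact ⟨k, by simpa [hk] using h1, by simpa [hk] using h2⟩

/-- The values of a test function allowed by a branch. -/
def branchRange (b : Bool) : Set ℝ := if b then Set.Ici 0 else Set.Iic 1

lemma isClosed_branchRange (b : Bool) : IsClosed (branchRange b) := by
  cases b
  · exact isClosed_Iic
  · exact isClosed_Ici

lemma mem_branchRange {τ : ℝ → ℝ} {b : Bool} {θ : ℝ}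
    (h : branchWeight (fun θ => Real.smoothTransition (τ θ)) b θ ≠ 0) : τ θ ∈ branchRange b := by
  cases b
  · by_contra hlt
    refine h ?_
    simp only [branchRange, Bool.false_eq_true, if_false, Set.mem_Iic, not_le] at hlt
    simp [branchWeight, Real.smoothTransition.one_of_one_le hlt.le]
  · by_contra hlt
    refine h ?_
    simp only [branchRange, if_true, Set.mem_Ici, not_le] at hlt
    simp [branchWeight, Real.smoothTransition.zero_of_nonpos hlt.le]

/-- The angles in the fundamental domain associated to a branch. -/
def angleRange (b : Bool) : Set ℝ :=
  if b then Set.Icc (-Real.pi) Real.pi else Set.Icc 0 (2 * Real.pi)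

lemma isCompact_angleRange (b : Bool) : IsCompact (angleRange b) := by
  cases b <;> exact isCompact_Icc

lemma exists_mem_angleRange (b : Bool) (θ : ℝ) : ∃ m : ℤ, θ + m * (2 * Real.pi) ∈ angleRange b := by
  cases b
  · refine ⟨-toIcoDiv Real.two_pi_pos 0 θ, ?_⟩
    have := toIcoMod_mem_Ico' Real.two_pi_pos θ
    rw [toIcoMod, zsmul_eq_mul] at this
    refine ⟨?_, ?_⟩ <;> push_cast <;> linarith [this.1, this.2]
  · refine ⟨-toIcoDiv Real.two_pi_pos (-Real.pi) θ, ?_⟩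
    have := toIcoMod_mem_Ico Real.two_pi_pos (-Real.pi) θ
    rw [toIcoMod, zsmul_eq_mul] at this
    refine ⟨?_, ?_⟩ <;> push_cast <;> linarith [this.1, this.2]

lemma exists_eq_add_int_mul {θ θ' : ℝ} (hc : Real.cos θ = Real.cos θ')
    (hs : Real.sin θ = Real.sin θ') : ∃ m : ℤ, θ' = θ + m * (2 * Real.pi) := by
  have h : (θ : Real.Angle) = θ' := Real.Angle.cos_sin_inj hc hs
  obtain ⟨m, hm⟩ := Real.Angle.angle_eq_iff_two_pi_dvd_sub.1 h
  refine ⟨-m, ?_⟩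
  push_cast
  linarith

lemma eq_of_mem_angleRange {b : Bool} {θ θ' : ℝ} (h : θ ∈ angleRange b) (h' : θ' ∈ angleRange b)
    (hc : Real.cos θ = Real.cos θ') (hs : Real.sin θ = Real.sin θ')
    (hb : Real.cos θ + 1 / 2 ∈ branchRange b) : θ = θ' := by
  obtain ⟨m, rfl⟩ := exists_eq_add_int_mul hc hs
  have hpi := Real.pi_pos
  suffices hm : m = 0 by simp [hm]
  have hlen : ∀ a : ℝ, θ ∈ Set.Icc a (a + 2 * Real.pi) →
      θ + m * (2 * Real.pi) ∈ Set.Icc a (a + 2 * Real.pi) →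
      m = 0 ∨ θ = a ∨ θ = a + 2 * Real.pi := by
    intro a ha ha'
    by_contra! hne
    obtain ⟨h0, h1, h2⟩ := hne
    have h1' := lt_of_le_of_ne ha.1 h1.symm
    have h2' := lt_of_le_of_ne ha.2 h2
    rcases lt_or_gt_of_ne h0 with hm | hm
    · have : (m : ℝ) ≤ -1 := by exact_mod_cast (by omega : m ≤ -1)
      nlinarith [ha'.1]
    · have : (1 : ℝ) ≤ m := by exact_mod_cast (by omega : 1 ≤ m)
      nlinarith [ha'.2]
  cases b
  · simp only [angleRange, branchRange, Bool.false_eq_true, if_false] at h h' hb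
    rcases hlen 0 (by simpa using h) (by simpa using h') with h0 | h0 | h0
    · exact h0
    · simp only [h0, Real.cos_zero, Set.mem_Iic] at hb
      norm_num at hb
    · simp only [h0, zero_add, Real.cos_two_pi, Set.mem_Iic] at hb
      norm_num at hb
  · simp only [angleRange, branchRange, if_true] at h h' hb
    have e : Real.pi = -Real.pi + 2 * Real.pi := by ring
    rcases hlen (-Real.pi) (by rwa [← e]) (by rwa [← e]) with h0 | h0 | h0
    · exact h0
    · simp only [h0, Real.cos_neg, Real.cos_pi, Set.mem_Ici] at hb
      norm_num at hb
    · rw [← e] at h0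
      simp only [h0, Real.cos_pi, Set.mem_Ici] at hb
      norm_num at hb

/-- A compact relation which is a partial function extends to a continuous function. -/
lemma exists_continuous_of_isCompact {C : Set (ℝ × ℝ)} (hC : IsCompact C)
    (hinj : ∀ u θ θ', (u, θ) ∈ C → (u, θ') ∈ C → θ = θ') :
    ∃ x : ℝ → ℝ, Continuous x ∧ ∀ u θ, (u, θ) ∈ C → x u = θ := by
  have : CompactSpace C := isCompact_iff_compactSpace.1 hC
  have hcont : Continuous fun z : C => z.1.1 := continuous_fst.comp continuous_subtype_val
  have he : Topology.IsClosedEmbedding fun z : C => z.1.1 := by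
    refine hcont.isClosedEmbedding ?_
    rintro ⟨⟨u, θ⟩, h⟩ ⟨⟨u', θ'⟩, h'⟩ (rfl : u = u')
    rw [Subtype.mk.injEq, hinj u θ θ' h h']
  obtain ⟨g, hg⟩ := ContinuousMap.exists_extension he
    (⟨fun z : C => z.1.2, continuous_snd.comp continuous_subtype_val⟩ : C(C, ℝ))
  exact ⟨g, g.continuous, fun u θ h => congrArg (fun f : C(C, ℝ) => f ⟨(u, θ), h⟩) hg⟩

/-- A family of smooth functions on the circle growing from `0` to `1` at one point at a
time, this point moving continuously. -/
theorem exists_pointwise_growth : ∃ (H : ℝ → ℝ → ℝ) (x : ℝ → ℝ) (B : ℕ → ℝ),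
    IsC1Family H ∧ IsClamped H ∧ (∀ θ, Monotone fun t => H t θ) ∧
    (∀ i t θ, t ∈ Set.Icc (0 : ℝ) 1 → ‖iteratedDeriv i (fun θ => H t θ - t) θ‖ ≤ B i) ∧
    Continuous x ∧ x 0 = 0 ∧ x 1 = 0 ∧
    ∀ s θ, (∀ s' < s, H s' θ < H s θ) →
      Real.cos (x s) = Real.cos θ ∧ Real.sin (x s) = Real.sin θ := by
  obtain ⟨τ, hτ, hτper, ⟨k₀, hk₀⟩, hsep⟩ := exists_separating_sequence
  obtain ⟨M, H, B, hH, hcl, hmono, hB, hgrow⟩ := exists_growth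
    (p := fun k θ => Real.smoothTransition (τ k θ))
    (fun k => Real.smoothTransition.contDiff.comp (hτ k))
    (fun k θ => by simp only [hτper k θ])
    (fun k θ => ⟨Real.smoothTransition.nonneg _, Real.smoothTransition.le_one _⟩)
  let K : Set (ℝ × ℝ) := {z | ∀ k, ∃ b, z.1 ∈ branchTimes M b k 0 ∧ τ k z.2 ∈ branchRange b}
  let A : Set (ℝ × ℝ) := {z | ∃ b, z.1 ∈ branchTimes M b k₀ 0 ∧ z.2 ∈ angleRange b}
  have hU : ∀ b k, IsCompact (branchTimes M b k 0) := fun b k =>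
    isCompact_Icc.of_isClosed_subset (isClosed_branchTimes b k 0)
      ((branchTimes_subset b k 0).trans Set.Ioo_subset_Icc_self)
  have hK : IsClosed K := by
    simp only [K, Set.ofPred_forall, Set.ofPred_exists]
    refine isClosed_iInter fun k => isClosed_iUnion_of_finite fun b => ?_
    exact ((isClosed_branchTimes b k 0).preimage continuous_fst).inter
      ((isClosed_branchRange b).preimage ((hτ k).continuous.comp continuous_snd))
  have hA : IsCompact A := by
    simp only [A, Set.ofPred_exists]
    refine isCompact_iUnion fun b => ?_
    exact (hU b k₀).prod (isCompact_angleRange b)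
  have hKIoo : ∀ z ∈ K, z.1 ∈ Set.Ioo (0 : ℝ) 1 := fun z hz => by
    obtain ⟨b, hb, -⟩ := hz 0
    exact branchTimes_subset b 0 0 hb
  obtain ⟨x, hx, hxC⟩ := exists_continuous_of_isCompact
    (C := (K ∩ A) ∪ {((0 : ℝ), (0 : ℝ)), ((1 : ℝ), (0 : ℝ))})
    ((hA.inter_left hK).union (Set.toFinite _).isCompact) (by
      intro u θ θ' h h'
      have hends : ∀ θ, (u, θ) ∈ ({((0 : ℝ), (0 : ℝ)), ((1 : ℝ), (0 : ℝ))} : Set (ℝ × ℝ)) →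
          (u = 0 ∨ u = 1) ∧ θ = 0 := by
        intro θ h
        simp only [Set.mem_insert_iff, Set.mem_singleton_iff, Prod.mk.injEq] at h
        tauto
      have hno : ∀ θ, (u, θ) ∈ K → ¬(u = 0 ∨ u = 1) := by
        intro θ h h'
        have := hKIoo _ h
        rcases h' with rfl | rfl
        · exact lt_irrefl _ this.1
        · exact lt_irrefl _ this.2
      rcases h with h | h <;> rcases h' with h' | h'
      · have hcs : Real.cos θ = Real.cos θ' ∧ Real.sin θ = Real.sin θ' := by
          by_contra hne
          obtain ⟨k, h1, h2⟩ := hsep _ _ hne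
          obtain ⟨b, hb, hb'⟩ := h.1 k
          obtain ⟨c, hc, hc'⟩ := h'.1 k
          obtain rfl := branch_unique _ _ hb hc
          cases b
          · exact h2.not_ge hc'
          · exact h1.not_ge hb'
        obtain ⟨b, hb, hbθ⟩ := h.2
        obtain ⟨c, hc, hcθ⟩ := h'.2
        obtain rfl := branch_unique _ _ hb hc
        obtain ⟨c, hc, hcθ'⟩ := h.1 k₀
        obtain rfl := branch_unique _ _ hb hc
        rw [hk₀] at hcθ'
        exact eq_of_mem_angleRange hbθ hcθ hcs.1 hcs.2 hcθ'
      · exact absurd (hends _ h').1 (hno _ h.1)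
      · exact absurd (hends _ h).1 (hno _ h'.1)
      · rw [(hends _ h).2, (hends _ h').2])
  refine ⟨H, x, B, hH, hcl, hmono, hB, hx, hxC 0 0 (by simp), hxC 1 0 (by simp),
    fun s θ hs => ?_⟩
  have hsK : ∀ k, ∃ b, s ∈ branchTimes M b k 0 ∧ τ k θ ∈ branchRange b := by
    intro k
    by_contra! hne
    have hcl : IsClosed (⋃ b ∈ {b | τ k θ ∈ branchRange b}, branchTimes M b k 0) :=
      (Set.toFinite _).isClosed_biUnion fun b _ => isClosed_branchTimes b k 0
    have hmem : s ∉ ⋃ b ∈ {b | τ k θ ∈ branchRange b}, branchTimes M b k 0 := by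
      simp only [Set.mem_iUnion, Set.mem_ofPred_eq, not_exists]
      exact fun b hb hb' => hne b hb' hb
    obtain ⟨δ, hδ, hsub⟩ := Metric.isOpen_iff.1 hcl.isOpen_compl s hmem
    have hlt : s - δ / 2 < s := by linarith
    obtain ⟨b, hb, u, hu, hub⟩ := hgrow k _ s θ hlt.le (hs _ hlt).ne
    refine hsub (a := u) ?_ (Set.mem_biUnion (mem_branchRange hb) hub)
    rw [Metric.mem_ball, Real.dist_eq, abs_lt]
    constructor <;> linarith [hu.1, hu.2]
  obtain ⟨b, hb, -⟩ := hsK k₀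
  obtain ⟨m, hm⟩ := exists_mem_angleRange b θ
  have hper : ∀ k, τ k (θ + m * (2 * Real.pi)) = τ k θ := fun k => (hτper k).int_mul m θ
  have := hxC s (θ + m * (2 * Real.pi)) (Or.inl ⟨fun k => by simpa only [hper] using hsK k,
    b, hb, hm⟩)
  rw [this, Real.cos_add_int_mul_two_pi, Real.sin_add_int_mul_two_pi]
  exact ⟨rfl, rfl⟩

/-! ### Bi-infinite subdivisions -/

/-- A positive `1`-Lipschitz minorant of a locally positive function. -/
lemma exists_continuous_minorant {η : ℝ → ℝ}
    (hη : ∀ t > 0, ∃ c > 0, ∃ r > 0, ∀ s > 0, |s - t| < r → c ≤ η s) :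
    ∃ ρ : ℝ → ℝ, (∀ t > 0, 0 < ρ t) ∧ (∀ t > 0, ρ t ≤ η t) ∧
      ∀ s > 0, ∀ t > 0, ρ s ≤ ρ t + |s - t| := by
  have hpos : ∀ t > 0, 0 < η t := fun t ht => by
    obtain ⟨c, hc, r, hr, h⟩ := hη t ht
    exact hc.trans_le (h t ht (by simpa using hr))
  have hbdd : ∀ t, BddBelow (Set.range fun s : Set.Ioi (0 : ℝ) => η s + |(s : ℝ) - t|) :=
    fun t => ⟨0, by
      rintro _ ⟨s, rfl⟩
      have := hpos s s.2
      positivity⟩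
  have : Nonempty (Set.Ioi (0 : ℝ)) := ⟨⟨1, Set.mem_Ioi.2 one_pos⟩⟩
  refine ⟨fun t => ⨅ s : Set.Ioi (0 : ℝ), (η s + |(s : ℝ) - t|), fun t ht => ?_, fun t ht => ?_,
    fun s hs t ht => ?_⟩
  · obtain ⟨c, hc, r, hr, h⟩ := hη t ht
    refine (lt_min hc hr).trans_le (le_ciInf fun s => ?_)
    rcases lt_or_ge |(s : ℝ) - t| r with hs | hs
    · exact (min_le_left _ _).trans ((h s s.2 hs).trans (le_add_of_nonneg_right (abs_nonneg _)))
    · exact (min_le_right _ _).trans (hs.trans (le_add_of_nonneg_left (hpos s s.2).le))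
  · exact (ciInf_le (hbdd t) ⟨t, ht⟩).trans (by simp)
  · refine sub_le_iff_le_add.1 (le_ciInf fun u => ?_)
    have h1 := ciInf_le (hbdd s) u
    have h2 := abs_sub_le (u : ℝ) t s
    rw [abs_sub_comm t s] at h2
    linarith

/-- Subdivision of `(0, ∞)` into intervals shorter than a locally positive function. -/
lemma exists_subdivision {η : ℝ → ℝ}
    (hη : ∀ t > 0, ∃ c > 0, ∃ r > 0, ∀ s > 0, |s - t| < r → c ≤ η s)
    (hηt : ∀ t > 0, η t ≤ t / 2) :
    ∃ g : ℤ → ℝ, StrictMono g ∧ (∀ n, 0 < g n) ∧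
      (∀ t > 0, ∃ n, t ∈ Set.Ioc (g n) (g (n + 1))) ∧
      ∀ n, ∀ t ∈ Set.Icc (g n) (g (n + 1)), g (n + 1) - g n ≤ η t := by
  obtain ⟨ρ, hpos, hle, hlip⟩ := exists_continuous_minorant hη
  have hlet : ∀ t > 0, ρ t ≤ t / 2 := fun t ht => (hle t ht).trans (hηt t ht)
  let a : ℕ → ℝ := fun n => (fun t => t + ρ t / 2)^[n] 1
  let b : ℕ → ℝ := fun n => (fun t => t - ρ t / 2)^[n] 1
  have ha : ∀ n, a (n + 1) = a n + ρ (a n) / 2 := fun n => Function.iterate_succ_apply' _ _ _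
  have hb : ∀ n, b (n + 1) = b n - ρ (b n) / 2 := fun n => Function.iterate_succ_apply' _ _ _
  have hapos : ∀ n, 0 < a n := by
    intro n
    induction n with
    | zero => exact one_pos
    | succ n ih => rw [ha]; linarith [hpos _ ih]
  have hbpos : ∀ n, 0 < b n := by
    intro n
    induction n with
    | zero => exact one_pos
    | succ n ih => rw [hb]; linarith [hlet _ ih]
  have hamono : Monotone a := monotone_nat_of_le_succ fun n => by
    rw [ha]; linarith [hpos _ (hapos n)]
  have hbanti : Antitone b := antitone_nat_of_succ_le fun n => by
    rw [hb]; linarith [hpos _ (hbpos n)]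
  have hatop : ∀ t, ∃ n, t ≤ a n := by
    intro t
    by_contra! h
    have hlim := tendsto_atTop_ciSup hamono ⟨t, by rintro _ ⟨n, rfl⟩; exact (h n).le⟩
    set L := ⨆ n, a n with hL
    have hLn : ∀ n, a n ≤ L := fun n =>
      le_ciSup (f := a) ⟨t, by rintro _ ⟨n, rfl⟩; exact (h n).le⟩ n
    have hL0 : 0 < L := (hapos 0).trans_le (hLn 0)
    obtain ⟨n, hn⟩ := (hlim.eventually (lt_mem_nhds (show L - ρ L / 3 < L by
      linarith [hpos L hL0]))).exists
    have h1 := hlip L hL0 (a n) (hapos n)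
    have h2 := hLn (n + 1)
    rw [abs_of_nonneg (by linarith [hLn n])] at h1
    rw [ha] at h2
    linarith [hpos L hL0]
  have hbbot : ∀ t > 0, ∃ n, b n < t := by
    intro t ht
    by_contra! h
    have hbd : BddBelow (Set.range b) := ⟨t, by rintro _ ⟨n, rfl⟩; exact h n⟩
    have hlim := tendsto_atTop_ciInf hbanti hbd
    set L := ⨅ n, b n with hL
    have hLn : ∀ n, L ≤ b n := fun n => ciInf_le hbd n
    have hL0 : 0 < L := ht.trans_le (le_ciInf h)
    obtain ⟨n, hn⟩ := (hlim.eventually (gt_mem_nhds (show L < L + ρ L / 3 by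
      linarith [hpos L hL0]))).exists
    have h1 := hlip L hL0 (b n) (hbpos n)
    have h2 := hLn (n + 1)
    rw [abs_of_nonpos (by linarith [hLn n])] at h1
    rw [hb] at h2
    linarith [hpos L hL0]
  let g : ℤ → ℝ := fun n => if 0 ≤ n then a n.toNat else b (-n).toNat
  have hga : ∀ n : ℕ, g n = a n := fun n => by simp [g]
  have hgb : ∀ n : ℕ, g (-n) = b n := fun n => by
    rcases n.eq_zero_or_pos with rfl | hn
    · simp [g, a, b]
    · simp only [g]
      rw [if_neg (by omega)]
      simp
  have hcases : ∀ n : ℤ, (∃ m : ℕ, g n = a m ∧ g (n + 1) = a (m + 1)) ∨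
      ∃ m : ℕ, g n = b (m + 1) ∧ g (n + 1) = b m := by
    intro n
    rcases lt_or_ge n 0 with hn | hn
    · obtain ⟨m, rfl⟩ : ∃ m : ℕ, n = -((m + 1 : ℕ) : ℤ) := ⟨(-n - 1).toNat, by omega⟩
      refine Or.inr ⟨m, hgb _, ?_⟩
      rw [← hgb]; congr 1; push_cast; ring
    · obtain ⟨m, rfl⟩ := Int.eq_ofNat_of_zero_le hn
      exact Or.inl ⟨m, hga _, by exact_mod_cast hga (m + 1)⟩
  have hlt : ∀ n, g n < g (n + 1) := by
    intro n
    rcases hcases n with ⟨m, h1, h2⟩ | ⟨m, h1, h2⟩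
    · rw [h1, h2, ha]; linarith [hpos _ (hapos m)]
    · rw [h1, h2, hb]; linarith [hpos _ (hbpos m)]
  have hg : StrictMono g := strictMono_int_of_lt_succ hlt
  have hgpos : ∀ n, 0 < g n := fun n => by
    simp only [g]
    split_ifs
    exacts [hapos _, hbpos _]
  refine ⟨g, hg, hgpos, fun t ht => ?_, fun n t ht => ?_⟩
  · obtain ⟨N, hN⟩ := hatop t
    obtain ⟨M, hM⟩ := hbbot t ht
    rw [← hga] at hN
    rw [← hgb] at hM
    obtain ⟨n, hn, hmax⟩ := Int.exists_greatest_of_bdd (P := fun n => g n < t)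
      ⟨N, fun z hz => (hg.lt_iff_lt.1 (hz.trans_le hN)).le⟩ ⟨_, hM⟩
    refine ⟨n, hn, ?_⟩
    by_contra! h
    have := hmax _ h
    omega
  · have ht0 : 0 < t := (hgpos n).trans_le ht.1
    refine le_trans ?_ (hle t ht0)
    obtain ⟨ht1, ht2⟩ := ht
    rcases hcases n with ⟨m, h1, h2⟩ | ⟨m, h1, h2⟩
    · have h3 := ha m
      have := hlip (a m) (hapos m) t ht0
      rw [abs_of_nonpos (by linarith)] at this
      linarith
    · have h3 := hb m
      have := hlip (b m) (hbpos m) t ht0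
      rw [abs_of_nonneg (by linarith)] at this
      linarith

/-! ### Families of radial graphs -/

/-- The unit vector of angle `θ`. -/
noncomputable def unitVec (θ : ℝ) : EuclideanSpace ℝ (Fin 2) :=
  (WithLp.equiv 2 (Fin 2 → ℝ)).symm ![Real.cos θ, Real.sin θ]

@[simp] lemma unitVec_zero (θ : ℝ) : unitVec θ 0 = Real.cos θ := rfl

@[simp] lemma unitVec_one (θ : ℝ) : unitVec θ 1 = Real.sin θ := rfl

@[simp] lemma norm_unitVec (θ : ℝ) : ‖unitVec θ‖ = 1 := by
  simp [EuclideanSpace.norm_eq, Fin.sum_univ_two]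

lemma contDiff_unitVec : ContDiff ℝ (⊤ : ℕ∞) unitVec := by
  refine contDiff_euclidean.2 fun i => ?_
  fin_cases i
  · exact Real.contDiff_cos
  · exact Real.contDiff_sin

lemma hasDerivAt_unitVec (θ : ℝ) : HasDerivAt unitVec (unitVec (θ + Real.pi / 2)) θ := by
  refine (PiLp.continuousLinearEquiv 2 ℝ (fun _ : Fin 2 => ℝ)).symm.hasFDerivAt.comp_hasDerivAt
    (f' := ![Real.cos (θ + Real.pi / 2), Real.sin (θ + Real.pi / 2)]) θ
    (hasDerivAt_pi.2 fun i => ?_)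
  fin_cases i
  · simpa [Real.cos_add_pi_div_two] using Real.hasDerivAt_cos θ
  · simpa [Real.sin_add_pi_div_two] using Real.hasDerivAt_sin θ

lemma iteratedDeriv_unitVec (n : ℕ) :
    iteratedDeriv n unitVec = fun θ => unitVec (θ + n * (Real.pi / 2)) := by
  induction n with
  | zero => simp
  | succ n ih =>
    rw [iteratedDeriv_succ, ih]
    funext θ
    rw [((hasDerivAt_unitVec _).comp_add_const θ _).deriv]
    congr 1
    push_cast
    ring

lemma norm_iteratedDeriv_smul_unitVec_le {h : ℝ → ℝ} (hh : ContDiff ℝ (⊤ : ℕ∞) h) {B : ℕ → ℝ}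
    {θ : ℝ} (hB : ∀ i, ‖iteratedDeriv i h θ‖ ≤ B i) (n : ℕ) :
    ‖iteratedDeriv n (fun θ => h θ • unitVec θ) θ‖ ≤
      ∑ j ∈ Finset.range (n + 1), n.choose j * B j := by
  rw [← norm_iteratedFDeriv_eq_norm_iteratedDeriv]
  refine (norm_iteratedFDeriv_smul_le (n := n) (N := ((⊤ : ℕ∞) : WithTop ℕ∞)) hh
    contDiff_unitVec θ (by exact_mod_cast le_top)).trans
    (Finset.sum_le_sum fun j _ => ?_)
  rw [norm_iteratedFDeriv_eq_norm_iteratedDeriv, norm_iteratedFDeriv_eq_norm_iteratedDeriv,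
    iteratedDeriv_unitVec, norm_unitVec, mul_one]
  exact mul_le_mul_of_nonneg_left (hB j) (Nat.cast_nonneg _)

/-- A function equal to a continuous function on each interval of a subdivision is continuous. -/
lemma continuousOn_of_subdivision {g : ℤ → ℝ} (hg : StrictMono g)
    (hcov : ∀ t > 0, ∃ n, t ∈ Set.Ioc (g n) (g (n + 1))) {φ : ℝ × ℝ → ℝ} {Φ : ℤ → ℝ × ℝ → ℝ}
    (hΦ : ∀ n, Continuous (Φ n))
    (hφ : ∀ n, ∀ z : ℝ × ℝ, z.1 ∈ Set.Icc (g n) (g (n + 1)) → φ z = Φ n z) :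
    ContinuousOn φ (Set.Ioi 0 ×ˢ Set.univ) := by
  rintro ⟨t, θ⟩ ⟨ht, -⟩
  refine ContinuousAt.continuousWithinAt ?_
  obtain ⟨n, hn⟩ := hcov t ht
  have hc : ∀ m, ContinuousOn φ (Prod.fst ⁻¹' Set.Icc (g m) (g (m + 1))) := fun m =>
    (hΦ m).continuousOn.congr fun z hz => hφ m z hz
  have hcl : ∀ m, IsClosed (Prod.fst ⁻¹' Set.Icc (g m) (g (m + 1)) : Set (ℝ × ℝ)) := fun m =>
    isClosed_Icc.preimage continuous_fst
  refine ((hc n).union_of_isClosed (hc (n + 1)) (hcl _) (hcl _)).continuousAt ?_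
  have hlt : t < g (n + 1 + 1) := hn.2.trans_lt (hg (by omega))
  filter_upwards [continuous_fst.continuousAt.eventually
    (Ioo_mem_nhds (a := g n) (b := g (n + 1 + 1)) (show g n < (t, θ).1 from hn.1) hlt)] with z hz
  rcases le_total z.1 (g (n + 1)) with h | h
  · exact Or.inl ⟨hz.1.le, h⟩
  · exact Or.inr ⟨h, hz.2.le⟩

/-- A family of radial graphs growing continuously from the origin, at a single point at each
time. -/
structure IsGrowth (f : ℝ → ℝ → ℝ) (X : ℝ → ℝ) : Prop where
  smooth : ∀ t > 0, ContDiff ℝ (⊤ : ℕ∞) (f t)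
  periodic : ∀ t > 0, Function.Periodic (f t) (2 * Real.pi)
  mono : ∀ θ s t, 0 < s → s ≤ t → f s θ ≤ f t θ
  cont : ContinuousOn (fun z : ℝ × ℝ => f z.1 z.2) (Set.Ioi 0 ×ˢ Set.univ)
  cont_deriv : ContinuousOn (fun z : ℝ × ℝ => deriv (f z.1) z.2) (Set.Ioi 0 ×ˢ Set.univ)
  cont_pos : ContinuousOn X (Set.Ioi 0)
  lower : ∀ t > 0, ∀ θ, t / 2 ≤ f t θ
  upper : ∀ t > 0, ∀ θ, f t θ ≤ 2 * t
  growth : ∀ t > 0, ∀ θ, (∀ s, 0 < s → s < t → f s θ < f t θ) →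
    Real.cos (X t) = Real.cos θ ∧ Real.sin (X t) = Real.sin θ

theorem exists_isGrowth {k : ℝ → ℕ} {ε : ℝ → ℝ} (hk : UpperSemicontinuousOn k (Set.Ioi 0))
    (hε : LowerSemicontinuousOn ε (Set.Ioi 0)) (hεpos : ∀ t ∈ Set.Ioi (0 : ℝ), 0 < ε t) :
    ∃ f X, IsGrowth f X ∧ ∀ t > 0, ∀ i ≤ k t, ∀ θ,
      ‖iteratedDeriv i (fun θ => (f t θ - t) • unitVec θ) θ‖ < ε t := by
  obtain ⟨H, x, B, hH, hcl, hmono, hB, hx, hx0, hx1, hgrow⟩ := exists_pointwise_growth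
  have hH0 : ∀ s θ, 0 ≤ H s θ := fun s θ => by
    rcases le_total s 0 with h | h
    · exact ((hcl s θ).1 h).ge
    · exact ((hcl 0 θ).1 le_rfl).ge.trans (hmono θ h)
  have hH1 : ∀ s θ, H s θ ≤ 1 := fun s θ => by
    rcases le_total 1 s with h | h
    · exact ((hcl s θ).2 h).le
    · exact (hmono θ h).trans ((hcl 1 θ).2 le_rfl).le
  have hB0 : ∀ i, 0 ≤ B i := fun i => (norm_nonneg _).trans (hB i 0 0 (by simp))
  let b : ℕ → ℝ := fun n => ∑ j ∈ Finset.range (n + 1), n.choose j * B j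
  have hb0 : ∀ n, 0 ≤ b n := fun n =>
    Finset.sum_nonneg fun j _ => mul_nonneg (Nat.cast_nonneg _) (hB0 j)
  let E : ℕ → ℝ := fun n => ∑ i ∈ Finset.range (n + 1), b i
  have hE0 : ∀ n, 0 ≤ E n := fun n => Finset.sum_nonneg fun i _ => hb0 i
  have hEmono : Monotone E := fun m n hmn =>
    Finset.sum_le_sum_of_subset_of_nonneg (Finset.range_subset_range.2 (by omega))
      fun i _ _ => hb0 i
  have hbE : ∀ i n, i ≤ n → b i ≤ E n := fun i n h =>
    Finset.single_le_sum (f := b) (fun i _ => hb0 i) (Finset.mem_range.2 (by omega))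
  let η : ℝ → ℝ := fun t => min (t / 2) (ε t / (2 * (1 + E (k t))))
  obtain ⟨g, hg, hgpos, hcov, hgη⟩ := exists_subdivision (η := η) (fun t ht => by
    have hE := hE0 (k t)
    have hε0 := hεpos t ht
    refine ⟨min (t / 4) (ε t / (4 * (1 + E (k t)))), by positivity, ?_⟩
    have h1 := hε t ht (ε t / 2) (by linarith)
    have h2 := hk t ht (k t + 1) (by omega)
    rw [eventually_nhdsWithin_iff] at h1 h2
    obtain ⟨r, hr, h⟩ := Metric.eventually_nhds_iff.1
      ((h1.and h2).and (lt_mem_nhds (show t / 2 < t by linarith)))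
    refine ⟨r, hr, fun s hs hst => ?_⟩
    obtain ⟨⟨h1, h2⟩, h3⟩ := h (y := s) (by rwa [Real.dist_eq])
    have hE' := hEmono (Nat.lt_succ_iff.1 (h2 hs))
    have hE'' := hE0 (k s)
    refine min_le_min (by linarith) ?_
    rw [div_le_div_iff₀ (by positivity) (by positivity)]
    nlinarith [h1 hs, mul_le_mul (h1 hs).le hE' (hE0 _) (hεpos s hs).le])
    (fun t _ => min_le_left _ _)
  have hδ : ∀ n, 0 < g (n + 1) - g n := fun n => sub_pos.2 (hg (by omega))
  let σ : ℤ → ℝ → ℝ := fun n t => (t - g n) / (g (n + 1) - g n)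
  let F : ℤ → ℝ → ℝ → ℝ := fun n t θ => g n + (g (n + 1) - g n) * H (σ n t) θ
  have hσ : ∀ n t, t ∈ Set.Icc (g n) (g (n + 1)) → σ n t ∈ Set.Icc (0 : ℝ) 1 := fun n t ht =>
    ⟨div_nonneg (sub_nonneg.2 ht.1) (hδ n).le,
      (div_le_one (hδ n)).2 (by linarith [ht.2])⟩
  have hσc : ∀ n, Continuous (σ n) := fun n => by fun_prop
  have hσl : ∀ n, σ n (g n) = 0 := fun n => by simp [σ]
  have hσr : ∀ n, σ n (g (n + 1)) = 1 := fun n => div_self (hδ n).ne'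
  have hFl : ∀ n θ, F n (g n) θ = g n := fun n θ => by
    simp only [F, hσl, (hcl 0 θ).1 le_rfl]; ring
  have hFr : ∀ n θ, F n (g (n + 1)) θ = g (n + 1) := fun n θ => by
    simp only [F, hσr, (hcl 1 θ).2 le_rfl]; ring
  have hFge : ∀ n t θ, g n ≤ F n t θ := fun n t θ =>
    le_add_of_nonneg_right (mul_nonneg (hδ n).le (hH0 _ _))
  have hFle : ∀ n t θ, F n t θ ≤ g (n + 1) := fun n t θ => by
    have := mul_le_mul_of_nonneg_left (hH1 (σ n t) θ) (hδ n).le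
    simp only [F]; linarith
  have hFmono : ∀ n θ, Monotone fun t => F n t θ := fun n θ s t hst =>
    add_le_add_right (mul_le_mul_of_nonneg_left (hmono θ
      (div_le_div_of_nonneg_right (by linarith) (hδ n).le)) (hδ n).le) _
  have hidx : ∀ t, ∃ n, 0 < t → t ∈ Set.Ioc (g n) (g (n + 1)) := fun t => by
    by_cases ht : 0 < t
    · obtain ⟨n, hn⟩ := hcov t ht
      exact ⟨n, fun _ => hn⟩
    · exact ⟨0, fun h => absurd h ht⟩
  choose N hN using hidx
  have hglue : ∀ n t, t ∈ Set.Icc (g n) (g (n + 1)) →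
      F (N t) t = F n t ∧ x (σ (N t) t) = x (σ n t) := by
    intro n t ht
    have ht' := hN t ((hgpos n).trans_le ht.1)
    have h1 : N t < n + 1 := hg.lt_iff_lt.1 (ht'.1.trans_le ht.2)
    have h2 : n ≤ N t + 1 := hg.le_iff_le.1 (ht.1.trans ht'.2)
    rcases h2.lt_or_eq with h2 | h2
    · obtain rfl : N t = n := by omega
      exact ⟨rfl, rfl⟩
    · obtain rfl : t = g n := le_antisymm (h2 ▸ ht'.2) ht.1
      generalize N (g n) = m at *
      subst h2
      exact ⟨funext fun θ => by rw [hFl, hFr], by rw [hσl, hσr, hx0, hx1]⟩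
  have hmem : ∀ t > 0, t ∈ Set.Icc (g (N t)) (g (N t + 1)) := fun t ht =>
    Set.Ioc_subset_Icc_self (hN t ht)
  have hlen : ∀ t > 0, g (N t + 1) - g (N t) ≤ t / 2 := fun t ht =>
    (hgη _ t (hmem t ht)).trans (min_le_left _ _)
  have hsm : ∀ n t, ContDiff ℝ (⊤ : ℕ∞) (F n t) := fun n t =>
    contDiff_const.add (contDiff_const.mul (hH.smooth _))
  have hdF : ∀ n t θ, deriv (F n t) θ = (g (n + 1) - g n) * deriv (H (σ n t)) θ := fun n t θ => by
    simp only [F]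
    rw [deriv_const_add, deriv_const_mul _ ((hH.smooth _).differentiable (by simp) θ)]
  refine ⟨fun t => F (N t) t, fun t => x (σ (N t) t), ⟨fun t _ => hsm _ _, fun t _ θ => ?_,
    fun θ s t hs hst => ?_, ?_, ?_, ?_, fun t ht θ => ?_, fun t ht θ => ?_,
    fun t ht θ hgr => ?_⟩, fun t ht i hi θ => ?_⟩
  · simp only [F, hH.periodic _ θ]
  · have h1 := hN s hs
    have h2 := hN t (hs.trans_le hst)
    have h3 : N s < N t + 1 := hg.lt_iff_lt.1 (h1.1.trans_le (hst.trans h2.2))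
    rcases (show N s ≤ N t by omega).lt_or_eq with h | h
    · exact (hFle _ _ _).trans ((hg.monotone (by omega)).trans (hFge _ _ _))
    · simp only [h]
      exact hFmono _ θ hst
  · refine continuousOn_of_subdivision hg hcov (Φ := fun n z => F n z.1 z.2) (fun n => ?_)
      fun n z hz => by rw [(hglue n _ hz).1]
    exact continuous_const.add (continuous_const.mul (hH.cont.comp
      (((hσc n).comp continuous_fst).prodMk continuous_snd)))
  · refine continuousOn_of_subdivision hg hcov (Φ := fun n z => deriv (F n z.1) z.2) (fun n => ?_)
      fun n z hz => by rw [(hglue n _ hz).1]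
    simp only [hdF]
    exact continuous_const.mul (hH.cont_deriv.comp
      (((hσc n).comp continuous_fst).prodMk continuous_snd))
  · have := continuousOn_of_subdivision hg hcov (φ := fun z => x (σ (N z.1) z.1))
      (Φ := fun n z => x (σ n z.1)) (fun n => hx.comp ((hσc n).comp continuous_fst))
      fun n z hz => (hglue n _ hz).2
    exact this.comp (f := fun t : ℝ => (t, (0 : ℝ))) (by fun_prop) fun t ht => ⟨ht, trivial⟩
  · linarith [hFge (N t) t θ, (hN t ht).2, hlen t ht]
  · linarith [hFle (N t) t θ, (hN t ht).1, hlen t ht]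
  · have hcancel : ∀ u, σ (N t) (g (N t) + (g (N t + 1) - g (N t)) * u) = u := fun u => by
      have := (hδ (N t)).ne'
      simp only [σ]
      field_simp
      ring
    have ht' := hN t ht
    have htσ : g (N t) + (g (N t + 1) - g (N t)) * σ (N t) t = t := by
      have := (hδ (N t)).ne'
      simp only [σ]
      field_simp
      ring
    have key : ∀ u, 0 ≤ u → u < σ (N t) t → H u θ < H (σ (N t) t) θ := by
      intro u hu hut
      have hlt := mul_lt_mul_of_pos_left hut (hδ (N t))
      have hnn := mul_nonneg (hδ (N t)).le hu
      have h := hgr (g (N t) + (g (N t + 1) - g (N t)) * u) (by linarith [hgpos (N t)])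
        (by linarith)
      have hI : g (N t) + (g (N t + 1) - g (N t)) * u ∈ Set.Icc (g (N t)) (g (N t + 1)) :=
        ⟨by linarith, by linarith [ht'.2]⟩
      simp only [(hglue _ _ hI).1] at h
      simp only [F, hcancel] at h
      exact lt_of_mul_lt_mul_left (by linarith) (hδ (N t)).le
    refine hgrow _ θ fun u hu => ?_
    rcases le_total 0 u with h | h
    · exact key u h hu
    · rw [(hcl u θ).1 h, ← (hcl 0 θ).1 le_rfl]
      exact key 0 le_rfl (div_pos (sub_pos.2 ht'.1) (hδ _))
  · have hεt := hεpos t ht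
    have hEt := hE0 (k t)
    have hne := (hδ (N t)).ne'
    have heq : (fun θ => (F (N t) t θ - t) • unitVec θ) = fun θ =>
        (g (N t + 1) - g (N t)) • ((H (σ (N t) t) θ - σ (N t) t) • unitVec θ) := by
      funext θ
      rw [smul_smul]
      congr 1
      simp only [F, σ]
      field_simp
      ring
    have hsmooth : ContDiff ℝ (⊤ : ℕ∞) fun θ => H (σ (N t) t) θ - σ (N t) t :=
      (hH.smooth _).sub contDiff_const
    have hle := (norm_iteratedDeriv_smul_unitVec_le hsmooth (B := B) (θ := θ)
      (fun j => hB j _ θ (hσ _ _ (hmem t ht))) i).trans (hbE i _ hi)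
    have hη : g (N t + 1) - g (N t) ≤ ε t / (2 * (1 + E (k t))) :=
      (hgη _ t (hmem t ht)).trans (min_le_right _ _)
    rw [le_div_iff₀ (by positivity)] at hη
    rw [heq, iteratedDeriv_fun_const_smul_field, norm_smul, Real.norm_of_nonneg (hδ _).le]
    nlinarith [mul_le_mul_of_nonneg_left hle (hδ (N t)).le, hδ (N t)]

/-! ### Polar coordinates -/

lemma unitVec_eq_iff {θ θ' : ℝ} :
    unitVec θ = unitVec θ' ↔ ∃ m : ℤ, θ' = θ + m * (2 * Real.pi) := by
  constructor
  · intro h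
    exact exists_eq_add_int_mul (congrArg (· 0) h) (congrArg (· 1) h)
  · rintro ⟨m, rfl⟩
    simp [unitVec, Real.cos_add_int_mul_two_pi, Real.sin_add_int_mul_two_pi]

lemma eq_of_unitVec_eq {θ θ' : ℝ} (h : unitVec θ = unitVec θ') {α : Type*} {P : ℝ → α}
    (hP : Function.Periodic P (2 * Real.pi)) : P θ = P θ' := by
  obtain ⟨m, rfl⟩ := unitVec_eq_iff.1 h
  exact (hP.int_mul m θ).symm

lemma norm_smul_unitVec {r : ℝ} (hr : 0 ≤ r) (θ : ℝ) : ‖r • unitVec θ‖ = r := by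
  rw [norm_smul, norm_unitVec, mul_one, Real.norm_of_nonneg hr]

lemma eq_of_smul_unitVec_eq {r r' θ θ' : ℝ} (hr : 0 < r) (hr' : 0 < r')
    (h : r • unitVec θ = r' • unitVec θ') : r = r' ∧ unitVec θ = unitVec θ' := by
  have h1 := congrArg norm h
  rw [norm_smul_unitVec hr.le, norm_smul_unitVec hr'.le] at h1
  subst h1
  exact ⟨rfl, smul_right_injective _ (ne_of_gt hr) h⟩

/-- The polar angle of a point of the plane. -/
noncomputable def polarAngle (p : EuclideanSpace ℝ (Fin 2)) : ℝ := Complex.arg ⟨p 0, p 1⟩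

lemma polarAngle_mem (p : EuclideanSpace ℝ (Fin 2)) :
    polarAngle p ∈ Set.Icc (-Real.pi) Real.pi :=
  Set.Ioc_subset_Icc_self (Complex.arg_mem_Ioc _)

lemma norm_smul_unitVec_polarAngle (p : EuclideanSpace ℝ (Fin 2)) :
    ‖p‖ • unitVec (polarAngle p) = p := by
  have hn : ‖p‖ = ‖(⟨p 0, p 1⟩ : ℂ)‖ := by
    rw [EuclideanSpace.norm_eq, Complex.norm_eq_sqrt_sq_add_sq]
    simp [Fin.sum_univ_two]
  ext i
  fin_cases i
  · simp [hn, polarAngle, Complex.norm_mul_cos_arg]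
  · simp [hn, polarAngle, Complex.norm_mul_sin_arg]

lemma hasDerivAt_smul_unitVec {h : ℝ → ℝ} {θ : ℝ} (hh : DifferentiableAt ℝ h θ) :
    HasDerivAt (fun θ => h θ • unitVec θ)
      (h θ • unitVec (θ + Real.pi / 2) + deriv h θ • unitVec θ) θ :=
  hh.hasDerivAt.smul (hasDerivAt_unitVec θ)

lemma deriv_smul_unitVec_ne_zero {h : ℝ → ℝ} {θ : ℝ} (hh : DifferentiableAt ℝ h θ)
    (h0 : h θ ≠ 0) : deriv (fun θ => h θ • unitVec θ) θ ≠ 0 := by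
  rw [(hasDerivAt_smul_unitVec hh).deriv]
  intro hv
  have h1 := congrArg (· 0) hv
  have h2 := congrArg (· 1) hv
  simp only [PiLp.add_apply, PiLp.smul_apply, unitVec_zero, unitVec_one, smul_eq_mul,
    Real.cos_add_pi_div_two, Real.sin_add_pi_div_two, PiLp.zero_apply] at h1 h2
  apply h0
  linear_combination Real.cos θ * h2 - Real.sin θ * h1 - h θ * Real.sin_sq_add_cos_sq θ

/-! ### Continuity through compact parametrizations -/

lemma continuousAt_of_lift {Z P W : Type*} [TopologicalSpace Z] [T2Space Z] [TopologicalSpace P]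
    [T2Space P] [TopologicalSpace W] {Ψ : Z → P} {V : P → W} {V' : Z → W} {C : Set Z} {p : P}
    (hC : IsCompact C) (hp : Ψ '' C ∈ nhds p) (hΨ : ContinuousOn Ψ C) (hV' : ContinuousOn V' C)
    (h : ∀ z ∈ C, V (Ψ z) = V' z) : ContinuousAt V p := by
  refine ContinuousOn.continuousAt (continuousOn_iff_isClosed.2 fun F hF => ?_) hp
  have hcpt : IsCompact (C ∩ V' ⁻¹' F) :=
    hC.of_isClosed_subset (hV'.preimage_isClosed_of_isClosed hC.isClosed hF)
      Set.inter_subset_left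
  refine ⟨Ψ '' (C ∩ V' ⁻¹' F), (hcpt.image_of_continuousOn
    (hΨ.mono Set.inter_subset_left)).isClosed, ?_⟩
  ext q
  constructor
  · rintro ⟨hq, z, hz, rfl⟩
    refine ⟨⟨z, ⟨hz, ?_⟩, rfl⟩, z, hz, rfl⟩
    rw [Set.mem_preimage, ← h z hz]
    exact hq
  · rintro ⟨⟨z, ⟨hz, hz'⟩, rfl⟩, hq⟩
    refine ⟨?_, hq⟩
    rw [Set.mem_preimage, h z hz]
    exact hz'

lemma continuousAt_comp_polarAngle {P : ℝ → ℝ} (hc : Continuous P)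
    (hP : Function.Periodic P (2 * Real.pi)) {p : EuclideanSpace ℝ (Fin 2)} (hp : p ≠ 0) :
    ContinuousAt (fun q => P (polarAngle q)) p := by
  have hp' : 0 < ‖p‖ := norm_pos_iff.2 hp
  have hu := contDiff_unitVec.continuous
  refine continuousAt_of_lift (Ψ := fun z : ℝ × ℝ => z.1 • unitVec z.2) (V' := fun z => P z.2)
    (C := Set.Icc (‖p‖ / 2) (2 * ‖p‖) ×ˢ Set.Icc (-Real.pi) Real.pi)
    (isCompact_Icc.prod isCompact_Icc) ?_ (by fun_prop) (by fun_prop) fun z hz => ?_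
  · filter_upwards [continuous_norm.continuousAt.eventually
      (Icc_mem_nhds (a := ‖p‖ / 2) (b := 2 * ‖p‖) (by linarith) (by linarith))] with q hq
    exact ⟨(‖q‖, polarAngle q), ⟨hq, polarAngle_mem q⟩, norm_smul_unitVec_polarAngle q⟩
  · have hz1 : 0 < z.1 := (by linarith : 0 < ‖p‖ / 2).trans_le hz.1.1
    have := norm_smul_unitVec_polarAngle (z.1 • unitVec z.2)
    rw [norm_smul_unitVec hz1.le] at this
    exact eq_of_unitVec_eq (eq_of_smul_unitVec_eq hz1 hz1 this).2 hP

lemma continuousOn_projectivization {V : EuclideanSpace ℝ (Fin 2) → EuclideanSpace ℝ (Fin 2)}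
    {Λ : EuclideanSpace ℝ (Fin 2) → Projectivization ℝ (EuclideanSpace ℝ (Fin 2))}
    {s : Set (EuclideanSpace ℝ (Fin 2))} (hV : ContinuousOn V s) (h0 : ∀ p ∈ s, V p ≠ 0)
    (hΛ : ∀ p (hp : p ∈ s), Λ p = Projectivization.mk ℝ (V p) (h0 p hp)) :
    ContinuousOn Λ s := by
  rw [continuousOn_iff_continuous_domRestrict]
  have h1 : Continuous fun p : s =>
      (⟨V p, h0 p p.2⟩ : {v : EuclideanSpace ℝ (Fin 2) // v ≠ 0}) :=
    (continuousOn_iff_continuous_domRestrict.1 hV).subtype_mk _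
  have h2 : s.domRestrict Λ = fun p : s => Projectivization.mk ℝ (V p) (h0 p p.2) :=
    funext fun p => hΛ p p.2
  rw [h2]
  exact (continuous_quotient_mk'
    (s := projectivizationSetoid ℝ (EuclideanSpace ℝ (Fin 2)))).comp h1

/-! ### The curve traced by a growth -/

/-- The curve following the growing point of a family of radial graphs. -/
noncomputable def growthCurve (f : ℝ → ℝ → ℝ) (X : ℝ → ℝ) (t : ℝ) : EuclideanSpace ℝ (Fin 2) :=
  if 0 < t then f t (X t) • unitVec (X t) else 0

namespace IsGrowth

lemma pos {f : ℝ → ℝ → ℝ} {X : ℝ → ℝ} (hf : IsGrowth f X)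
    {t : ℝ} (ht : 0 < t) (θ : ℝ) : 0 < f t θ :=
  (half_pos ht).trans_le (hf.lower t ht θ)

lemma continuous_growthCurve {f : ℝ → ℝ → ℝ} {X : ℝ → ℝ} (hf : IsGrowth f X) :
    Continuous (growthCurve f X) := by
  refine continuous_iff_continuousAt.2 fun t => ?_
  rcases lt_trichotomy t 0 with ht | rfl | ht
  · refine (continuousAt_const (y := 0)).congr ?_
    filter_upwards [gt_mem_nhds ht] with s hs
    rw [growthCurve, if_neg hs.le.not_gt]
  · have h0 : growthCurve f X 0 = 0 := if_neg (lt_irrefl _)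
    rw [ContinuousAt, h0]
    refine squeeze_zero_norm (a := fun t => 2 * |t|) (fun t => ?_) ?_
    · rw [growthCurve]
      split_ifs with ht
      · rw [norm_smul_unitVec (hf.pos ht _).le, abs_of_pos ht]
        exact hf.upper t ht _
      · simp
    · have : Continuous fun t : ℝ => 2 * |t| := by fun_prop
      simpa using this.tendsto 0
  · have hX : ContinuousAt X t := hf.cont_pos.continuousAt (Ioi_mem_nhds ht)
    have hfX : ContinuousAt (fun s => f s (X s)) t :=
      ContinuousAt.comp (f := fun s => (s, X s)) (g := fun z : ℝ × ℝ => f z.1 z.2)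
        (hf.cont.continuousAt (prod_mem_nhds (Ioi_mem_nhds ht) Filter.univ_mem))
        (continuousAt_id.prodMk hX)
    refine (hfX.smul (contDiff_unitVec.continuous.continuousAt.comp hX)).congr ?_
    filter_upwards [lt_mem_nhds ht] with s hs
    rw [growthCurve, if_pos hs]
    rfl

lemma continuousOn_time {f : ℝ → ℝ → ℝ} {X : ℝ → ℝ} (hf : IsGrowth f X)
    (θ : ℝ) : ContinuousOn (fun t => f t θ) (Set.Ioi 0) :=
  hf.cont.comp (f := fun t => (t, θ)) (by fun_prop) fun _ ht => ⟨ht, trivial⟩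

/-- Every point is reached when the family first passes through it. -/
lemma exists_growthCurve_eq {f : ℝ → ℝ → ℝ} {X : ℝ → ℝ} (hf : IsGrowth f X)
    {r t θ : ℝ} (hr : 0 < r) (ht : 0 < t) (hrt : r ≤ f t θ) :
    ∃ s ∈ Set.Icc 0 t, growthCurve f X s = r • unitVec θ := by
  have hpos : ∀ s ∈ Set.Icc (r / 2) t, 0 < s := fun s hs => (half_pos hr).trans_le hs.1
  have hcpt : IsCompact (Set.Icc (r / 2) t ∩ (fun s => f s θ) ⁻¹' Set.Ici r) :=
    isCompact_Icc.of_isClosed_subset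
      (((hf.continuousOn_time θ).mono hpos).preimage_isClosed_of_isClosed
        isClosed_Icc isClosed_Ici) Set.inter_subset_left
  have hlow : ∀ s > 0, r ≤ f s θ → r / 2 ≤ s := fun s hs h => by
    linarith [hf.upper s hs θ]
  obtain ⟨s, ⟨hs, hrs⟩, hmin⟩ := hcpt.exists_isLeast ⟨t, ⟨hlow t ht hrt, le_rfl⟩, hrt⟩
  have hs0 := hpos s hs
  have hlt : ∀ u, 0 < u → u < s → f u θ < r := by
    intro u hu hus
    by_contra! h
    exact hus.not_ge (hmin ⟨⟨hlow u hu h, hus.le.trans hs.2⟩, h⟩)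
  have heq : f s θ = r := by
    refine le_antisymm ?_ hrs
    refine le_of_tendsto (((hf.continuousOn_time θ).continuousAt
      (Ioi_mem_nhds hs0)).tendsto.mono_left (nhdsWithin_le_nhds (s := Set.Iio s))) ?_
    filter_upwards [Ioo_mem_nhdsLT hs0] with u hu
    exact (hlt u hu.1 hu.2).le
  obtain ⟨hc, hsin⟩ := hf.growth s hs0 θ fun u hu hus => heq ▸ hlt u hu hus
  have hX : unitVec (X s) = unitVec θ := unitVec_eq_iff.2 (exists_eq_add_int_mul hc hsin)
  refine ⟨s, ⟨hs0.le, hs.2⟩, ?_⟩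
  rw [growthCurve, if_pos hs0, hX, eq_of_unitVec_eq hX (hf.periodic s hs0), heq]

lemma smul_unitVec_mem_image_iff {f : ℝ → ℝ → ℝ} {X : ℝ → ℝ} (hf : IsGrowth f X)
    {r t θ : ℝ} (hr : 0 ≤ r) (ht : 0 < t) :
    r • unitVec θ ∈ growthCurve f X '' Set.Icc 0 t ↔ r ≤ f t θ := by
  rcases hr.eq_or_lt with rfl | hr
  · refine iff_of_true ⟨0, by simp [ht.le], ?_⟩ (hf.pos ht θ).le
    simp [growthCurve]
  · refine ⟨?_, hf.exists_growthCurve_eq hr ht⟩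
    rintro ⟨s, hs, h⟩
    rcases hs.1.eq_or_lt with rfl | hs0
    · have := congrArg norm h
      rw [norm_smul_unitVec hr.le, growthCurve, if_neg (lt_irrefl _), norm_zero] at this
      exact absurd this hr.ne
    · rw [growthCurve, if_pos hs0] at h
      obtain ⟨h1, h2⟩ := eq_of_smul_unitVec_eq (hf.pos hs0 _) hr h
      rw [← h1, eq_of_unitVec_eq h2 (hf.periodic s hs0)]
      exact hf.mono _ _ _ hs0 hs.2

lemma mem_image_iff {f : ℝ → ℝ → ℝ} {X : ℝ → ℝ} (hf : IsGrowth f X)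
    {t : ℝ} (ht : 0 < t) {p : EuclideanSpace ℝ (Fin 2)} :
    p ∈ growthCurve f X '' Set.Icc 0 t ↔ ‖p‖ ≤ f t (polarAngle p) := by
  rw [← hf.smul_unitVec_mem_image_iff (norm_nonneg p) ht, norm_smul_unitVec_polarAngle]

lemma ball_subset_image {f : ℝ → ℝ → ℝ} {X : ℝ → ℝ} (hf : IsGrowth f X)
    {t : ℝ} (ht : 0 < t) :
    Metric.ball 0 (t / 2) ⊆ growthCurve f X '' Set.Icc 0 t := by
  intro p hp
  rw [hf.mem_image_iff ht]
  exact (mem_ball_zero_iff.1 hp).le.trans (hf.lower t ht _)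

lemma frontier_image {f : ℝ → ℝ → ℝ} {X : ℝ → ℝ} (hf : IsGrowth f X)
    {t : ℝ} (ht : 0 < t) :
    frontier (growthCurve f X '' Set.Icc 0 t) = Set.range fun θ => f t θ • unitVec θ := by
  have hcl : IsClosed (growthCurve f X '' Set.Icc 0 t) :=
    (isCompact_Icc.image hf.continuous_growthCurve).isClosed
  rw [hcl.frontier_eq]
  ext p
  constructor
  · rintro ⟨hp, hint⟩
    refine ⟨polarAngle p, ?_⟩
    suffices h : f t (polarAngle p) = ‖p‖ by
      simp only [h, norm_smul_unitVec_polarAngle]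
    refine le_antisymm (not_lt.1 fun hlt => hint ?_) ((hf.mem_image_iff ht).1 hp)
    rw [mem_interior_iff_mem_nhds]
    rcases eq_or_ne p 0 with rfl | h0
    · exact Filter.mem_of_superset (Metric.ball_mem_nhds 0 (half_pos ht)) (hf.ball_subset_image ht)
    · filter_upwards [continuous_norm.continuousAt.eventually_lt (continuousAt_comp_polarAngle
        (hf.smooth t ht).continuous (hf.periodic t ht) h0) hlt] with q hq
      exact (hf.mem_image_iff ht).2 hq.le
  · rintro ⟨θ, rfl⟩
    have hpos := hf.pos ht θ
    refine ⟨(hf.smul_unitVec_mem_image_iff hpos.le ht).2 le_rfl, fun hint => ?_⟩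
    have hc : Continuous fun r : ℝ => r • unitVec θ := by fun_prop
    have hev := hc.continuousAt.eventually (mem_interior_iff_mem_nhds.1 hint)
    obtain ⟨r, hr, hlt⟩ := ((hev.filter_mono nhdsWithin_le_nhds).and
      (self_mem_nhdsWithin (s := Set.Ioi (f t θ)))).exists
    have hlt' : f t θ < r := hlt
    exact hlt'.not_ge ((hf.smul_unitVec_mem_image_iff (hpos.trans hlt').le ht).1 hr)

/-- Two graphs of the family through the same point are tangent there. -/
lemma deriv_eq {f : ℝ → ℝ → ℝ} {X : ℝ → ℝ} (hf : IsGrowth f X)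
    {s t θ : ℝ} (hs : 0 < s) (ht : 0 < t) (h : f s θ = f t θ) :
    deriv (f s) θ = deriv (f t) θ := by
  wlog hst : s ≤ t generalizing s t
  · exact (this ht hs h.symm (le_of_not_ge hst)).symm
  have hd : ∀ u > 0, DifferentiableAt ℝ (f u) θ := fun u hu =>
    (hf.smooth u hu).differentiable (by simp) θ
  have hmin : IsLocalMin (fun φ => f t φ - f s φ) θ := Filter.Eventually.of_forall fun φ => by
    have := hf.mono φ s t hs hst
    simp only [h, sub_self]
    linarith
  have := hmin.deriv_eq_zero
  rw [deriv_fun_sub (hd t ht) (hd s hs)] at this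
  linarith

lemma exists_time {f : ℝ → ℝ → ℝ} {X : ℝ → ℝ} (hf : IsGrowth f X)
    {p : EuclideanSpace ℝ (Fin 2)} (hp : p ≠ 0) :
    ∃ t ∈ Set.Icc (‖p‖ / 2) (2 * ‖p‖), f t (polarAngle p) = ‖p‖ := by
  have hp' : 0 < ‖p‖ := norm_pos_iff.2 hp
  refine intermediate_value_Icc (by linarith) ((hf.continuousOn_time _).mono fun t ht =>
    (half_pos hp').trans_le ht.1) ⟨?_, ?_⟩
  · linarith [hf.upper (‖p‖ / 2) (by linarith) (polarAngle p)]
  · linarith [hf.lower (2 * ‖p‖) (by linarith) (polarAngle p)]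

/-- The common tangent vector field of the graphs of the family. -/
lemma exists_tangent_field {f : ℝ → ℝ → ℝ} {X : ℝ → ℝ} (hf : IsGrowth f X) :
    ∃ V : EuclideanSpace ℝ (Fin 2) → EuclideanSpace ℝ (Fin 2),
    ContinuousOn V {p | p ≠ 0} ∧ (∀ p ≠ 0, V p ≠ 0) ∧
    ∀ t > 0, ∀ θ, V (f t θ • unitVec θ) = deriv (fun θ => f t θ • unitVec θ) θ := by
  have hd : ∀ t > 0, ∀ θ, DifferentiableAt ℝ (f t) θ := fun t ht θ =>
    (hf.smooth t ht).differentiable (by simp) θ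
  have hT : ∀ p : EuclideanSpace ℝ (Fin 2), ∃ t, p ≠ 0 →
      t ∈ Set.Icc (‖p‖ / 2) (2 * ‖p‖) ∧ f t (polarAngle p) = ‖p‖ := fun p => by
    by_cases hp : p = 0
    · exact ⟨0, fun h => absurd hp h⟩
    · obtain ⟨t, h⟩ := hf.exists_time hp
      exact ⟨t, fun _ => h⟩
  choose T hT using hT
  have hTpos : ∀ p, p ≠ 0 → 0 < T p := fun p hp =>
    (half_pos (norm_pos_iff.2 hp)).trans_le (hT p hp).1.1
  let W : ℝ × ℝ → EuclideanSpace ℝ (Fin 2) := fun z =>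
    f z.1 z.2 • unitVec (z.2 + Real.pi / 2) + deriv (f z.1) z.2 • unitVec z.2
  have hW : ∀ t > 0, ∀ θ, deriv (fun θ => f t θ • unitVec θ) θ = W (t, θ) := fun t ht θ =>
    (hasDerivAt_smul_unitVec (hd t ht θ)).deriv
  have hu := contDiff_unitVec.continuous
  have hWc : ContinuousOn W (Set.Ioi 0 ×ˢ Set.univ) :=
    (hf.cont.smul (by fun_prop)).add (hf.cont_deriv.smul (by fun_prop))
  let V : EuclideanSpace ℝ (Fin 2) → EuclideanSpace ℝ (Fin 2) := fun p => W (T p, polarAngle p)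
  have hVW : ∀ t > 0, ∀ θ, V (f t θ • unitVec θ) = W (t, θ) := by
    intro t ht θ
    have hpos := hf.pos ht θ
    set p := f t θ • unitVec θ with hp
    have hnorm : ‖p‖ = f t θ := norm_smul_unitVec hpos.le θ
    have hp0 : p ≠ 0 := norm_pos_iff.1 (hnorm ▸ hpos)
    have hT0 := hTpos p hp0
    have hu := norm_smul_unitVec_polarAngle p
    rw [hnorm] at hu
    have hu := (eq_of_smul_unitVec_eq hpos hpos hu).2
    have hfT : f (T p) θ = f t θ := by
      rw [← eq_of_unitVec_eq hu (hf.periodic _ hT0), (hT p hp0).2, hnorm]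
    have h1 : f (T p) (polarAngle p) = f t θ := (hT p hp0).2.trans hnorm
    have h2 : deriv (f (T p)) (polarAngle p) = deriv (f t) θ := by
      have hper : Function.Periodic (deriv (f (T p))) (2 * Real.pi) := fun φ => by
        rw [← deriv_comp_add_const]
        exact congrArg (deriv · φ) (funext (hf.periodic _ hT0))
      rw [eq_of_unitVec_eq hu hper, hf.deriv_eq hT0 ht hfT]
    have h3 : unitVec (polarAngle p + Real.pi / 2) = unitVec (θ + Real.pi / 2) := by
      obtain ⟨m, hm⟩ := unitVec_eq_iff.1 hu
      exact unitVec_eq_iff.2 ⟨m, by rw [hm]; ring⟩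
    simp only [V, W, h1, h2, h3, hu]
  refine ⟨V, fun p hp => ContinuousAt.continuousWithinAt ?_, fun p hp => ?_, fun t ht θ => ?_⟩
  · have hp' : 0 < ‖p‖ := norm_pos_iff.2 hp
    have hsub : Set.Icc (‖p‖ / 4) (4 * ‖p‖) ×ˢ Set.Icc (-Real.pi) Real.pi ⊆
        Set.Ioi (0 : ℝ) ×ˢ (Set.univ : Set ℝ) := fun z hz =>
      ⟨(by linarith : 0 < ‖p‖ / 4).trans_le hz.1.1, trivial⟩
    refine continuousAt_of_lift (Ψ := fun z : ℝ × ℝ => f z.1 z.2 • unitVec z.2) (V' := W)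
      (isCompact_Icc.prod isCompact_Icc) ?_ ((hf.cont.mono hsub).smul (by fun_prop))
      (hWc.mono hsub) fun z hz => hVW z.1 (hsub hz).1 z.2
    filter_upwards [continuous_norm.continuousAt.eventually
      (Ioo_mem_nhds (a := ‖p‖ / 2) (b := 2 * ‖p‖) (by linarith) (by linarith))] with q hq
    have hq0 : q ≠ 0 := norm_pos_iff.1 ((half_pos hp').trans hq.1)
    obtain ⟨⟨h1, h2⟩, h3⟩ := hT q hq0
    refine ⟨(T q, polarAngle q), ⟨⟨?_, ?_⟩, polarAngle_mem q⟩, ?_⟩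
    · exact le_trans (by linarith [hq.1]) h1
    · exact h2.trans (by linarith [hq.2])
    · simp only [h3, norm_smul_unitVec_polarAngle]
  · simp only [V]
    rw [← hW _ (hTpos p hp)]
    exact deriv_smul_unitVec_ne_zero (hd _ (hTpos p hp) _) (hf.pos (hTpos p hp) _).ne'
  · rw [hVW t ht, hW t ht]

end IsGrowth

end Footprint

/-- Let `k : (0,∞) → ℕ` be upper semicontinuous and `ε : (0,∞) → (0,∞)`
lower semicontinuous. Then there exist a Peano curve `γ : [0,∞) → ℝ²` and a continuous
line field `Λ` on `ℝ² \\ {γ 0}` such that for every `t > 0` the boundary of `γ([0,t])`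
is the image of a `C^∞` embedding `β : 𝕋 → ℝ²` (encoded as a smooth `2π`-periodic map
`β : ℝ → ℝ²`, injective modulo `2π`, with nonvanishing derivative) containing `γ t`,
tangent to `Λ` at every point, and satisfying `‖β − α_t‖_{k t} < ε t`, where
`α_t(θ) = (t cos θ, t sin θ)` and the `C^k` norm is the maximum over `i ≤ k` of the
(attained) supremum over `θ` of the Euclidean norm of the `i`-th derivative. -/
theorem exists_peano_curve_with_footprints_close_to_circles
    (k : ℝ → ℕ) (ε : ℝ → ℝ)
    (hk : UpperSemicontinuousOn k (Set.Ioi 0))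
    (hε : LowerSemicontinuousOn ε (Set.Ioi 0))
    (hεpos : ∀ t ∈ Set.Ioi (0:ℝ), 0 < ε t) :
    ∃ (γ : ℝ → EuclideanSpace ℝ (Fin 2))
      (Λ : EuclideanSpace ℝ (Fin 2) → Projectivization ℝ (EuclideanSpace ℝ (Fin 2))),
      ContinuousOn γ (Set.Ici 0) ∧
      (interior (γ '' Set.Ici 0)).Nonempty ∧
      ContinuousOn Λ {p | p ≠ γ 0} ∧
      ∀ t : ℝ, 0 < t →
        ∃ β : ℝ → EuclideanSpace ℝ (Fin 2),
          ContDiff ℝ (⊤ : ℕ∞) β ∧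
          Function.Periodic β (2 * Real.pi) ∧
          (∀ θ₁ θ₂ : ℝ, β θ₁ = β θ₂ ↔ ∃ m : ℤ, θ₂ = θ₁ + m * (2 * Real.pi)) ∧
          frontier (γ '' Set.Icc 0 t) = Set.range β ∧
          γ t ∈ frontier (γ '' Set.Icc 0 t) ∧
          (∀ θ : ℝ, ∃ h : deriv β θ ≠ 0,
            Λ (β θ) = Projectivization.mk ℝ (deriv β θ) h) ∧
          (∀ i ≤ k t, ∀ θ : ℝ,
            ‖iteratedDeriv i
                (fun θ' : ℝ => β θ' -
                  t • (WithLp.equiv 2 (Fin 2 → ℝ)).symm ![Real.cos θ', Real.sin θ']) θ‖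
              < ε t) := by
  obtain ⟨f, X, hf, hfε⟩ := Footprint.exists_isGrowth hk hε hεpos
  obtain ⟨V, hV, hV0, hVt⟩ := hf.exists_tangent_field
  have hγ0 : Footprint.growthCurve f X 0 = 0 := if_neg (lt_irrefl _)
  have hγ := hf.continuous_growthCurve
  let Λ : EuclideanSpace ℝ (Fin 2) → Projectivization ℝ (EuclideanSpace ℝ (Fin 2)) := fun p =>
    if hp : p = 0 then
      Projectivization.mk ℝ (Footprint.unitVec 0) (norm_ne_zero_iff.1 (by simp))
    else Projectivization.mk ℝ (V p) (hV0 p hp)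
  refine ⟨Footprint.growthCurve f X, Λ, hγ.continuousOn, ?_, ?_, fun t ht =>
    ⟨fun θ => f t θ • Footprint.unitVec θ, (hf.smooth t ht).smul Footprint.contDiff_unitVec,
      ?_, fun θ₁ θ₂ => ⟨fun h => ?_, ?_⟩, hf.frontier_image ht, ?_, fun θ => ?_,
      fun i hi θ => ?_⟩⟩
  · exact ⟨0, interior_mono (Set.image_mono Set.Icc_subset_Ici_self)
      (interior_maximal (hf.ball_subset_image one_pos) Metric.isOpen_ball
        (Metric.mem_ball_self (by norm_num)))⟩
  · rw [hγ0]
    exact Footprint.continuousOn_projectivization hV hV0 fun p hp => dif_neg hp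
  · intro θ
    have : Footprint.unitVec (θ + 2 * Real.pi) = Footprint.unitVec θ := by
      simp [Footprint.unitVec]
    simp only [hf.periodic t ht θ, this]
  · exact Footprint.unitVec_eq_iff.1
      (Footprint.eq_of_smul_unitVec_eq (hf.pos ht _) (hf.pos ht _) h).2
  · intro h
    have h := Footprint.unitVec_eq_iff.2 h
    simp only [h, Footprint.eq_of_unitVec_eq h (hf.periodic t ht)]
  · rw [hf.frontier_image ht, Footprint.growthCurve, if_pos ht]
    exact ⟨X t, rfl⟩
  · have hne : f t θ • Footprint.unitVec θ ≠ 0 := by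
      rw [← norm_pos_iff, Footprint.norm_smul_unitVec (hf.pos ht θ).le]
      exact hf.pos ht θ
    refine ⟨hVt t ht θ ▸ hV0 _ hne, ?_⟩
    simp only [Λ, dif_neg hne, hVt t ht θ]
  · have := hfε t ht i hi θ
    simp only [sub_smul] at this
    exact this
end
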